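/- Let n ≥ 4 and let p satisfy 2n/(n+1) < p < 2(n−1)/(n−3). Then there exists a constant C ∈ (0,∞) such that for every Schwartz function g on ℝⁿ, defining u(x,t) = ∫_{ℝⁿ} e^{2πi x·ξ} (sin(2πt|ξ|)/(2π|ξ|)) ĝ(ξ) dξ for t > 0 (the solution of the wave equation ∂²_t u = Δu with u(·,0)=0, ∂_t u(·,0)=g), one has ‖ sup_{t>0} t^{−1}|u(·,t)| ‖_{L^p(ℝⁿ)} ≤ C ‖g‖_{L^p(ℝⁿ)}. -/

import Mathlib

open MeasureTheory Filter Metric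
open scoped ENNReal RealInnerProductSpace Topology

/-- The Fourier transform `f̂(ξ) = ∫ f(x) e^{-2πi x·ξ} dx`. -/
noncomputable def fourierT {n : ℕ} (f : EuclideanSpace ℝ (Fin n) → ℂ)
    (ξ : EuclideanSpace ℝ (Fin n)) : ℂ :=
  ∫ x, Complex.exp (((-(2 * Real.pi * ⟪x, ξ⟫) : ℝ) : ℂ) * Complex.I) * f x

/-- `u(x,t) = ∫ e^{2πi x·ξ} (sin(2πt|ξ|)/(2π|ξ|)) ĝ(ξ) dξ`, the solution of the wave equation
`∂²_t u = Δu` with `u(·,0) = 0`, `∂_t u(·,0) = g`. -/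
noncomputable def waveSol (n : ℕ) (g : EuclideanSpace ℝ (Fin n) → ℂ)
    (x : EuclideanSpace ℝ (Fin n)) (t : ℝ) : ℂ :=
  ∫ ξ, Complex.exp (((2 * Real.pi * ⟪x, ξ⟫ : ℝ) : ℂ) * Complex.I) *
    ((Real.sin (2 * Real.pi * t * ‖ξ‖) / (2 * Real.pi * ‖ξ‖) : ℝ) : ℂ) * fourierT g ξ

open scoped FourierTransform

/-- The Fourier transform of the one-dimensional Poisson symbol. -/
lemma fourier_exp_neg_abs {a : ℝ} (ha : 0 < a) :
    𝓕 (fun v : ℝ => (Real.exp (-(2 * Real.pi * a * |v|)) : ℂ)) =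
      fun w : ℝ => ((a / (Real.pi * (a ^ 2 + w ^ 2)) : ℝ) : ℂ) := by
  funext w
  have hpi := Real.pi_pos
  rw [Real.fourier_eq']
  have hc1 : (-(2 * Real.pi * (a + w * Complex.I)) : ℂ).re < 0 := by
    simp; positivity
  have hc2 : 0 < (2 * Real.pi * (a - w * Complex.I) : ℂ).re := by
    simp; positivity
  have e1 : Set.EqOn (fun v : ℝ => Complex.exp (((-2 * Real.pi * ⟪v, w⟫ : ℝ) : ℂ) * Complex.I) •
      (Real.exp (-(2 * Real.pi * a * |v|)) : ℂ))
      (fun v : ℝ => Complex.exp ((-(2 * Real.pi * (a + w * Complex.I)) : ℂ) * v)) (Set.Ioi 0) := by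
    intro v hv
    simp only [smul_eq_mul, Complex.ofReal_exp, ← Complex.exp_add]
    congr 1
    rw [abs_of_pos hv]
    simp
    ring
  have e2 : Set.EqOn (fun v : ℝ => Complex.exp (((-2 * Real.pi * ⟪v, w⟫ : ℝ) : ℂ) * Complex.I) •
      (Real.exp (-(2 * Real.pi * a * |v|)) : ℂ))
      (fun v : ℝ => Complex.exp ((2 * Real.pi * (a - w * Complex.I) : ℂ) * v)) (Set.Iic 0) := by
    intro v hv
    simp only [smul_eq_mul, Complex.ofReal_exp, ← Complex.exp_add]
    congr 1
    rw [abs_of_nonpos hv]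
    simp
    ring
  have i1 := integrableOn_exp_mul_complex_Ioi hc1 0
  have i2 := integrableOn_exp_mul_complex_Iic hc2 0
  rw [← integral_add_compl (s := Set.Iic (0:ℝ)) measurableSet_Iic, Set.compl_Iic,
    setIntegral_congr_fun measurableSet_Iic e2, setIntegral_congr_fun measurableSet_Ioi e1,
    integral_exp_mul_complex_Ioi hc1, integral_exp_mul_complex_Iic hc2]
  · have h1 : (a + w * Complex.I : ℂ) ≠ 0 := by
      intro h; have := congrArg Complex.re h; simp at this; linarith
    have h2 : (a - w * Complex.I : ℂ) ≠ 0 := by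
      intro h; have := congrArg Complex.re h; simp at this; linarith
    have h3 : (a ^ 2 + w ^ 2 : ℂ) = (a + w * Complex.I) * (a - w * Complex.I) := by
      ring_nf; simp
    have h4 : (Real.pi : ℂ) ≠ 0 := by exact_mod_cast hpi.ne'
    push_cast
    rw [h3]
    simp only [mul_zero, Complex.exp_zero]
    field_simp
    ring
  · rw [← integrableOn_univ, ← Set.Iic_union_Ioi (a := (0:ℝ))]
    exact ((integrableOn_congr_fun e2 measurableSet_Iic).2 i2).union
      ((integrableOn_congr_fun e1 measurableSet_Ioi).2 i1)

/-- Subordination of the Poisson symbol to Gaussians. -/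
lemma poisson_subordination {a : ℝ} (ha : 0 < a) (r : ℝ) :
    ∫ s in Set.Ioi (0 : ℝ), a * s ^ (-(1 / 2) : ℝ) *
      Real.exp (-(Real.pi * s * a ^ 2) - Real.pi * r ^ 2 / s) =
      Real.exp (-(2 * Real.pi * a * |r|)) := by
  have hpi := Real.pi_pos
  have hcont : Continuous (fun v : ℝ => (Real.exp (-(2 * Real.pi * a * |v|)) : ℂ)) := by fun_prop
  have hF := fourier_exp_neg_abs ha
  have hq : ∀ v : ℝ, 0 < a ^ 2 + v ^ 2 := fun v => by positivity
  have hcauchy : Integrable (fun w : ℝ => a / (Real.pi * (a ^ 2 + w ^ 2))) := by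
    have := (integrable_inv_one_add_sq.comp_div ha.ne').const_mul (1 / (Real.pi * a))
    refine this.congr (Eventually.of_forall fun w => ?_)
    have := hq w
    have h2 : 0 < 1 + (w / a) ^ 2 := by positivity
    simp only
    field_simp
  have hInt : Integrable (fun v : ℝ => (Real.exp (-(2 * Real.pi * a * |v|)) : ℂ)) := by
    have : Integrable (fun v : ℝ => Real.exp (-(2 * Real.pi * a * |v|))) := by
      have h1 : IntegrableOn (fun v : ℝ => Real.exp (-(2 * Real.pi * a * |v|))) (Set.Ioi 0) := by
        refine (integrableOn_congr_fun (fun v hv => ?_) measurableSet_Ioi).2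
          (integrableOn_exp_mul_Ioi (a := -(2 * Real.pi * a)) (by
            have : 0 < 2 * Real.pi * a := by positivity
            linarith) 0)
        rw [abs_of_pos hv, neg_mul]
      have h2 : IntegrableOn (fun v : ℝ => Real.exp (-(2 * Real.pi * a * |v|))) (Set.Iic 0) := by
        refine (integrableOn_congr_fun (fun v hv => ?_) measurableSet_Iic).2
          (integrableOn_exp_mul_Iic (a := 2 * Real.pi * a) (by positivity) 0)
        rw [abs_of_nonpos hv]; simp only [mul_neg, neg_neg]
      rw [← integrableOn_univ, ← Set.Iic_union_Ioi (a := (0:ℝ))]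
      exact h2.union h1
    exact this.ofReal
  have hinv := congrFun (hcont.fourierInv_fourier_eq hInt (by rw [hF]; exact hcauchy.ofReal)) r
  rw [hF, Real.fourierInv_eq'] at hinv
  have key : ∀ v : ℝ, (∫ s in Set.Ioi (0:ℝ), a * Real.exp (-(Real.pi * s * (a ^ 2 + v ^ 2)))) =
      a / (Real.pi * (a ^ 2 + v ^ 2)) := by
    intro v
    have h := Real.integral_rpow_mul_exp_neg_mul_Ioi (a := 1) (r := Real.pi * (a ^ 2 + v ^ 2))
      one_pos (by have := hq v; positivity)
    rw [integral_const_mul]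
    simp only [sub_self, Real.rpow_zero, one_mul, Real.rpow_one, Real.Gamma_one, mul_one] at h
    rw [div_eq_mul_one_div, ← h]
    congr 2; ext s; congr 2; ring
  have hsec : ∀ v : ℝ, Integrable (fun s => a * Real.exp (-(Real.pi * s * (a ^ 2 + v ^ 2))))
      (volume.restrict (Set.Ioi (0:ℝ))) := by
    intro v
    by_contra h
    have := key v
    rw [integral_undef h] at this
    have h3 : 0 < a / (Real.pi * (a ^ 2 + v ^ 2)) := by have := hq v; positivity
    linarith
  have hprod : Integrable (fun q : ℝ × ℝ => Complex.exp (((2 * Real.pi * ⟪q.1, r⟫ : ℝ) : ℂ) *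
      Complex.I) * ((a * Real.exp (-(Real.pi * q.2 * (a ^ 2 + q.1 ^ 2))) : ℝ) : ℂ))
      (volume.prod (volume.restrict (Set.Ioi (0:ℝ)))) := by
    rw [integrable_prod_iff (by
      apply Continuous.aestronglyMeasurable
      simp only [RCLike.inner_apply, conj_trivial]
      fun_prop)]
    refine ⟨Eventually.of_forall fun v => ?_, ?_⟩
    · exact (Integrable.ofReal (𝕜 := ℂ) (hsec v)).const_mul
        (Complex.exp (((2 * Real.pi * ⟪v, r⟫ : ℝ) : ℂ) * Complex.I))
    · refine hcauchy.congr (Eventually.of_forall fun v => ?_)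
      simp only
      rw [← key v]
      refine integral_congr_ae (Eventually.of_forall fun s => ?_)
      simp only [norm_mul, Complex.norm_exp_ofReal_mul_I, one_mul, Complex.norm_real,
        Real.norm_eq_abs]
      rw [abs_of_pos ha, abs_of_pos (Real.exp_pos _)]
  have hswap := integral_integral_swap (f := fun v s : ℝ => Complex.exp
      (((2 * Real.pi * ⟪v, r⟫ : ℝ) : ℂ) * Complex.I) *
        ((a * Real.exp (-(Real.pi * s * (a ^ 2 + v ^ 2))) : ℝ) : ℂ)) hprod
  have hL : ∀ v : ℝ, ∫ s in Set.Ioi (0:ℝ), Complex.exp (((2 * Real.pi * ⟪v, r⟫ : ℝ) : ℂ) *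
      Complex.I) * ((a * Real.exp (-(Real.pi * s * (a ^ 2 + v ^ 2))) : ℝ) : ℂ) =
      Complex.exp (((2 * Real.pi * ⟪v, r⟫ : ℝ) : ℂ) * Complex.I) •
        ((a / (Real.pi * (a ^ 2 + v ^ 2)) : ℝ) : ℂ) := by
    intro v
    rw [integral_const_mul, integral_complex_ofReal, key v, smul_eq_mul]
  simp only [hL] at hswap
  rw [hswap] at hinv
  have hR : ∀ s ∈ Set.Ioi (0:ℝ), ∫ v : ℝ, Complex.exp (((2 * Real.pi * ⟪v, r⟫ : ℝ) : ℂ) *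
      Complex.I) * ((a * Real.exp (-(Real.pi * s * (a ^ 2 + v ^ 2))) : ℝ) : ℂ) =
      ((a * s ^ (-(1 / 2) : ℝ) *
        Real.exp (-(Real.pi * s * a ^ 2) - Real.pi * r ^ 2 / s) : ℝ) : ℂ) := by
    intro s hs
    have hs : 0 < s := hs
    have hb : 0 < ((Real.pi * s : ℝ) : ℂ).re := by simp; positivity
    have h := fourierIntegral_gaussian hb (2 * Real.pi * r : ℂ)
    have e : ∀ v : ℝ, Complex.exp (((2 * Real.pi * ⟪v, r⟫ : ℝ) : ℂ) *
      Complex.I) * ((a * Real.exp (-(Real.pi * s * (a ^ 2 + v ^ 2))) : ℝ) : ℂ) =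
      (a * Complex.exp (-(Real.pi * s * a ^ 2))) * (Complex.exp (Complex.I * (2 * Real.pi * r) * v) *
        Complex.exp (-((Real.pi * s : ℝ) : ℂ) * v ^ 2)) := by
      intro v
      push_cast
      rw [mul_assoc (a : ℂ), ← Complex.exp_add, ← Complex.exp_add, mul_left_comm, ← Complex.exp_add]
      congr 2
      simp
      ring
    simp only [e]
    rw [integral_const_mul, h]
    have h1 : ((Real.pi : ℂ) / ((Real.pi * s : ℝ) : ℂ)) ^ (1 / 2 : ℂ) =
        ((s ^ (-(1 / 2) : ℝ) : ℝ) : ℂ) := by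
      rw [← Complex.ofReal_div, show Real.pi / (Real.pi * s) = s⁻¹ by field_simp,
        Real.rpow_neg hs.le, ← Real.inv_rpow hs.le, Complex.ofReal_cpow (by positivity)]
      norm_num
    rw [h1]
    push_cast
    rw [sub_eq_add_neg, Complex.exp_add]
    have h2 : (-(2 * Real.pi * r : ℂ) ^ 2 / (4 * (Real.pi * s))) = -(Real.pi * r ^ 2 / s) := by
      have : (s : ℂ) ≠ 0 := by exact_mod_cast hs.ne'
      have : (Real.pi : ℂ) ≠ 0 := by exact_mod_cast hpi.ne'
      field_simp
      ring
    rw [h2]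
    ring
  rw [setIntegral_congr_fun measurableSet_Ioi hR, integral_complex_ofReal] at hinv
  exact_mod_cast hinv

lemma pow_mul_exp_neg_le (k m : ℕ) {c : ℝ} (hc : 0 < c) {r : ℝ} (hr : 0 ≤ r) :
    r ^ k * Real.exp (-(c * r)) ≤
      Real.exp c * (k + m).factorial / c ^ (k + m) * ((1 + r) ^ m)⁻¹ := by
  have h1 := Real.pow_div_factorial_le_exp (c * (1 + r)) (by positivity) (k + m)
  have h2 : Real.exp (-(c * r)) = Real.exp c * (Real.exp (c * (1 + r)))⁻¹ := by
    rw [← Real.exp_neg, ← Real.exp_add]; congr 1; ring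
  have hr1 : 0 < 1 + r := by linarith
  have h3 : (Real.exp (c * (1 + r)))⁻¹ ≤ ((c * (1 + r)) ^ (k + m) / (k + m).factorial)⁻¹ :=
    inv_anti₀ (by positivity) h1
  have h4 : r ^ k ≤ (1 + r) ^ k := pow_le_pow_left₀ hr (by linarith) k
  calc r ^ k * Real.exp (-(c * r))
      ≤ (1 + r) ^ k * (Real.exp c * ((c * (1 + r)) ^ (k + m) / (k + m).factorial)⁻¹) := by
        rw [h2]; gcongr
    _ = _ := by
        rw [mul_pow, pow_add (1 + r)]
        field_simp

lemma integrable_pow_mul_exp_neg_norm {n : ℕ} (k : ℕ) {c : ℝ} (hc : 0 < c) :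
    Integrable (fun ξ : EuclideanSpace ℝ (Fin n) => ‖ξ‖ ^ k * Real.exp (-(c * ‖ξ‖))) := by
  have h : Integrable (fun ξ : EuclideanSpace ℝ (Fin n) =>
      Real.exp c * (k + (n + 1)).factorial / c ^ (k + (n + 1)) *
        (1 + ‖ξ‖) ^ (-((n : ℝ) + 1))) :=
    (integrable_one_add_norm (by simp)).const_mul _
  refine h.mono' (by fun_prop) (Eventually.of_forall fun ξ => ?_)
  rw [Real.norm_of_nonneg (by positivity)]
  refine (pow_mul_exp_neg_le k (n + 1) hc (norm_nonneg ξ)).trans_eq ?_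
  rw [Real.rpow_neg (by positivity)]
  norm_cast

/-- The symbol `(-2π|ξ|)^k e^{-2π z |ξ|}`. -/
noncomputable def waveSym {n : ℕ} (k : ℕ) (z : ℂ) (ξ : EuclideanSpace ℝ (Fin n)) : ℂ :=
  ((-(2 * Real.pi * ‖ξ‖) : ℝ) : ℂ) ^ k * Complex.exp (((-(2 * Real.pi * ‖ξ‖) : ℝ) : ℂ) * z)

/-- The convolution kernel of the multiplier `waveSym`. -/
noncomputable def waveKer {n : ℕ} (k : ℕ) (z : ℂ) : EuclideanSpace ℝ (Fin n) → ℂ :=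
  𝓕⁻ (waveSym k z)

section
variable {n : ℕ}

lemma norm_waveSym (k : ℕ) (z : ℂ) (ξ : EuclideanSpace ℝ (Fin n)) :
    ‖waveSym k z ξ‖ = (2 * Real.pi) ^ k * (‖ξ‖ ^ k * Real.exp (-(2 * Real.pi * z.re * ‖ξ‖))) := by
  have h : (0:ℝ) ≤ 2 * Real.pi * ‖ξ‖ := by positivity
  rw [waveSym, norm_mul, norm_pow, Complex.norm_exp, Complex.norm_real, norm_neg,
    Real.norm_of_nonneg h, mul_pow, mul_assoc]
  congr 3
  simp
  ring

lemma norm_waveSym_le (k : ℕ) {a : ℝ} {z : ℂ} (h : a ≤ z.re) (ξ : EuclideanSpace ℝ (Fin n)) :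
    ‖waveSym k z ξ‖ ≤ (2 * Real.pi) ^ k * (‖ξ‖ ^ k * Real.exp (-(2 * Real.pi * a * ‖ξ‖))) := by
  rw [norm_waveSym]; gcongr

@[fun_prop]
lemma continuous_waveSym (k : ℕ) (z : ℂ) :
    Continuous (waveSym k z : EuclideanSpace ℝ (Fin n) → ℂ) := by
  unfold waveSym; fun_prop

lemma integrable_waveSym (k : ℕ) {z : ℂ} (hz : 0 < z.re) :
    Integrable (waveSym k z : EuclideanSpace ℝ (Fin n) → ℂ) := by
  refine ((integrable_pow_mul_exp_neg_norm (n := n) k (c := 2 * Real.pi * z.re)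
    (by positivity)).const_mul ((2 * Real.pi) ^ k)).mono'
    (continuous_waveSym k z).aestronglyMeasurable (Eventually.of_forall fun ξ => ?_)
  exact norm_waveSym_le k le_rfl ξ

lemma waveKer_eq (k : ℕ) (z : ℂ) (x : EuclideanSpace ℝ (Fin n)) :
    waveKer k z x = ∫ ξ : EuclideanSpace ℝ (Fin n),
      Complex.exp (((2 * Real.pi * ⟪ξ, x⟫ : ℝ) : ℂ) * Complex.I) * waveSym k z ξ := by
  rw [waveKer, Real.fourierInv_eq']; rfl

lemma hasDerivAt_waveKer (k : ℕ) {z : ℂ} (hz : 0 < z.re) (x : EuclideanSpace ℝ (Fin n)) :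
    HasDerivAt (fun z => waveKer k z x) (waveKer (k + 1) z x) z := by
  simp only [waveKer_eq]
  have hs : {w : ℂ | z.re / 2 < w.re} ∈ 𝓝 z :=
    (isOpen_lt continuous_const Complex.continuous_re).mem_nhds (by simp; linarith)
  refine (hasDerivAt_integral_of_dominated_loc_of_deriv_le (μ := volume)
    (F := fun w (ξ : EuclideanSpace ℝ (Fin n)) =>
      Complex.exp (((2 * Real.pi * ⟪ξ, x⟫ : ℝ) : ℂ) * Complex.I) * waveSym k w ξ)
    (F' := fun w (ξ : EuclideanSpace ℝ (Fin n)) =>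
      Complex.exp (((2 * Real.pi * ⟪ξ, x⟫ : ℝ) : ℂ) * Complex.I) * waveSym (k + 1) w ξ)
    (bound := fun ξ => (2 * Real.pi) ^ (k + 1) *
      (‖ξ‖ ^ (k + 1) * Real.exp (-(2 * Real.pi * (z.re / 2) * ‖ξ‖)))) hs ?_ ?_ ?_ ?_ ?_ ?_).2
  · refine Eventually.of_forall fun w => Continuous.aestronglyMeasurable (by fun_prop)
  · refine (integrable_waveSym k hz).mono (Continuous.aestronglyMeasurable (by fun_prop))
      (Eventually.of_forall fun ξ => ?_)
    rw [norm_mul, Complex.norm_exp_ofReal_mul_I, one_mul]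
  · exact Continuous.aestronglyMeasurable (by fun_prop)
  · refine Eventually.of_forall fun ξ w hw => ?_
    rw [norm_mul, Complex.norm_exp_ofReal_mul_I, one_mul]
    exact norm_waveSym_le _ (le_of_lt hw) ξ
  · exact (integrable_pow_mul_exp_neg_norm (k + 1) (by positivity)).const_mul _
  · refine Eventually.of_forall fun ξ w _ => ?_
    refine HasDerivAt.const_mul _ ?_
    unfold waveSym
    have h := ((hasDerivAt_id w).const_mul ((-(2 * Real.pi * ‖ξ‖) : ℝ) : ℂ)).cexp
    refine (h.const_mul (((-(2 * Real.pi * ‖ξ‖) : ℝ) : ℂ) ^ k)).congr_deriv ?_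
    simp only [id]
    ring

/-- The Poisson kernel in dimension `n`. -/
lemma waveKer_zero_ofReal {a : ℝ} (ha : 0 < a) (x : EuclideanSpace ℝ (Fin n)) :
    waveKer 0 (a : ℂ) x = ((a * ((1 / (Real.pi * (a ^ 2 + ‖x‖ ^ 2))) ^ (((n : ℝ) + 1) / 2) *
      Real.Gamma (((n : ℝ) + 1) / 2)) : ℝ) : ℂ) := by
  have hpi := Real.pi_pos
  have hsub := poisson_subordination ha
  have hsec : ∀ r : ℝ, Integrable (fun s => a * s ^ (-(1 / 2) : ℝ) *
      Real.exp (-(Real.pi * s * a ^ 2) - Real.pi * r ^ 2 / s))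
      (volume.restrict (Set.Ioi (0:ℝ))) := by
    intro r
    by_contra h
    have := hsub r
    rw [integral_undef h] at this
    linarith [Real.exp_pos (-(2 * Real.pi * a * |r|))]
  have hsym : Integrable (fun ξ : EuclideanSpace ℝ (Fin n) =>
      Real.exp (-(2 * Real.pi * a * |‖ξ‖|))) := by
    simpa using integrable_pow_mul_exp_neg_norm (n := n) 0 (c := 2 * Real.pi * a) (by positivity)
  have hprod : Integrable (fun q : EuclideanSpace ℝ (Fin n) × ℝ =>
      Complex.exp (((2 * Real.pi * ⟪q.1, x⟫ : ℝ) : ℂ) * Complex.I) *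
        ((a * q.2 ^ (-(1 / 2) : ℝ) * Real.exp (-(Real.pi * q.2 * a ^ 2) -
          Real.pi * ‖q.1‖ ^ 2 / q.2) : ℝ) : ℂ))
      (volume.prod (volume.restrict (Set.Ioi (0:ℝ)))) := by
    rw [integrable_prod_iff (by
      apply Measurable.aestronglyMeasurable
      fun_prop)]
    refine ⟨Eventually.of_forall fun ξ => ?_, ?_⟩
    · exact (Integrable.ofReal (𝕜 := ℂ) (hsec ‖ξ‖)).const_mul
        (Complex.exp (((2 * Real.pi * ⟪ξ, x⟫ : ℝ) : ℂ) * Complex.I))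
    · refine hsym.congr (Eventually.of_forall fun ξ => ?_)
      simp only
      rw [← hsub ‖ξ‖]
      refine setIntegral_congr_fun measurableSet_Ioi fun s hs => ?_
      have hs : 0 < s := hs
      simp only [norm_mul, Complex.norm_exp_ofReal_mul_I, one_mul, Complex.norm_real,
        Real.norm_eq_abs]
      rw [abs_of_pos ha, abs_of_pos (Real.exp_pos _), abs_of_pos (by positivity)]
  have hswap := integral_integral_swap (f := fun (ξ : EuclideanSpace ℝ (Fin n)) (s : ℝ) =>
    Complex.exp (((2 * Real.pi * ⟪ξ, x⟫ : ℝ) : ℂ) * Complex.I) *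
        ((a * s ^ (-(1 / 2) : ℝ) * Real.exp (-(Real.pi * s * a ^ 2) -
          Real.pi * ‖ξ‖ ^ 2 / s) : ℝ) : ℂ)) hprod
  have hL : ∀ ξ : EuclideanSpace ℝ (Fin n), ∫ s in Set.Ioi (0:ℝ),
      Complex.exp (((2 * Real.pi * ⟪ξ, x⟫ : ℝ) : ℂ) * Complex.I) *
        ((a * s ^ (-(1 / 2) : ℝ) * Real.exp (-(Real.pi * s * a ^ 2) -
          Real.pi * ‖ξ‖ ^ 2 / s) : ℝ) : ℂ) =
      Complex.exp (((2 * Real.pi * ⟪ξ, x⟫ : ℝ) : ℂ) * Complex.I) * waveSym 0 (a : ℂ) ξ := by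
    intro ξ
    rw [integral_const_mul, integral_complex_ofReal, hsub, waveSym]
    push_cast
    rw [abs_of_nonneg (norm_nonneg ξ)]
    congr 1
    rw [pow_zero, one_mul]
    congr 1
    ring
  simp only [hL] at hswap
  rw [waveKer_eq, hswap]
  have hR : ∀ s ∈ Set.Ioi (0:ℝ), ∫ ξ : EuclideanSpace ℝ (Fin n),
      Complex.exp (((2 * Real.pi * ⟪ξ, x⟫ : ℝ) : ℂ) * Complex.I) *
        ((a * s ^ (-(1 / 2) : ℝ) * Real.exp (-(Real.pi * s * a ^ 2) -
          Real.pi * ‖ξ‖ ^ 2 / s) : ℝ) : ℂ) =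
      ((a * (s ^ (((n : ℝ) + 1) / 2 - 1) *
        Real.exp (-((Real.pi * (a ^ 2 + ‖x‖ ^ 2)) * s))) : ℝ) : ℂ) := by
    intro s hs
    have hs : 0 < s := hs
    have hsC : (s : ℂ) ≠ 0 := by exact_mod_cast hs.ne'
    have hpC : (Real.pi : ℂ) ≠ 0 := by exact_mod_cast hpi.ne'
    have hb : 0 < ((Real.pi / s : ℝ) : ℂ).re := by simp; positivity
    have h := GaussianFourier.integral_cexp_neg_mul_sq_norm_add hb (2 * Real.pi * Complex.I) x
    have e : ∀ ξ : EuclideanSpace ℝ (Fin n),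
        Complex.exp (((2 * Real.pi * ⟪ξ, x⟫ : ℝ) : ℂ) * Complex.I) *
        ((a * s ^ (-(1 / 2) : ℝ) * Real.exp (-(Real.pi * s * a ^ 2) -
          Real.pi * ‖ξ‖ ^ 2 / s) : ℝ) : ℂ) =
      ((a * s ^ (-(1 / 2) : ℝ) * Real.exp (-(Real.pi * s * a ^ 2)) : ℝ) : ℂ) *
        Complex.exp (-((Real.pi / s : ℝ) : ℂ) * (‖ξ‖ : ℂ) ^ 2 +
          2 * Real.pi * Complex.I * (⟪x, ξ⟫ : ℝ)) := by
      intro ξ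
      push_cast
      rw [mul_left_comm, ← Complex.exp_add, mul_assoc _ (Complex.exp _) (Complex.exp _),
        ← Complex.exp_add, real_inner_comm]
      congr 2
      ring
    simp only [e]
    rw [integral_const_mul, h]
    have h1 : ((Real.pi : ℂ) / ((Real.pi / s : ℝ) : ℂ)) ^
        ((Module.finrank ℝ (EuclideanSpace ℝ (Fin n)) : ℂ) / 2) =
        ((s ^ ((n : ℝ) / 2) : ℝ) : ℂ) := by
      rw [← Complex.ofReal_div, show Real.pi / (Real.pi / s) = s by field_simp,
        Complex.ofReal_cpow hs.le]
      simp
    have h2 : ((2 * Real.pi * Complex.I) ^ 2 * (‖x‖ : ℂ) ^ 2 / (4 * ((Real.pi / s : ℝ) : ℂ)) : ℂ) =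
        ((-(Real.pi * s * ‖x‖ ^ 2) : ℝ) : ℂ) := by
      push_cast
      field_simp
      rw [Complex.I_sq]; ring
    rw [h1, h2, ← Complex.ofReal_exp, ← Complex.ofReal_mul, ← Complex.ofReal_mul]
    congr 1
    rw [show ((n : ℝ) + 1) / 2 - 1 = -(1 / 2) + n / 2 by ring, Real.rpow_add hs,
      show -(Real.pi * (a ^ 2 + ‖x‖ ^ 2) * s) = -(Real.pi * s * a ^ 2) + -(Real.pi * s * ‖x‖ ^ 2)
        by ring, Real.exp_add]
    ring
  rw [setIntegral_congr_fun measurableSet_Ioi hR, integral_complex_ofReal, integral_const_mul,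
    Real.integral_rpow_mul_exp_neg_mul_Ioi (by positivity) (by positivity)]

end

/-- The `j`-th derivative of `z ↦ z ^ a * (z ^ 2 + r ^ 2) ^ (-(α + b))`. -/
noncomputable def poissonDer (α r : ℝ) : ℕ → ℕ → ℕ → ℂ → ℂ
  | 0, a, b, z => z ^ a * (z ^ 2 + (r : ℂ) ^ 2) ^ ((-(α + b) : ℝ) : ℂ)
  | j + 1, a, b, z => a * poissonDer α r j (a - 1) b z -
      ((2 * (α + b) : ℝ) : ℂ) * poissonDer α r j (a + 1) (b + 1) z

lemma sq_add_sq_mem_slitPlane {z : ℂ} (hz : 0 < z.re) (r : ℝ) :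
    z ^ 2 + (r : ℂ) ^ 2 ∈ Complex.slitPlane := by
  rw [Complex.mem_slitPlane_iff]
  by_cases h : z.im = 0
  · left
    simp [pow_two, h]
    nlinarith [mul_self_nonneg r]
  · right
    simp [pow_two]
    have : z.re * z.im ≠ 0 := mul_ne_zero hz.ne' h
    intro h'; apply this; linarith

lemma hasDerivAt_poissonDer (α r : ℝ) (j a b : ℕ) {z : ℂ} (hz : 0 < z.re) :
    HasDerivAt (poissonDer α r j a b) (poissonDer α r (j + 1) a b z) z := by
  induction j generalizing a b with
  | zero =>
    have hs := sq_add_sq_mem_slitPlane hz r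
    have hne := Complex.slitPlane_ne_zero hs
    have h2 : HasDerivAt (fun w : ℂ => w ^ 2 + (r : ℂ) ^ 2) (2 * z) z := by
      simpa using (hasDerivAt_pow 2 z).add_const ((r : ℂ) ^ 2)
    have h3 := h2.cpow_const (c := ((-(α + b) : ℝ) : ℂ)) hs
    have h4 := (hasDerivAt_pow a z).mul h3
    refine (h4.congr_deriv ?_)
    simp only [poissonDer]
    have e : ((-(α + (b + 1 : ℕ)) : ℝ) : ℂ) = ((-(α + b) : ℝ) : ℂ) - 1 := by
      push_cast; ring
    rw [e]
    push_cast
    ring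
  | succ j ih =>
    exact ((ih (a - 1) b).const_mul (a : ℂ)).sub ((ih (a + 1) (b + 1)).const_mul _)

lemma norm_poissonDer_le (α : ℝ) (hα : 0 ≤ α) {c : ℝ} (hc : 0 < c) (j a b : ℕ) :
    ∃ C : ℝ, 0 < C ∧ ∀ (r : ℝ) (z : ℂ) (Z M W : ℝ), 0 < Z → 0 < M → ‖z‖ ≤ Z →
      c * M ≤ ‖z ^ 2 + (r : ℂ) ^ 2‖ → Z⁻¹ ≤ W → Z * M⁻¹ ≤ W →
      ‖poissonDer α r j a b z‖ ≤ C * (Z ^ a * M ^ (-(α + b)) * W ^ j) := by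
  induction j generalizing a b with
  | zero =>
    refine ⟨c ^ (-(α + b)), by positivity, fun r z Z M W hZ hM hz hD _ _ => ?_⟩
    simp only [poissonDer, norm_mul, norm_pow, pow_zero, mul_one]
    rw [Complex.norm_cpow_real, mul_left_comm, ← Real.mul_rpow hc.le hM.le]
    refine mul_le_mul (pow_le_pow_left₀ (norm_nonneg _) hz a) ?_ (by positivity) (by positivity)
    have : 0 ≤ α + b := by positivity
    exact Real.rpow_le_rpow_of_nonpos (by positivity) hD (by linarith)
  | succ j ih =>
    obtain ⟨C1, hC1, h1⟩ := ih (a - 1) b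
    obtain ⟨C2, hC2, h2⟩ := ih (a + 1) (b + 1)
    refine ⟨a * C1 + 2 * (α + b) * C2 + 1, by positivity,
      fun r z Z M W hZ hM hz hD hW1 hW2 => ?_⟩
    have hW : 0 < W := lt_of_lt_of_le (by positivity) hW1
    have k1 := h1 r z Z M W hZ hM hz hD hW1 hW2
    have k2 := h2 r z Z M W hZ hM hz hD hW1 hW2
    set P := Z ^ a * M ^ (-(α + b)) * W ^ (j + 1) with hP
    have hP0 : 0 < P := by positivity
    have m1 : (a : ℝ) * ‖poissonDer α r j (a - 1) b z‖ ≤ a * C1 * P := by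
      rcases Nat.eq_zero_or_pos a with rfl | ha
      · simp
      · have e : Z ^ (a - 1) = Z ^ a * Z⁻¹ := by
          obtain ⟨a', rfl⟩ := Nat.exists_eq_succ_of_ne_zero ha.ne'
          simp only [Nat.succ_eq_add_one, Nat.add_sub_cancel, pow_succ]
          field_simp
        calc (a : ℝ) * ‖poissonDer α r j (a - 1) b z‖
            ≤ a * (C1 * (Z ^ a * Z⁻¹ * M ^ (-(α + b)) * W ^ j)) := by rw [← e]; gcongr
          _ ≤ a * (C1 * (Z ^ a * W * M ^ (-(α + b)) * W ^ j)) := by gcongr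
          _ = a * C1 * P := by rw [hP, pow_succ]; ring
    have m2 : 2 * (α + b) * ‖poissonDer α r j (a + 1) (b + 1) z‖ ≤ 2 * (α + b) * C2 * P := by
      have e : M ^ (-(α + ((b + 1 : ℕ) : ℝ))) = M ^ (-(α + b)) * M⁻¹ := by
        rw [← Real.rpow_neg_one M, ← Real.rpow_add hM]; congr 1; push_cast; ring
      calc 2 * (α + b) * ‖poissonDer α r j (a + 1) (b + 1) z‖
          ≤ 2 * (α + b) * (C2 * (Z ^ (a + 1) * (M ^ (-(α + b)) * M⁻¹) * W ^ j)) := by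
            rw [← e]; gcongr
        _ = 2 * (α + b) * (C2 * (Z ^ a * (Z * M⁻¹) * M ^ (-(α + b)) * W ^ j)) := by ring
        _ ≤ 2 * (α + b) * (C2 * (Z ^ a * W * M ^ (-(α + b)) * W ^ j)) := by gcongr
        _ = _ := by rw [hP, pow_succ]; ring
    rw [poissonDer]
    refine (norm_sub_le _ _).trans ?_
    rw [norm_mul, norm_mul, Complex.norm_natCast, Complex.norm_real,
      Real.norm_of_nonneg (by positivity)]
    nlinarith

section
variable {n : ℕ}

/-- The closed form of the wave kernels. -/
lemma exists_waveKer_eq_poissonDer (n : ℕ) : ∃ c : ℝ, ∀ (k : ℕ) (z : ℂ), 0 < z.re →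
    ∀ x : EuclideanSpace ℝ (Fin n),
      waveKer k z x = c * poissonDer (((n : ℝ) + 1) / 2) ‖x‖ k 1 0 z := by
  have hpi := Real.pi_pos
  set c : ℝ := (1 / Real.pi) ^ (((n : ℝ) + 1) / 2) * Real.Gamma (((n : ℝ) + 1) / 2) with hc
  have hU : IsOpen {z : ℂ | 0 < z.re} := isOpen_lt continuous_const Complex.continuous_re
  refine ⟨c, fun k => ?_⟩
  induction k with
  | zero =>
    intro z hz x
    have h1 : AnalyticOnNhd ℂ (fun z => waveKer 0 z x) {z : ℂ | 0 < z.re} :=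
      DifferentiableOn.analyticOnNhd (fun w hw =>
        (hasDerivAt_waveKer 0 hw x).differentiableAt.differentiableWithinAt) hU
    have h2 : AnalyticOnNhd ℂ (fun z => (c : ℂ) * poissonDer (((n : ℝ) + 1) / 2) ‖x‖ 0 1 0 z)
        {z : ℂ | 0 < z.re} :=
      DifferentiableOn.analyticOnNhd (fun w hw =>
        ((hasDerivAt_poissonDer _ _ 0 1 0 hw).const_mul _).differentiableAt.differentiableWithinAt)
        hU
    have hconn : IsPreconnected {z : ℂ | 0 < z.re} := by
      exact (convex_halfSpace_gt (f := Complex.re) (by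
        constructor <;> intros <;> simp) 0).isPreconnected
    refine h1.eqOn_of_preconnected_of_frequently_eq h2 hconn (z₀ := 1) (by simp) ?_ hz
    have hev : ∀ a : ℝ, 0 < a →
        waveKer 0 (a : ℂ) x = (c : ℂ) * poissonDer (((n : ℝ) + 1) / 2) ‖x‖ 0 1 0 (a : ℂ) := by
      intro a ha
      have hq : 0 < a ^ 2 + ‖x‖ ^ 2 := by positivity
      rw [waveKer_zero_ofReal ha, poissonDer]
      have e1 : ((a : ℂ) ^ 2 + (‖x‖ : ℂ) ^ 2) = ((a ^ 2 + ‖x‖ ^ 2 : ℝ) : ℂ) := by push_cast; rfl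
      rw [e1, ← Complex.ofReal_cpow hq.le, pow_one, ← Complex.ofReal_mul, ← Complex.ofReal_mul]
      congr 1
      have e2 : 1 / (Real.pi * (a ^ 2 + ‖x‖ ^ 2)) = 1 / Real.pi * (a ^ 2 + ‖x‖ ^ 2)⁻¹ := by
        rw [one_div, mul_inv, one_div]
      rw [hc, e2, Real.mul_rpow (by positivity) (by positivity),
        Real.inv_rpow hq.le, ← Real.rpow_neg hq.le, Nat.cast_zero, add_zero]
      ring
    have ht : Tendsto (fun m : ℕ => ((1 + 1 / ((m : ℝ) + 1) : ℝ) : ℂ)) atTop (𝓝[≠] 1) := by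
      rw [tendsto_nhdsWithin_iff]
      constructor
      · have : Tendsto (fun m : ℕ => (1 + 1 / ((m : ℝ) + 1) : ℝ)) atTop (𝓝 (1 + 0)) :=
          tendsto_const_nhds.add tendsto_one_div_add_atTop_nhds_zero_nat
        have := (Complex.continuous_ofReal.tendsto _).comp this
        simpa [Function.comp_def] using this
      · refine Eventually.of_forall fun m => ?_
        have : (0:ℝ) < 1 / ((m : ℝ) + 1) := by positivity
        simp only [Set.mem_compl_iff, Set.mem_singleton_iff]
        intro h
        have h' : (1 + 1 / ((m : ℝ) + 1) : ℝ) = 1 := by exact_mod_cast h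
        linarith
    refine ht.frequently (Eventually.frequently (Eventually.of_forall fun m => ?_))
    exact hev _ (by positivity)
  | succ k ih =>
    intro z hz x
    have h1 := hasDerivAt_waveKer k hz x
    have h2 := (hasDerivAt_poissonDer (((n : ℝ) + 1) / 2) ‖x‖ k 1 0 hz).const_mul (c : ℂ)
    refine h1.unique (h2.congr_of_eventuallyEq ?_)
    filter_upwards [hU.mem_nhds hz] with w hw using ih w hw x

lemma norm_sq_add_sq_ge {z : ℂ} (h : 1 / 2 ≤ z.re) (r : ℝ) (hr : 0 ≤ r) :
    (1 / 9) * ((1 + r + |z.im|) * (1 + abs (r - |z.im|))) ≤ ‖z ^ 2 + (r : ℂ) ^ 2‖ := by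
  have hfac : ‖z ^ 2 + (r : ℂ) ^ 2‖ = ‖(z.re : ℂ) + (z.im + r : ℝ) * Complex.I‖ *
      ‖(z.re : ℂ) + (z.im - r : ℝ) * Complex.I‖ := by
    rw [← norm_mul]
    congr 1
    conv_lhs => rw [← Complex.re_add_im z]
    push_cast
    ring_nf
    simp
  have aux : ∀ y : ℝ, (1 / 3) * (1 + |y|) ≤ ‖(z.re : ℂ) + (y : ℝ) * Complex.I‖ := by
    intro y
    rw [Complex.norm_add_mul_I]
    refine Real.le_sqrt_of_sq_le ?_
    have := sq_abs y
    nlinarith [abs_nonneg y, sq_nonneg (|y| - 1)]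
  have hB : (1 + r + |z.im|) * (1 + abs (r - |z.im|)) = (1 + |z.im + r|) * (1 + |z.im - r|) := by
    rcases le_total 0 z.im with h0 | h0
    · rw [abs_of_nonneg h0, abs_of_nonneg (add_nonneg h0 hr), abs_sub_comm]; ring
    · rw [abs_of_nonpos h0, abs_of_nonpos (by linarith : z.im - r ≤ 0), sub_neg_eq_add,
        add_comm r z.im]; ring
  rw [hB, hfac]
  calc _ = ((1 / 3) * (1 + |z.im + r|)) * ((1 / 3) * (1 + |z.im - r|)) := by ring
    _ ≤ _ := mul_le_mul (aux _) (aux _) (by positivity) (by positivity)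

/-- Pointwise bound for the wave kernels, concentrated near the light cone. -/
lemma norm_waveKer_le (n k : ℕ) : ∃ C : ℝ, 0 < C ∧ ∀ (z : ℂ), 1 / 2 ≤ z.re → z.re ≤ 3 →
    ∀ x : EuclideanSpace ℝ (Fin n),
      ‖waveKer k z x‖ ≤ C * ((1 + ‖x‖ + |z.im|) *
        ((1 + ‖x‖ + |z.im|) * (1 + abs (‖x‖ - |z.im|))) ^ (-(((n : ℝ) + 1) / 2)) *
        (1 + abs (‖x‖ - |z.im|))⁻¹ ^ k) := by
  obtain ⟨c, hc⟩ := exists_waveKer_eq_poissonDer n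
  obtain ⟨C, hC, h⟩ := norm_poissonDer_le (((n : ℝ) + 1) / 2) (by positivity)
    (c := 1 / 9) (by norm_num) k 1 0
  refine ⟨(|c| + 1) * (C * (3 * 3 ^ k)), by positivity, fun z hz1 hz2 x => ?_⟩
  rw [hc k z (by linarith) x, norm_mul, Complex.norm_real, Real.norm_eq_abs]
  set A := 1 + ‖x‖ + |z.im| with hA
  set B := 1 + abs (‖x‖ - |z.im|) with hB
  have hA1 : 1 ≤ A := by have := norm_nonneg x; have := abs_nonneg z.im; linarith
  have hB1 : 1 ≤ B := by have := abs_nonneg (‖x‖ - |z.im|); linarith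
  have hBA : B ≤ A := by
    have := norm_nonneg x
    have := abs_nonneg z.im
    have : abs (‖x‖ - |z.im|) ≤ ‖x‖ + |z.im| := abs_le.2 ⟨by linarith, by linarith⟩
    linarith
  have hzA : ‖z‖ ≤ 3 * A := by
    have := Complex.norm_le_abs_re_add_abs_im z
    rw [abs_of_pos (by linarith : 0 < z.re)] at this
    have := norm_nonneg x
    have := abs_nonneg z.im
    linarith
  have key := h ‖x‖ z (3 * A) (A * B) (3 * B⁻¹) (by positivity) (by positivity) hzA
    (norm_sq_add_sq_ge hz1 _ (norm_nonneg x)) (by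
      rw [mul_inv]
      have : A⁻¹ ≤ B⁻¹ := inv_anti₀ (by positivity) hBA
      have : 0 < B⁻¹ := by positivity
      nlinarith) (by
      apply le_of_eq; field_simp)
  calc |c| * ‖poissonDer (((n : ℝ) + 1) / 2) ‖x‖ k 1 0 z‖
      ≤ (|c| + 1) * (C * ((3 * A) ^ 1 * (A * B) ^ (-(((n : ℝ) + 1) / 2 + (0 : ℕ))) *
          (3 * B⁻¹) ^ k)) := by gcongr; linarith
    _ = _ := by rw [mul_pow, Nat.cast_zero, add_zero]; ring

/-- Pointwise bound for the wave kernels at small times. -/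
lemma norm_waveKer_le_of_abs_im_le (n k : ℕ) : ∃ C : ℝ, 0 < C ∧ ∀ (z : ℂ), 1 / 2 ≤ z.re →
    z.re ≤ 3 → |z.im| ≤ 1 → ∀ x : EuclideanSpace ℝ (Fin n),
      ‖waveKer k z x‖ ≤ C * (1 + ‖x‖) ^ (-((n : ℝ) + 1)) := by
  obtain ⟨c, hc⟩ := exists_waveKer_eq_poissonDer n
  obtain ⟨C, hC, h⟩ := norm_poissonDer_le (((n : ℝ) + 1) / 2) (by positivity)
    (c := 1 / 18) (by norm_num) k 1 0
  refine ⟨(|c| + 1) * (C * (4 * 4 ^ k)), by positivity, fun z hz1 hz2 hz3 x => ?_⟩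
  rw [hc k z (by linarith) x, norm_mul, Complex.norm_real, Real.norm_eq_abs]
  have hx := norm_nonneg x
  have him := abs_nonneg z.im
  have hz4 : ‖z‖ ≤ 4 := by
    have := Complex.norm_le_abs_re_add_abs_im z
    rw [abs_of_pos (by linarith : 0 < z.re)] at this
    linarith
  have hD : (1 / 18) * (1 + ‖x‖) ^ 2 ≤ ‖z ^ 2 + (‖x‖ : ℂ) ^ 2‖ := by
    refine le_trans ?_ (norm_sq_add_sq_ge hz1 _ hx)
    have h1 : (1 + ‖x‖) / 2 ≤ 1 + abs (‖x‖ - |z.im|) := by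
      have := le_abs_self (‖x‖ - |z.im|)
      have := abs_nonneg (‖x‖ - |z.im|)
      rcases le_total ‖x‖ 1 with h | h <;> linarith
    have h2 : 1 + ‖x‖ ≤ 1 + ‖x‖ + |z.im| := by linarith
    calc (1 / 18) * (1 + ‖x‖) ^ 2 = 1 / 9 * ((1 + ‖x‖) * ((1 + ‖x‖) / 2)) := by ring
      _ ≤ _ := by gcongr
  have key := h ‖x‖ z 4 ((1 + ‖x‖) ^ 2) 4 (by positivity) (by positivity) hz4 hD (by norm_num) (by
      have : ((1 + ‖x‖) ^ 2)⁻¹ ≤ 1 := inv_le_one_of_one_le₀ (by nlinarith)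
      linarith)
  have e : ((1 + ‖x‖) ^ 2) ^ (-(((n : ℝ) + 1) / 2 + (0 : ℕ))) = (1 + ‖x‖) ^ (-((n : ℝ) + 1)) := by
    rw [← Real.rpow_natCast, ← Real.rpow_mul (by positivity)]
    congr 1
    push_cast
    ring
  rw [e] at key
  calc |c| * ‖poissonDer (((n : ℝ) + 1) / 2) ‖x‖ k 1 0 z‖
      ≤ (|c| + 1) * (C * (4 ^ 1 * (1 + ‖x‖) ^ (-((n : ℝ) + 1)) * 4 ^ k)) := by gcongr; linarith
    _ = _ := by ring

lemma waveKer_neg (k : ℕ) (z : ℂ) (x : EuclideanSpace ℝ (Fin n)) :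
    waveKer k z (-x) = waveKer k z x := by
  rw [waveKer_eq, waveKer_eq, ← integral_neg_eq_self]
  simp [waveSym]

lemma waveKer_sub_comm (k : ℕ) (z : ℂ) (x y : EuclideanSpace ℝ (Fin n)) :
    waveKer k z (x - y) = waveKer k z (y - x) := by
  rw [← neg_sub, waveKer_neg]

lemma waveSym_conj (k : ℕ) (z : ℂ) (ξ : EuclideanSpace ℝ (Fin n)) :
    waveSym k (starRingEnd ℂ z) ξ = starRingEnd ℂ (waveSym k z ξ) := by
  simp only [waveSym, map_mul, map_pow, ← Complex.exp_conj, Complex.conj_ofReal]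

lemma waveKer_conj (k : ℕ) (z : ℂ) (x : EuclideanSpace ℝ (Fin n)) :
    waveKer k (starRingEnd ℂ z) x = starRingEnd ℂ (waveKer k z x) := by
  rw [← waveKer_neg, waveKer_eq, waveKer_eq, ← integral_conj]
  congr 1
  ext ξ
  simp only [map_mul, ← Complex.exp_conj, Complex.conj_ofReal, Complex.conj_I, waveSym_conj,
    inner_neg_right]
  push_cast
  ring_nf

lemma waveKer_smul (k : ℕ) (z : ℂ) {a : ℝ} (ha : 0 < a) (x : EuclideanSpace ℝ (Fin n)) :
    waveKer k (a * z) (a • x) = ((a ^ (n + k))⁻¹ : ℝ) * waveKer k z x := by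
  rw [waveKer_eq, waveKer_eq]
  have h := Measure.integral_comp_smul (volume : Measure (EuclideanSpace ℝ (Fin n)))
    (fun ξ => Complex.exp (((2 * Real.pi * ⟪ξ, x⟫ : ℝ) : ℂ) * Complex.I) *
      (((a⁻¹ ^ k : ℝ) : ℂ) * waveSym k z ξ)) a
  rw [finrank_euclideanSpace_fin, abs_of_pos (by positivity)] at h
  rw [show (fun ξ => Complex.exp (((2 * Real.pi * ⟪ξ, a • x⟫ : ℝ) : ℂ) * Complex.I) *
      waveSym k (a * z) ξ) = fun ξ : EuclideanSpace ℝ (Fin n) =>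
        Complex.exp (((2 * Real.pi * ⟪a • ξ, x⟫ : ℝ) : ℂ) * Complex.I) *
      (((a⁻¹ ^ k : ℝ) : ℂ) * waveSym k z (a • ξ)) from ?_, h, Complex.real_smul]
  · rw [show (fun ξ => Complex.exp (((2 * Real.pi * ⟪ξ, x⟫ : ℝ) : ℂ) * Complex.I) *
      (((a⁻¹ ^ k : ℝ) : ℂ) * waveSym k z ξ)) = fun ξ : EuclideanSpace ℝ (Fin n) =>
        ((a⁻¹ ^ k : ℝ) : ℂ) * (Complex.exp (((2 * Real.pi * ⟪ξ, x⟫ : ℝ) : ℂ) * Complex.I) *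
       waveSym k z ξ) from by ext ξ; ring, integral_const_mul, ← mul_assoc, ← Complex.ofReal_mul]
    congr 3
    rw [pow_add, mul_inv, inv_pow]
  · ext ξ
    rw [inner_smul_left, inner_smul_right, waveSym, waveSym, norm_smul, Real.norm_of_nonneg ha.le]
    have : (a : ℂ) ≠ 0 := by exact_mod_cast ha.ne'
    simp only [RCLike.conj_to_real]
    congr 1
    rw [Complex.ofReal_pow, ← mul_assoc (_ ^ k) (_ ^ k), ← mul_pow]
    congr 1
    · congr 1
      push_cast
      field_simp
    · congr 1
      push_cast
      ring

lemma norm_waveKer_one_le (n k : ℕ) (b : ℝ) : ∃ C : ℝ, 0 < C ∧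
    ∀ x : EuclideanSpace ℝ (Fin n), ‖waveKer k (1 + b * Complex.I) x‖ ≤
      C * (1 + ‖x‖) ^ (-((n : ℝ) + 1)) := by
  obtain ⟨c, hc⟩ := exists_waveKer_eq_poissonDer n
  set z : ℂ := 1 + b * Complex.I with hz
  have hre : z.re = 1 := by simp [hz]
  have him : z.im = b := by simp [hz]
  set A : ℝ := 1 + |b| with hA
  have hA1 : 1 ≤ A := by have := abs_nonneg b; linarith
  obtain ⟨C, hC, h⟩ := norm_poissonDer_le (((n : ℝ) + 1) / 2) (by positivity)
    (c := 1 / (9 * A)) (by positivity) k 1 0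
  refine ⟨(|c| + 1) * (C * (A * (A + 1) ^ k)), by positivity, fun x => ?_⟩
  rw [hc k z (by linarith) x, norm_mul, Complex.norm_real, Real.norm_eq_abs]
  have hx := norm_nonneg x
  have hb := abs_nonneg b
  have hzA : ‖z‖ ≤ A := by
    have := Complex.norm_le_abs_re_add_abs_im z
    rw [hre, him, abs_one] at this
    linarith
  have hD : (1 / (9 * A)) * (1 + ‖x‖) ^ 2 ≤ ‖z ^ 2 + (‖x‖ : ℂ) ^ 2‖ := by
    refine le_trans ?_ (norm_sq_add_sq_ge (by linarith) _ hx)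
    rw [him]
    have h1 : (1 + ‖x‖) / A ≤ 1 + abs (‖x‖ - |b|) := by
      have := le_abs_self (‖x‖ - |b|)
      have := abs_nonneg (‖x‖ - |b|)
      rw [div_le_iff₀ (by positivity), hA]
      nlinarith
    have h2 : 1 + ‖x‖ ≤ 1 + ‖x‖ + |b| := by linarith
    calc (1 / (9 * A)) * (1 + ‖x‖) ^ 2 = 1 / 9 * ((1 + ‖x‖) * ((1 + ‖x‖) / A)) := by
          field_simp
      _ ≤ _ := by gcongr
  have key := h ‖x‖ z A ((1 + ‖x‖) ^ 2) (A + 1) (by positivity) (by positivity) hzA hD (by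
      have : A⁻¹ ≤ 1 := inv_le_one_of_one_le₀ hA1
      linarith) (by
      have : ((1 + ‖x‖) ^ 2)⁻¹ ≤ 1 := inv_le_one_of_one_le₀ (by nlinarith)
      nlinarith)
  have e : ((1 + ‖x‖) ^ 2) ^ (-(((n : ℝ) + 1) / 2 + (0 : ℕ))) = (1 + ‖x‖) ^ (-((n : ℝ) + 1)) := by
    rw [← Real.rpow_natCast, ← Real.rpow_mul (by positivity)]
    congr 1
    push_cast
    ring
  rw [e] at key
  calc |c| * ‖poissonDer (((n : ℝ) + 1) / 2) ‖x‖ k 1 0 z‖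
      ≤ (|c| + 1) * (C * (A ^ 1 * (1 + ‖x‖) ^ (-((n : ℝ) + 1)) * (A + 1) ^ k)) := by
        gcongr; linarith
    _ = _ := by ring

@[fun_prop]
lemma continuous_waveKer (k : ℕ) {z : ℂ} (hz : 0 < z.re) :
    Continuous (waveKer k z : EuclideanSpace ℝ (Fin n) → ℂ) := by
  rw [show (waveKer k z : EuclideanSpace ℝ (Fin n) → ℂ) = fun x => ∫ ξ, Complex.exp
    (((2 * Real.pi * ⟪ξ, x⟫ : ℝ) : ℂ) * Complex.I) * waveSym k z ξ from
      funext fun x => waveKer_eq k z x]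
  refine continuous_of_dominated (bound := fun ξ => ‖waveSym k z ξ‖) (fun x => ?_) (fun x => ?_)
    (integrable_waveSym k hz).norm (Eventually.of_forall fun ξ => ?_)
  · exact Continuous.aestronglyMeasurable (by fun_prop)
  · refine Eventually.of_forall fun ξ => ?_
    rw [norm_mul, Complex.norm_exp_ofReal_mul_I, one_mul]
  · fun_prop

lemma exists_norm_waveKer_le (k : ℕ) {z : ℂ} (hz : 0 < z.re) : ∃ C : ℝ, 0 < C ∧
    ∀ x : EuclideanSpace ℝ (Fin n), ‖waveKer k z x‖ ≤ C * (1 + ‖x‖) ^ (-((n : ℝ) + 1)) := by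
  set a := z.re with ha
  obtain ⟨C, hC, h⟩ := norm_waveKer_one_le n k (z.im / a)
  set D : ℝ := 1 + a with hD
  have e : z = (a : ℂ) * (1 + ((z.im / a : ℝ) : ℂ) * Complex.I) := by
    conv_lhs => rw [← Complex.re_add_im z]
    have : (a : ℂ) ≠ 0 := by exact_mod_cast hz.ne'
    push_cast
    field_simp
    rw [← ha]
  refine ⟨(a ^ (n + k))⁻¹ * (C * D ^ ((n : ℝ) + 1)), by positivity, fun x => ?_⟩
  have hx : x = a • (a⁻¹ • x) := by rw [smul_smul, mul_inv_cancel₀ hz.ne', one_smul]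
  rw [e]
  conv_lhs => rw [hx]
  rw [waveKer_smul _ _ hz, norm_mul, Complex.norm_real, Real.norm_of_nonneg (by positivity)]
  rw [mul_assoc]
  refine mul_le_mul_of_nonneg_left ((h _).trans ?_) (by positivity)
  rw [mul_assoc]
  refine mul_le_mul_of_nonneg_left ?_ hC.le
  have h1 : (1 + ‖x‖) / D ≤ 1 + ‖a⁻¹ • x‖ := by
    rw [norm_smul, Real.norm_of_nonneg (by positivity), div_le_iff₀ (by positivity), hD]
    have : a⁻¹ * ‖x‖ * a = ‖x‖ := by field_simp
    have h3 : 0 ≤ a⁻¹ * ‖x‖ := by positivity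
    nlinarith
  calc (1 + ‖a⁻¹ • x‖) ^ (-((n : ℝ) + 1)) ≤ ((1 + ‖x‖) / D) ^ (-((n : ℝ) + 1)) :=
        Real.rpow_le_rpow_of_nonpos (by positivity) h1 (by linarith [(Nat.cast_nonneg n : (0:ℝ) ≤ n)])
    _ = _ := by
      rw [Real.div_rpow (by positivity) (by positivity), Real.rpow_neg (by positivity : 0 ≤ D),
        div_inv_eq_mul, mul_comm]

lemma integrable_one_add_norm_rpow (n : ℕ) :
    Integrable fun x : EuclideanSpace ℝ (Fin n) => (1 + ‖x‖) ^ (-((n : ℝ) + 1)) :=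
  integrable_one_add_norm (by rw [finrank_euclideanSpace_fin]; linarith)

lemma integrable_waveKer (k : ℕ) {z : ℂ} (hz : 0 < z.re) :
    Integrable (waveKer k z : EuclideanSpace ℝ (Fin n) → ℂ) := by
  obtain ⟨C, hC, h⟩ := exists_norm_waveKer_le (n := n) k hz
  exact ((integrable_one_add_norm_rpow n).const_mul C).mono'
    (continuous_waveKer k hz).aestronglyMeasurable (Eventually.of_forall h)

lemma fourier_waveKer (k : ℕ) {z : ℂ} (hz : 0 < z.re) :
    𝓕 (waveKer k z : EuclideanSpace ℝ (Fin n) → ℂ) = waveSym k z := by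
  refine (continuous_waveSym k z).fourier_fourierInv_eq (integrable_waveSym k hz) ?_
  refine (integrable_waveKer (n := n) k hz).comp_neg.congr (Eventually.of_forall fun x => ?_)
  change 𝓕⁻ (waveSym k z) (-x) = _
  rw [Real.fourierInv_eq_fourier_neg, neg_neg]

/-- Convolution with the wave kernel. -/
noncomputable def waveOp (k : ℕ) (z : ℂ) (f : EuclideanSpace ℝ (Fin n) → ℂ)
    (x : EuclideanSpace ℝ (Fin n)) : ℂ :=
  ∫ y, waveKer k z (x - y) * f y

lemma norm_waveKer_le_const (k : ℕ) {z : ℂ} (hz : 0 < z.re) : ∃ C : ℝ, 0 < C ∧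
    ∀ x : EuclideanSpace ℝ (Fin n), ‖waveKer k z x‖ ≤ C := by
  obtain ⟨C, hC, h⟩ := exists_norm_waveKer_le (n := n) k hz
  refine ⟨C, hC, fun x => (h x).trans ?_⟩
  have : (1 + ‖x‖) ^ (-((n : ℝ) + 1)) ≤ 1 :=
    Real.rpow_le_one_of_one_le_of_nonpos (by linarith [norm_nonneg x])
      (by linarith [(Nat.cast_nonneg n : (0:ℝ) ≤ n)])
  nlinarith

lemma integrable_waveKer_mul (k : ℕ) {z : ℂ} (hz : 0 < z.re)
    {f : EuclideanSpace ℝ (Fin n) → ℂ} (hf : Integrable f) (x : EuclideanSpace ℝ (Fin n)) :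
    Integrable fun y => waveKer k z (x - y) * f y := by
  obtain ⟨C, hC, h⟩ := norm_waveKer_le_const (n := n) k hz
  exact hf.bdd_mul (c := C) ((continuous_waveKer k hz).comp (by fun_prop)).aestronglyMeasurable
    (Eventually.of_forall fun y => h _)

lemma waveOp_add (k : ℕ) {z : ℂ} (hz : 0 < z.re) {f g : EuclideanSpace ℝ (Fin n) → ℂ}
    (hf : Integrable f) (hg : Integrable g) (x : EuclideanSpace ℝ (Fin n)) :
    waveOp k z (f + g) x = waveOp k z f x + waveOp k z g x := by
  simp only [waveOp, Pi.add_apply, mul_add]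
  exact integral_add (integrable_waveKer_mul k hz hf x) (integrable_waveKer_mul k hz hg x)

lemma waveOp_eq_convolution (k : ℕ) (z : ℂ) (f : EuclideanSpace ℝ (Fin n) → ℂ) :
    waveOp k z f = convolution f (waveKer k z) (ContinuousLinearMap.mul ℂ ℂ) volume := by
  ext x
  rw [waveOp, convolution_def]
  congr 1
  ext y
  simp [mul_comm]

lemma integrable_waveOp (k : ℕ) {z : ℂ} (hz : 0 < z.re) {f : EuclideanSpace ℝ (Fin n) → ℂ}
    (hf : Integrable f) : Integrable (waveOp k z f) := by
  rw [waveOp_eq_convolution]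
  exact hf.integrable_convolution _ (integrable_waveKer k hz)

lemma fourier_waveOp (k : ℕ) {z : ℂ} (hz : 0 < z.re) {f : EuclideanSpace ℝ (Fin n) → ℂ}
    (hf : Integrable f) (ξ : EuclideanSpace ℝ (Fin n)) :
    𝓕 (waveOp k z f) ξ = waveSym k z ξ * 𝓕 f ξ := by
  rw [waveOp_eq_convolution, Real.fourier_mul_convolution_eq hf (integrable_waveKer k hz),
    fourier_waveKer k hz, mul_comm]

lemma norm_fourier_le (f : EuclideanSpace ℝ (Fin n) → ℂ) (ξ : EuclideanSpace ℝ (Fin n)) :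
    ‖𝓕 f ξ‖ ≤ ∫ y, ‖f y‖ :=
  VectorFourier.norm_fourierIntegral_le_integral_norm _ _ _ _ _

lemma continuous_fourier {f : EuclideanSpace ℝ (Fin n) → ℂ} (hf : Integrable f) :
    Continuous (𝓕 f) :=
  VectorFourier.fourierIntegral_continuous Real.continuous_fourierChar
    (by exact continuous_inner) hf

/-- A multiplier operator with integrable symbol, as a convolution. -/
lemma integral_fourierInv_sub_mul {m : EuclideanSpace ℝ (Fin n) → ℂ} (hm : Integrable m)
    {f : EuclideanSpace ℝ (Fin n) → ℂ} (hf : Integrable f) (x : EuclideanSpace ℝ (Fin n)) :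
    ∫ y, 𝓕⁻ m (x - y) * f y = ∫ ξ : EuclideanSpace ℝ (Fin n),
      Complex.exp (((2 * Real.pi * ⟪ξ, x⟫ : ℝ) : ℂ) * Complex.I) * (m ξ * 𝓕 f ξ) := by
  have h1 : ∀ y, 𝓕⁻ m (x - y) * f y = ∫ ξ : EuclideanSpace ℝ (Fin n),
      Complex.exp (((2 * Real.pi * ⟪ξ, x - y⟫ : ℝ) : ℂ) * Complex.I) * (m ξ * f y) := by
    intro y
    rw [Real.fourierInv_eq', ← integral_mul_const]
    simp only [smul_eq_mul, mul_assoc]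
  have h2 : ∀ ξ : EuclideanSpace ℝ (Fin n),
      Complex.exp (((2 * Real.pi * ⟪ξ, x⟫ : ℝ) : ℂ) * Complex.I) * (m ξ * 𝓕 f ξ) =
      ∫ y, Complex.exp (((2 * Real.pi * ⟪ξ, x - y⟫ : ℝ) : ℂ) * Complex.I) * (m ξ * f y) := by
    intro ξ
    rw [Real.fourier_eq', ← mul_assoc, ← integral_const_mul]
    congr 1
    ext y
    rw [inner_sub_right, real_inner_comm y ξ]
    simp only [smul_eq_mul]
    rw [show ((2 * Real.pi * (⟪ξ, x⟫ - ⟪y, ξ⟫) : ℝ) : ℂ) * Complex.I =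
      ((2 * Real.pi * ⟪ξ, x⟫ : ℝ) : ℂ) * Complex.I + ((-2 * Real.pi * ⟪y, ξ⟫ : ℝ) : ℂ) * Complex.I
      by push_cast; ring, Complex.exp_add]
    ring
  simp only [h1, h2]
  refine integral_integral_swap ?_
  refine ((hf.mul_prod hm)).mono ?_ (Eventually.of_forall fun p => ?_)
  · refine AEStronglyMeasurable.mul (Continuous.aestronglyMeasurable (by fun_prop)) ?_
    exact (hm.aestronglyMeasurable.comp_snd).mul hf.aestronglyMeasurable.comp_fst
  · simp only [Function.uncurry]
    rw [norm_mul, Complex.norm_exp_ofReal_mul_I, one_mul, norm_mul, norm_mul, mul_comm]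

lemma waveOp_eq (k : ℕ) {z : ℂ} (hz : 0 < z.re) {f : EuclideanSpace ℝ (Fin n) → ℂ}
    (hf : Integrable f) (x : EuclideanSpace ℝ (Fin n)) :
    waveOp k z f x = ∫ ξ : EuclideanSpace ℝ (Fin n),
      Complex.exp (((2 * Real.pi * ⟪ξ, x⟫ : ℝ) : ℂ) * Complex.I) * (waveSym k z ξ * 𝓕 f ξ) :=
  integral_fourierInv_sub_mul (integrable_waveSym k hz) hf x

lemma waveSym_mul (k k' : ℕ) (z z' : ℂ) (ξ : EuclideanSpace ℝ (Fin n)) :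
    waveSym k z ξ * waveSym k' z' ξ = waveSym (k + k') (z + z') ξ := by
  simp only [waveSym, pow_add, mul_add, Complex.exp_add]
  ring

lemma waveOp_waveOp (k k' : ℕ) {z z' : ℂ} (hz : 0 < z.re) (hz' : 0 < z'.re)
    {f : EuclideanSpace ℝ (Fin n) → ℂ} (hf : Integrable f) (x : EuclideanSpace ℝ (Fin n)) :
    waveOp k z (waveOp k' z' f) x = waveOp (k + k') (z + z') f x := by
  rw [waveOp_eq k hz (integrable_waveOp k' hz' hf), waveOp_eq (k + k') (by simp; linarith) hf]
  simp only [fourier_waveOp k' hz' hf, ← mul_assoc (waveSym k z _), waveSym_mul]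

lemma waveKer_conv (k k' : ℕ) {z z' : ℂ} (hz : 0 < z.re) (hz' : 0 < z'.re)
    (x : EuclideanSpace ℝ (Fin n)) :
    ∫ y, waveKer k z (x - y) * waveKer k' z' y = waveKer (k + k') (z + z') x := by
  have h := waveOp_eq k hz (integrable_waveKer (n := n) k' hz') x
  rw [waveOp] at h
  rw [h, waveKer_eq]
  simp only [fourier_waveKer k' hz', waveSym_mul]

lemma integral_waveKer_mul_conj (k : ℕ) {z z' : ℂ} (hz : 0 < z.re) (hz' : 0 < z'.re)
    (x x' : EuclideanSpace ℝ (Fin n)) :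
    ∫ y, waveKer k z (x - y) * starRingEnd ℂ (waveKer k z' (x' - y)) =
      waveKer (k + k) (z + starRingEnd ℂ z') (x - x') := by
  rw [← waveKer_conv k k hz (by simpa using hz'), ← integral_add_right_eq_self (fun y =>
    waveKer k z (x - y) * starRingEnd ℂ (waveKer k z' (x' - y))) x']
  congr 1
  ext y
  rw [waveKer_conj, ← waveKer_neg k z' y, sub_add_cancel_right, sub_add_eq_sub_sub_swap]

lemma continuous_waveOp (k : ℕ) {z : ℂ} (hz : 0 < z.re) {f : EuclideanSpace ℝ (Fin n) → ℂ}
    (hf : Integrable f) : Continuous (waveOp k z f) := by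
  rw [show waveOp k z f = _ from funext fun x => waveOp_eq k hz hf x]
  refine continuous_of_dominated (bound := fun ξ => ‖waveSym k z ξ‖ * ∫ y, ‖f y‖) (fun x => ?_)
    (fun x => ?_) ((integrable_waveSym k hz).norm.mul_const _) (Eventually.of_forall fun ξ => ?_)
  · have := continuous_fourier hf
    exact Continuous.aestronglyMeasurable (by fun_prop)
  · refine Eventually.of_forall fun ξ => ?_
    rw [norm_mul, Complex.norm_exp_ofReal_mul_I, one_mul, norm_mul]
    gcongr
    exact norm_fourier_le _ _
  · fun_prop

lemma waveOp_smul (k : ℕ) (z : ℂ) {a : ℝ} (ha : 0 < a) (f : EuclideanSpace ℝ (Fin n) → ℂ)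
    (x : EuclideanSpace ℝ (Fin n)) :
    waveOp k (a * z) f (a • x) = ((a ^ k)⁻¹ : ℝ) * waveOp k z (fun y => f (a • y)) x := by
  have h := Measure.integral_comp_smul (volume : Measure (EuclideanSpace ℝ (Fin n)))
    (fun y => waveKer k (a * z) (a • x - y) * f y) a
  rw [finrank_euclideanSpace_fin, abs_of_pos (by positivity)] at h
  simp only [← smul_sub, waveKer_smul _ _ ha] at h
  simp only [mul_assoc, integral_const_mul] at h
  rw [waveOp, waveOp]
  rw [Complex.real_smul, pow_add, mul_inv, Complex.ofReal_mul, mul_assoc] at h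
  refine (mul_left_cancel₀ ?_ h).symm
  have : (a : ℂ) ≠ 0 := by exact_mod_cast ha.ne'
  push_cast
  positivity

end

lemma lintegral_Ioi_rpow_indicator_lt {r : ℝ} (hr : 0 < r) (c : ℝ≥0∞) :
    ∫⁻ t in Set.Ioi (0:ℝ), Set.indicator {t : ℝ | ENNReal.ofReal t < c}
      (fun t => ENNReal.ofReal (r * t ^ (r - 1))) t = c ^ r := by
  have key : ∀ a : ℝ, 0 ≤ a → ∫⁻ t in Set.Ioo (0:ℝ) a, ENNReal.ofReal (r * t ^ (r - 1)) =
      ENNReal.ofReal a ^ r := by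
    intro a ha
    rw [setLIntegral_congr Ioo_ae_eq_Ioc, ← ofReal_integral_eq_lintegral_ofReal]
    · rw [← intervalIntegral.integral_of_le ha, intervalIntegral.integral_const_mul,
        integral_rpow (Or.inl (by linarith)), ENNReal.ofReal_rpow_of_nonneg ha hr.le]
      congr 1
      rw [sub_add_cancel, Real.zero_rpow hr.ne']
      field_simp
      simp
    · rw [← IntegrableOn, ← intervalIntegrable_iff_integrableOn_Ioc_of_le ha]
      exact (intervalIntegral.intervalIntegrable_rpow' (by linarith)).const_mul _
    · filter_upwards [ae_restrict_mem measurableSet_Ioc] with t ht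
      have := ht.1
      positivity
  have hm : MeasurableSet {t : ℝ | ENNReal.ofReal t < c} :=
    measurableSet_lt ENNReal.measurable_ofReal measurable_const
  rw [lintegral_indicator hm, Measure.restrict_restrict hm]
  by_cases hc : c = ∞
  · subst hc
    rw [ENNReal.top_rpow_of_pos hr]
    refine ENNReal.eq_top_of_forall_nnreal_le fun a => ?_
    have h := key ((a : ℝ) ^ r⁻¹) (by positivity)
    rw [ENNReal.ofReal_rpow_of_nonneg (by positivity) hr.le, ← Real.rpow_mul (by positivity),
      inv_mul_cancel₀ hr.ne', Real.rpow_one, ENNReal.ofReal_coe_nnreal] at h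
    rw [← h]
    refine lintegral_mono_set fun t ht => ⟨by simp, ht.1⟩
  · rw [show {t : ℝ | ENNReal.ofReal t < c} ∩ Set.Ioi 0 = Set.Ioo 0 c.toReal from ?_,
      key _ ENNReal.toReal_nonneg, ENNReal.ofReal_toReal hc]
    ext t
    simp only [Set.mem_inter_iff, Set.mem_ofPred_eq, Set.mem_Ioi, Set.mem_Ioo]
    rw [and_comm]
    refine and_congr_right fun ht => ?_
    rw [ENNReal.ofReal_lt_iff_lt_toReal ht.le hc]

lemma lintegral_Ioi_rpow_indicator_ge {r : ℝ} (hr : 0 < r) {c : ℝ≥0∞} (hc0 : c ≠ 0) (hc : c ≠ ∞) :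
    ∫⁻ t in Set.Ioi (0:ℝ), Set.indicator {t : ℝ | c ≤ ENNReal.ofReal t}
      (fun t => ENNReal.ofReal (r * t ^ (-r - 1))) t = c ^ (-r) := by
  have hm : MeasurableSet {t : ℝ | c ≤ ENNReal.ofReal t} :=
    measurableSet_le measurable_const ENNReal.measurable_ofReal
  have hc' : 0 < c.toReal := ENNReal.toReal_pos hc0 hc
  rw [lintegral_indicator hm, Measure.restrict_restrict hm]
  rw [show {t : ℝ | c ≤ ENNReal.ofReal t} ∩ Set.Ioi 0 = Set.Ici c.toReal from ?_]
  · rw [← setLIntegral_congr Ioi_ae_eq_Ici, ← ofReal_integral_eq_lintegral_ofReal]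
    · rw [integral_const_mul, integral_Ioi_rpow_of_lt (by linarith) hc', ← ENNReal.ofReal_toReal hc,
        ENNReal.ofReal_rpow_of_pos hc', ENNReal.toReal_ofReal hc'.le]
      congr 1
      rw [sub_add_cancel]
      field_simp
    · exact (integrableOn_Ioi_rpow_of_lt (by linarith) hc').const_mul _
    · filter_upwards [ae_restrict_mem measurableSet_Ioi] with t ht
      have : 0 < t := hc'.trans ht
      positivity
  · ext t
    simp only [Set.mem_inter_iff, Set.mem_ofPred_eq, Set.mem_Ioi, Set.mem_Ici]
    constructor
    · rintro ⟨h1, h2⟩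
      exact ENNReal.toReal_le_of_le_ofReal h2.le h1
    · intro h
      exact ⟨ENNReal.le_ofReal_iff_toReal_le hc (hc'.le.trans h) |>.2 h, hc'.trans_le h⟩

/-- Marcinkiewicz interpolation, at the level of distribution functions. -/
lemma lintegral_rpow_le_of_distribution {Ω E : Type*} [MeasurableSpace Ω] [MeasurableSpace E]
    {μ : Measure Ω} {ν : Measure E} [SFinite μ] [SFinite ν] {F : Ω → ℝ≥0∞} (hF : Measurable F)
    {φ : E → ℝ≥0∞} (hφ : Measurable φ) (hφt : ∀ x, φ x ≠ ∞) {a b p : ℝ} (ha : 0 < a) (hap : a < p)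
    (hpb : p < b)
    (h : ∀ t : ℝ, 0 < t → μ {ω | ENNReal.ofReal t < F ω} ≤
      ENNReal.ofReal (t ^ (-a)) * (∫⁻ x, Set.indicator {x | ENNReal.ofReal t < φ x}
        (fun x => φ x ^ a) x ∂ν) +
      ENNReal.ofReal (t ^ (-b)) * ∫⁻ x, Set.indicator {x | φ x ≤ ENNReal.ofReal t}
        (fun x => φ x ^ b) x ∂ν) :
    ∫⁻ ω, F ω ^ p ∂μ ≤ ENNReal.ofReal (p / (p - a) + p / (b - p)) * ∫⁻ x, φ x ^ p ∂ν := by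
  have hp : 0 < p := ha.trans hap
  have hpa : 0 < p - a := by linarith
  have hbp : 0 < b - p := by linarith
  have hmr : ∀ r : ℝ, Measurable fun t : ℝ => ENNReal.ofReal (p * t ^ r) := fun r => by fun_prop
  have step1 : ∫⁻ ω, F ω ^ p ∂μ = ∫⁻ t in Set.Ioi (0:ℝ),
      ENNReal.ofReal (p * t ^ (p - 1)) * μ {ω | ENNReal.ofReal t < F ω} := by
    simp_rw [← lintegral_Ioi_rpow_indicator_lt hp]
    rw [lintegral_lintegral_swap]
    · refine lintegral_congr fun t => ?_
      rw [← lintegral_indicator_const (measurableSet_lt measurable_const hF)]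
      rfl
    · refine Measurable.aemeasurable ?_
      have hm : MeasurableSet {q : Ω × ℝ | ENNReal.ofReal q.2 < F q.1} :=
        measurableSet_lt (by fun_prop) (by fun_prop)
      exact Measurable.indicator (f := fun q : Ω × ℝ => ENNReal.ofReal (p * q.2 ^ (p - 1)))
        (by fun_prop) hm
  have ma : MeasurableSet {q : ℝ × E | ENNReal.ofReal q.1 < φ q.2} :=
    measurableSet_lt (by fun_prop) (by fun_prop)
  have mb : MeasurableSet {q : ℝ × E | φ q.2 ≤ ENNReal.ofReal q.1} :=
    measurableSet_le (by fun_prop) (by fun_prop)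
  have m1 : Measurable fun q : ℝ × E => Set.indicator {x | ENNReal.ofReal q.1 < φ x}
        (fun x => φ x ^ a) q.2 :=
    Measurable.indicator (f := fun q : ℝ × E => φ q.2 ^ a) (by fun_prop) ma
  have m2 : Measurable fun q : ℝ × E => Set.indicator {x | φ x ≤ ENNReal.ofReal q.1}
        (fun x => φ x ^ b) q.2 :=
    Measurable.indicator (f := fun q : ℝ × E => φ q.2 ^ b) (by fun_prop) mb
  have i1 : ∫⁻ t in Set.Ioi (0:ℝ), ENNReal.ofReal (p * t ^ (p - a - 1)) *
      (∫⁻ x, Set.indicator {x | ENNReal.ofReal t < φ x} (fun x => φ x ^ a) x ∂ν) =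
      ENNReal.ofReal (p / (p - a)) * ∫⁻ x, φ x ^ p ∂ν := by
    simp_rw [← lintegral_const_mul' _ _ ENNReal.ofReal_ne_top]
    rw [lintegral_lintegral_swap (by
      exact Measurable.aemeasurable (((hmr _).comp measurable_fst).mul m1))]
    refine lintegral_congr fun x => ?_
    have e : ∀ t : ℝ, ENNReal.ofReal (p * t ^ (p - a - 1)) *
        Set.indicator {x | ENNReal.ofReal t < φ x} (fun x => φ x ^ a) x =
        ENNReal.ofReal (p / (p - a)) * φ x ^ a * Set.indicator {t : ℝ | ENNReal.ofReal t < φ x}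
          (fun t => ENNReal.ofReal ((p - a) * t ^ (p - a - 1))) t := by
      intro t
      by_cases ht : ENNReal.ofReal t < φ x
      · rw [Set.indicator_of_mem (by exact ht), Set.indicator_of_mem (by exact ht),
          mul_right_comm, ← ENNReal.ofReal_mul (by positivity)]
        congr 2
        field_simp
      · rw [Set.indicator_of_notMem (by exact ht), Set.indicator_of_notMem (by exact ht)]; simp
    simp_rw [e]
    rw [lintegral_const_mul' _ _ (ENNReal.mul_ne_top ENNReal.ofReal_ne_top
      (ENNReal.rpow_ne_top_of_nonneg ha.le (hφt x))), lintegral_Ioi_rpow_indicator_lt hpa,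
      mul_assoc, ← ENNReal.rpow_add_of_nonneg _ _ ha.le hpa.le, add_sub_cancel]
  have i2 : ∫⁻ t in Set.Ioi (0:ℝ), ENNReal.ofReal (p * t ^ (p - b - 1)) *
      (∫⁻ x, Set.indicator {x | φ x ≤ ENNReal.ofReal t} (fun x => φ x ^ b) x ∂ν) =
      ENNReal.ofReal (p / (b - p)) * ∫⁻ x, φ x ^ p ∂ν := by
    simp_rw [← lintegral_const_mul' _ _ ENNReal.ofReal_ne_top]
    rw [lintegral_lintegral_swap (by
      exact Measurable.aemeasurable (((hmr _).comp measurable_fst).mul m2))]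
    refine lintegral_congr fun x => ?_
    by_cases h0 : φ x = 0
    · have : ∀ t : ℝ, Set.indicator {x | φ x ≤ ENNReal.ofReal t} (fun x => φ x ^ b) x = 0 := by
        intro t
        rw [Set.indicator_apply_eq_zero]
        intro _
        rw [h0, ENNReal.zero_rpow_of_pos (by linarith)]
      simp_rw [this]
      simp [h0, ENNReal.zero_rpow_of_pos hp]
    have e : ∀ t : ℝ, ENNReal.ofReal (p * t ^ (p - b - 1)) *
        Set.indicator {x | φ x ≤ ENNReal.ofReal t} (fun x => φ x ^ b) x =
        ENNReal.ofReal (p / (b - p)) * φ x ^ b * Set.indicator {t : ℝ | φ x ≤ ENNReal.ofReal t}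
          (fun t => ENNReal.ofReal ((b - p) * t ^ (-(b - p) - 1))) t := by
      intro t
      by_cases ht : φ x ≤ ENNReal.ofReal t
      · rw [Set.indicator_of_mem (by exact ht), Set.indicator_of_mem (by exact ht),
          mul_right_comm, ← ENNReal.ofReal_mul (by positivity), neg_sub]
        congr 2
        field_simp
      · rw [Set.indicator_of_notMem (by exact ht), Set.indicator_of_notMem (by exact ht)]; simp
    simp_rw [e]
    rw [lintegral_const_mul' _ _ (ENNReal.mul_ne_top ENNReal.ofReal_ne_top
      (ENNReal.rpow_ne_top_of_nonneg (by linarith) (hφt x))),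
      lintegral_Ioi_rpow_indicator_ge hbp h0 (hφt x),
      mul_assoc, ← ENNReal.rpow_add _ _ h0 (hφt x)]
    congr 2
    ring
  rw [step1, ENNReal.ofReal_add (by positivity) (by positivity), add_mul, ← i1, ← i2,
    ← lintegral_add_left' (by
      exact (((hmr _).mul (Measurable.lintegral_prod_right' m1)).aemeasurable))]
  refine lintegral_mono_ae ?_
  filter_upwards [ae_restrict_mem measurableSet_Ioi] with t ht
  have ht : 0 < t := ht
  refine (mul_le_mul_right (h t ht) _).trans_eq ?_
  rw [mul_add, ← mul_assoc, ← mul_assoc, ← ENNReal.ofReal_mul (by positivity),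
    ← ENNReal.ofReal_mul (by positivity), mul_assoc, mul_assoc, ← Real.rpow_add ht,
    ← Real.rpow_add ht]
  congr 5 <;> ring

/-- Marcinkiewicz interpolation for sublinear operators of weak types `(a, a)` and `(b, b)`. -/
lemma lintegral_rpow_le_of_weakType {E Ω : Type*} [MeasurableSpace E] [MeasurableSpace Ω]
    {μ : Measure Ω} {ν : Measure E} [SFinite μ] [SFinite ν] {T : (E → ℂ) → Ω → ℝ≥0∞}
    (hT : ∀ f, Measurable f → Integrable f ν → Measurable (T f))
    (hsub : ∀ f g, Measurable f → Integrable f ν → Measurable g → Integrable g ν → ∀ ω,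
      T (f + g) ω ≤ T f ω + T g ω)
    {a b p A : ℝ} (ha : 0 < a) (hap : a < p) (hpb : p < b) (hA : 0 < A)
    (hwa : ∀ f, Measurable f → Integrable f ν → ∀ t : ℝ, 0 < t →
      μ {ω | ENNReal.ofReal t < T f ω} ≤ ENNReal.ofReal ((t / A) ^ (-a)) * ∫⁻ x, ‖f x‖ₑ ^ a ∂ν)
    (hwb : ∀ f, Measurable f → Integrable f ν → ∀ t : ℝ, 0 < t →
      μ {ω | ENNReal.ofReal t < T f ω} ≤ ENNReal.ofReal ((t / A) ^ (-b)) * ∫⁻ x, ‖f x‖ₑ ^ b ∂ν)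
    {f : E → ℂ} (hfm : Measurable f) (hf : Integrable f ν) :
    ∫⁻ ω, T f ω ^ p ∂μ ≤ ENNReal.ofReal ((2 * A) ^ p * (p / (p - a) + p / (b - p))) *
      ∫⁻ x, ‖f x‖ₑ ^ p ∂ν := by
  have hp : 0 < p := ha.trans hap
  have h2A : ENNReal.ofReal (2 * A) ≠ 0 := by simpa using hA
  have key := lintegral_rpow_le_of_distribution (μ := μ) (ν := ν)
    (F := fun ω => T f ω / ENNReal.ofReal (2 * A)) ((hT f hfm hf).div_const _)
    (φ := fun x => ‖f x‖ₑ) hfm.enorm (fun x => enorm_ne_top) ha hap hpb (fun t ht => ?_)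
  · have e : ∀ ω, T f ω ^ p = ENNReal.ofReal ((2 * A) ^ p) *
        (T f ω / ENNReal.ofReal (2 * A)) ^ p := by
      intro ω
      rw [← ENNReal.ofReal_rpow_of_pos (by positivity), ← ENNReal.mul_rpow_of_nonneg _ _ hp.le,
        ENNReal.mul_div_cancel h2A ENNReal.ofReal_ne_top]
    simp_rw [e]
    rw [lintegral_const_mul' _ _ ENNReal.ofReal_ne_top,
      ENNReal.ofReal_mul (p := (2 * A) ^ p) (by positivity), mul_assoc]
    exact mul_le_mul_right key _
  · set S : Set E := {x | ENNReal.ofReal t < ‖f x‖ₑ} with hS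
    have hSm : MeasurableSet S := measurableSet_lt measurable_const hfm.enorm
    have hsum : f = S.indicator f + Sᶜ.indicator f := (Set.indicator_self_add_compl S f).symm
    have h1 := hwa _ (hfm.indicator hSm) (hf.indicator hSm) (A * t) (by positivity)
    have h2 := hwb _ (hfm.indicator hSm.compl) (hf.indicator hSm.compl) (A * t) (by positivity)
    rw [mul_div_cancel_left₀ _ hA.ne'] at h1 h2
    refine (measure_mono (t := {ω | ENNReal.ofReal (A * t) < T (S.indicator f) ω} ∪
      {ω | ENNReal.ofReal (A * t) < T (Sᶜ.indicator f) ω}) fun ω hω => ?_).trans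
      ((measure_union_le _ _).trans (add_le_add (h1.trans_eq ?_) (h2.trans_eq ?_)))
    · by_contra hcon
      simp only [Set.mem_union, Set.mem_ofPred_eq, not_or, not_lt] at hcon
      have h3 := hsub _ _ (hfm.indicator hSm) (hf.indicator hSm) (hfm.indicator hSm.compl)
        (hf.indicator hSm.compl) ω
      rw [← hsum] at h3
      have hω : ENNReal.ofReal t < T f ω / ENNReal.ofReal (2 * A) := hω
      refine absurd hω (not_lt.2 (ENNReal.div_le_of_le_mul ?_))
      refine h3.trans ((add_le_add hcon.1 hcon.2).trans_eq ?_)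
      rw [← ENNReal.ofReal_add (by positivity) (by positivity), ← ENNReal.ofReal_mul ht.le]
      congr 1; ring
    · congr 1
      refine lintegral_congr fun x => ?_
      by_cases hx : x ∈ S
      · rw [Set.indicator_of_mem hx, Set.indicator_of_mem hx]
      · rw [Set.indicator_of_notMem hx, Set.indicator_of_notMem hx]
        simp [ENNReal.zero_rpow_of_pos ha]
    · congr 1
      refine lintegral_congr fun x => ?_
      by_cases hx : x ∈ S
      · rw [Set.indicator_of_notMem (by simpa using hx), Set.indicator_of_notMem (by
          simpa [hS] using hx)]
        simp [ENNReal.zero_rpow_of_pos ((ha.trans hap).trans hpb)]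
      · rw [Set.indicator_of_mem (by simpa using hx), Set.indicator_of_mem (by
          simpa [hS] using hx)]

section
variable {n : ℕ}

/-- The Hardy–Littlewood maximal function. -/
noncomputable def hlMax (φ : EuclideanSpace ℝ (Fin n) → ℝ≥0∞) (x : EuclideanSpace ℝ (Fin n)) :
    ℝ≥0∞ :=
  ⨆ (r : ℝ) (_ : 0 < r), (∫⁻ y in closedBall x r, φ y) / ENNReal.ofReal (r ^ n)

lemma lintegral_closedBall_le_hlMax (φ : EuclideanSpace ℝ (Fin n) → ℝ≥0∞)
    (x : EuclideanSpace ℝ (Fin n)) {r : ℝ} (hr : 0 < r) :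
    ∫⁻ y in closedBall x r, φ y ≤ ENNReal.ofReal (r ^ n) * hlMax φ x := by
  have h : (∫⁻ y in closedBall x r, φ y) / ENNReal.ofReal (r ^ n) ≤ hlMax φ x :=
    le_iSup₂ (f := fun (r : ℝ) (_ : 0 < r) =>
      (∫⁻ y in closedBall x r, φ y) / ENNReal.ofReal (r ^ n)) r hr
  rw [ENNReal.div_le_iff' (by simpa using pow_pos hr n) ENNReal.ofReal_ne_top] at h
  exact h

lemma hlMax_weakType (hn : 0 < n) : ∃ C : ℝ, 0 < C ∧
    ∀ φ : EuclideanSpace ℝ (Fin n) → ℝ≥0∞, Measurable φ → ∀ t : ℝ, 0 < t →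
      volume {x | ENNReal.ofReal t < hlMax φ x} ≤ ENNReal.ofReal (C / t) * ∫⁻ x, φ x := by
  set V : ℝ≥0∞ := volume (ball (0 : EuclideanSpace ℝ (Fin n)) 1) with hV
  have hVt : V ≠ ∞ := measure_ball_lt_top.ne
  have hV0 : V ≠ 0 := (measure_ball_pos _ _ one_pos).ne'
  refine ⟨4 ^ n * V.toReal, mul_pos (by positivity) (ENNReal.toReal_pos hV0 hVt),
    fun φ hφ t ht => ?_⟩
  have hC : ENNReal.ofReal (4 ^ n * V.toReal / t) = ENNReal.ofReal (4 ^ n) * V *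
      (ENNReal.ofReal t)⁻¹ := by
    rw [div_eq_mul_inv, ENNReal.ofReal_mul (by positivity), ENNReal.ofReal_mul (by positivity),
      ENNReal.ofReal_toReal hVt, ENNReal.ofReal_inv_of_pos ht]
  have ht0 : ENNReal.ofReal t ≠ 0 := by simpa using ht
  by_cases hI : ∫⁻ x, φ x = ∞
  · rw [hI, ENNReal.mul_top]
    · exact le_top
    · simpa using div_pos (mul_pos (by positivity) (ENNReal.toReal_pos hV0 hVt)) ht
  set U := {x | ENNReal.ofReal t < hlMax φ x} with hU
  have hex : ∀ x ∈ U, ∃ r : ℝ, 0 < r ∧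
      ENNReal.ofReal t * ENNReal.ofReal (r ^ n) ≤ ∫⁻ y in closedBall x r, φ y := by
    intro x hx
    have hx : ENNReal.ofReal t < hlMax φ x := hx
    simp only [hlMax, lt_iSup_iff] at hx
    obtain ⟨r, hr, h⟩ := hx
    refine ⟨r, hr, ?_⟩
    rw [← ENNReal.le_div_iff_mul_le (Or.inl (by simpa using pow_pos hr n))
      (Or.inl ENNReal.ofReal_ne_top)]
    exact h.le
  choose! r hr0 hr using hex
  have hbd : ∀ x ∈ U, r x ≤ 1 + ((∫⁻ x, φ x) / ENNReal.ofReal t).toReal := by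
    intro x hx
    by_contra! hcon
    have hfin : (∫⁻ x, φ x) / ENNReal.ofReal t ≠ ∞ := ENNReal.div_ne_top hI ht0
    have h1 : ENNReal.ofReal (r x ^ n) ≤ (∫⁻ x, φ x) / ENNReal.ofReal t := by
      rw [ENNReal.le_div_iff_mul_le (Or.inl ht0) (Or.inl ENNReal.ofReal_ne_top), mul_comm]
      exact (hr x hx).trans (setLIntegral_le_lintegral _ _)
    have h2 : r x ^ n ≤ ((∫⁻ x, φ x) / ENNReal.ofReal t).toReal :=
      (ENNReal.ofReal_le_iff_le_toReal hfin).1 h1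
    have h3 : 1 ≤ r x := by linarith [ENNReal.toReal_nonneg (a := (∫⁻ x, φ x) / ENNReal.ofReal t)]
    have h4 : r x ≤ r x ^ n := le_self_pow₀ h3 hn.ne'
    linarith
  obtain ⟨u, huU, hdisj, hcov⟩ := Vitali.exists_disjoint_subfamily_covering_enlargement_closedBall
    U (fun x => x) r _ hbd 4 (by norm_num)
  have hcount : u.Countable := by
    refine hdisj.countable_of_nonempty_interior fun x hx => ?_
    exact ⟨x, ball_subset_interior_closedBall (mem_ball_self (hr0 x (huU hx)))⟩
  have hsub : U ⊆ ⋃ x ∈ u, closedBall x (4 * r x) := by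
    intro x hx
    obtain ⟨b, hb, hsub⟩ := hcov x hx
    exact Set.mem_biUnion hb (hsub (mem_closedBall_self (hr0 x hx).le))
  calc volume U ≤ ∑' x : u, volume (closedBall (x : EuclideanSpace ℝ (Fin n)) (4 * r x)) :=
        (measure_mono hsub).trans (measure_biUnion_le _ hcount _)
    _ ≤ ∑' x : u, ENNReal.ofReal (4 ^ n) * V * (ENNReal.ofReal t)⁻¹ *
          ∫⁻ y in closedBall (x : EuclideanSpace ℝ (Fin n)) (r x), φ y := by
        refine ENNReal.tsum_le_tsum fun x => ?_
        have hx := huU x.2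
        rw [Measure.addHaar_closedBall _ _ (by linarith [hr0 x hx]), finrank_euclideanSpace_fin,
          mul_pow, ENNReal.ofReal_mul (by positivity)]
        calc ENNReal.ofReal (4 ^ n) * ENNReal.ofReal (r x ^ n) * V
            = ENNReal.ofReal (4 ^ n) * V * (ENNReal.ofReal t)⁻¹ *
              (ENNReal.ofReal t * ENNReal.ofReal (r x ^ n)) := by
              rw [mul_assoc (_ * V), ← mul_assoc (ENNReal.ofReal t)⁻¹,
                ENNReal.inv_mul_cancel ht0 ENNReal.ofReal_ne_top, one_mul, mul_right_comm]
          _ ≤ _ := mul_le_mul_right (hr x hx) _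
    _ = ENNReal.ofReal (4 ^ n) * V * (ENNReal.ofReal t)⁻¹ *
          ∫⁻ y in ⋃ x ∈ u, closedBall x (r x), φ y := by
        rw [ENNReal.tsum_mul_left, lintegral_biUnion hcount
          (fun x _ => measurableSet_closedBall) hdisj]
    _ ≤ _ := by
        rw [hC]
        exact mul_le_mul_right (setLIntegral_le_lintegral _ _) _

/-- An integrable radially decreasing kernel is controlled by the maximal function. -/
lemma lintegral_rpow_le_hlMax (φ : EuclideanSpace ℝ (Fin n) → ℝ≥0∞)
    (hφ : Measurable φ) (x : EuclideanSpace ℝ (Fin n)) {s : ℝ} (hs : 0 < s) :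
    ∫⁻ y, ENNReal.ofReal ((s ^ n)⁻¹ * (1 + ‖x - y‖ / s) ^ (-((n : ℝ) + 1))) * φ y ≤
      ENNReal.ofReal (2 ^ (n + 2)) * hlMax φ x := by
  have hpt : ∀ y, ENNReal.ofReal ((s ^ n)⁻¹ * (1 + ‖x - y‖ / s) ^ (-((n : ℝ) + 1))) * φ y ≤
      ∑' j : ℕ, ENNReal.ofReal ((s ^ n)⁻¹ * (2 ^ (n + 1) * ((2 ^ j) ^ (n + 1))⁻¹)) *
        (closedBall x (2 ^ j * s)).indicator φ y := by
    intro y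
    set v := ‖x - y‖ / s with hv
    have hv0 : 0 ≤ v := by positivity
    have : ∃ j : ℕ, v ≤ 2 ^ j ∧ (2:ℝ) ^ j ≤ 2 * (1 + v) := by
      obtain ⟨j, h1, h2⟩ := exists_nat_pow_near (show (1:ℝ) ≤ 1 + v by linarith) one_lt_two
      refine ⟨j + 1, by linarith, ?_⟩
      rw [pow_succ]; linarith
    obtain ⟨j, h1, h2⟩ := this
    refine le_trans ?_ (ENNReal.le_tsum j)
    have hy : y ∈ closedBall x (2 ^ j * s) := by
      rw [mem_closedBall', dist_eq_norm]
      rwa [hv, div_le_iff₀ hs] at h1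
    rw [Set.indicator_of_mem hy]
    refine mul_le_mul_left (ENNReal.ofReal_le_ofReal ?_) _
    refine mul_le_mul_of_nonneg_left ?_ (by positivity)
    rw [Real.rpow_neg (by positivity), show ((n : ℝ) + 1) = ((n + 1 : ℕ) : ℝ) by push_cast; rfl,
      Real.rpow_natCast, ← inv_pow, ← inv_pow, ← mul_pow]
    refine pow_le_pow_left₀ (by positivity) ?_ _
    rw [← div_eq_mul_inv, inv_eq_one_div, div_le_div_iff₀ (by positivity) (by positivity)]
    linarith
  calc _ ≤ ∫⁻ y, ∑' j : ℕ, ENNReal.ofReal ((s ^ n)⁻¹ * (2 ^ (n + 1) * ((2 ^ j) ^ (n + 1))⁻¹)) *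
        (closedBall x (2 ^ j * s)).indicator φ y := lintegral_mono hpt
    _ = ∑' j : ℕ, ENNReal.ofReal ((s ^ n)⁻¹ * (2 ^ (n + 1) * ((2 ^ j) ^ (n + 1))⁻¹)) *
        ∫⁻ y in closedBall x (2 ^ j * s), φ y := by
        rw [lintegral_tsum fun j => by
          exact ((hφ.indicator measurableSet_closedBall).const_mul _).aemeasurable]
        congr 1
        ext j
        rw [lintegral_const_mul' _ _ ENNReal.ofReal_ne_top,
          lintegral_indicator measurableSet_closedBall]
    _ ≤ ∑' j : ℕ, ENNReal.ofReal (2 ^ (n + 1)) * hlMax φ x * (2⁻¹ : ℝ≥0∞) ^ j := by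
        refine ENNReal.tsum_le_tsum fun j => ?_
        refine (mul_le_mul_right (lintegral_closedBall_le_hlMax φ x
          (by positivity : 0 < 2 ^ j * s)) _).trans_eq ?_
        rw [← mul_assoc, ← ENNReal.ofReal_mul (by positivity),
          mul_right_comm (ENNReal.ofReal (2 ^ (n + 1)))]
        congr 1
        rw [show (2⁻¹ : ℝ≥0∞) ^ j = ENNReal.ofReal ((2⁻¹ : ℝ) ^ j) by
          rw [ENNReal.ofReal_pow (by norm_num), ENNReal.ofReal_inv_of_pos (by norm_num)]; simp,
          ← ENNReal.ofReal_mul (by positivity)]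
        congr 1
        rw [mul_pow, inv_pow]
        field_simp
        rw [pow_succ']
    _ = _ := by
        rw [ENNReal.tsum_mul_left, ENNReal.tsum_geometric, ENNReal.one_sub_inv_two, inv_inv,
          mul_right_comm, pow_succ _ (n + 1), ENNReal.ofReal_mul (by positivity)]
        simp

/-- The maximal function is of weak type `(a, a)` for `a ≥ 1`. -/
lemma hlMax_weakType_rpow (hn : 0 < n) {a : ℝ} (ha : 1 ≤ a) : ∃ A : ℝ, 0 < A ∧
    ∀ φ : EuclideanSpace ℝ (Fin n) → ℝ≥0∞, Measurable φ → ∀ t : ℝ, 0 < t →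
      volume {x | ENNReal.ofReal t < hlMax φ x} ≤
        ENNReal.ofReal ((t / A) ^ (-a)) * ∫⁻ x, φ x ^ a := by
  obtain ⟨C, hC, h⟩ := hlMax_weakType hn
  set V : ℝ≥0∞ := volume (ball (0 : EuclideanSpace ℝ (Fin n)) 1) with hV
  have hVt : V ≠ ∞ := measure_ball_lt_top.ne
  have hV0 : 0 < V.toReal := ENNReal.toReal_pos (measure_ball_pos _ _ one_pos).ne' hVt
  set v := V.toReal
  set c : ℝ := (2 * v)⁻¹ with hc
  have hc0 : 0 < c := by positivity
  set D : ℝ := 2 * C * c ^ (1 - a) with hD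
  have hD0 : 0 < D := by positivity
  refine ⟨D ^ a⁻¹, by positivity, fun φ hφ t ht => ?_⟩
  have hcon : (t / D ^ a⁻¹) ^ (-a) = 2 * C / t * (c * t) ^ (1 - a) := by
    rw [Real.div_rpow ht.le (by positivity), Real.rpow_neg (by positivity : 0 ≤ D ^ a⁻¹),
      ← Real.rpow_mul hD0.le, inv_mul_cancel₀ (by linarith), Real.rpow_one, div_inv_eq_mul,
      Real.mul_rpow hc0.le ht.le, Real.rpow_sub ht, Real.rpow_one, Real.rpow_neg ht.le, hD]
    have := Real.rpow_pos_of_pos ht a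
    field_simp
  rw [hcon]
  set S : Set (EuclideanSpace ℝ (Fin n)) := {x | ENNReal.ofReal (c * t) < φ x} with hS
  have hSm : MeasurableSet S := measurableSet_lt measurable_const hφ
  have hsub : {x | ENNReal.ofReal t < hlMax φ x} ⊆
      {x | ENNReal.ofReal (t / 2) < hlMax (S.indicator φ) x} := by
    intro x hx
    have hx : ENNReal.ofReal t < hlMax φ x := hx
    by_contra hcon
    have hcon : hlMax (S.indicator φ) x ≤ ENNReal.ofReal (t / 2) := not_lt.1 hcon
    refine absurd hx (not_lt.2 ?_)
    refine iSup₂_le fun r hr => ?_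
    rw [ENNReal.div_le_iff' (by simpa using pow_pos hr n) ENNReal.ofReal_ne_top]
    calc ∫⁻ y in closedBall x r, φ y
        ≤ ∫⁻ y in closedBall x r, (S.indicator φ y + ENNReal.ofReal (c * t)) := by
          refine lintegral_mono fun y => ?_
          by_cases hy : y ∈ S
          · rw [Set.indicator_of_mem hy]; exact le_self_add
          · rw [Set.indicator_of_notMem hy, zero_add]
            exact not_lt.1 hy
      _ = (∫⁻ y in closedBall x r, S.indicator φ y) +
          ENNReal.ofReal (c * t) * (ENNReal.ofReal (r ^ n) * V) := by
          rw [lintegral_add_right _ measurable_const, setLIntegral_const,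
            Measure.addHaar_closedBall _ _ hr.le, finrank_euclideanSpace_fin]
      _ ≤ ENNReal.ofReal (r ^ n) * ENNReal.ofReal (t / 2) +
          ENNReal.ofReal (r ^ n) * ENNReal.ofReal (t / 2) := by
          refine add_le_add ((lintegral_closedBall_le_hlMax _ _ hr).trans
            (mul_le_mul_right hcon _)) (le_of_eq ?_)
          rw [← ENNReal.ofReal_toReal hVt, mul_left_comm, ← ENNReal.ofReal_mul (by positivity)]
          congr 2
          change c * t * v = t / 2
          rw [hc]
          field_simp
      _ = _ := by
          rw [← mul_add, ← ENNReal.ofReal_add (by positivity) (by positivity), add_halves]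
  refine (measure_mono hsub).trans ((h _ (hφ.indicator hSm) (t / 2) (by positivity)).trans ?_)
  rw [ENNReal.ofReal_mul (by positivity), mul_assoc, show C / (t / 2) = 2 * C / t by field_simp]
  refine mul_le_mul_right ?_ _
  rw [← lintegral_const_mul' _ _ ENNReal.ofReal_ne_top]
  refine lintegral_mono fun x => ?_
  by_cases hx : x ∈ S
  · rw [Set.indicator_of_mem hx]
    have hx : ENNReal.ofReal (c * t) < φ x := hx
    by_cases hxt : φ x = ∞
    · rw [hxt, ENNReal.top_rpow_of_pos (by linarith), ENNReal.mul_top]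
      simpa using Real.rpow_pos_of_pos (by positivity : 0 < c * t) (1 - a)
    · have hx0 : φ x ≠ 0 := (lt_of_le_of_lt zero_le hx).ne'
      calc φ x = φ x ^ (1 - a) * φ x ^ a := by
            rw [← ENNReal.rpow_add _ _ hx0 hxt]; simp
        _ ≤ _ := by
            refine mul_le_mul_left ?_ _
            rw [← ENNReal.ofReal_rpow_of_pos (by positivity)]
            rw [show 1 - a = -(a - 1) by ring, ENNReal.rpow_neg, ENNReal.rpow_neg]
            exact ENNReal.inv_le_inv.2 (ENNReal.rpow_le_rpow hx.le (by linarith))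
  · rw [Set.indicator_of_notMem hx]; exact zero_le

lemma norm_waveOp_le_integral (k : ℕ) {z : ℂ} (hz : 0 < z.re) : ∃ C : ℝ, 0 < C ∧
    ∀ f : EuclideanSpace ℝ (Fin n) → ℂ, Integrable f → ∀ x, ‖waveOp k z f x‖ ≤ C * ∫ y, ‖f y‖ := by
  obtain ⟨C, hC, h⟩ := norm_waveKer_le_const (n := n) k hz
  refine ⟨C, hC, fun f hf x => ?_⟩
  rw [← integral_const_mul]
  refine norm_integral_le_of_norm_le (hf.norm.const_mul C) (Eventually.of_forall fun y => ?_)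
  rw [norm_mul]
  exact mul_le_mul_of_nonneg_right (h _) (norm_nonneg _)

lemma integral_conj_mul_waveOp (k : ℕ) {z : ℂ} (hz : 0 < z.re)
    {f g : EuclideanSpace ℝ (Fin n) → ℂ} (hf : Integrable f) (hg : Integrable g) :
    ∫ x, starRingEnd ℂ (g x) * waveOp k z f x =
      ∫ ξ, waveSym k z ξ * 𝓕 f ξ * starRingEnd ℂ (𝓕 g ξ) := by
  have h1 : ∀ x, starRingEnd ℂ (g x) * waveOp k z f x = ∫ ξ : EuclideanSpace ℝ (Fin n),
      Complex.exp (((2 * Real.pi * ⟪ξ, x⟫ : ℝ) : ℂ) * Complex.I) *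
        (starRingEnd ℂ (g x) * (waveSym k z ξ * 𝓕 f ξ)) := by
    intro x
    rw [waveOp_eq k hz hf, ← integral_const_mul]
    congr 1; ext ξ; ring
  have h2 : ∀ ξ, waveSym k z ξ * 𝓕 f ξ * starRingEnd ℂ (𝓕 g ξ) =
      ∫ x : EuclideanSpace ℝ (Fin n),
      Complex.exp (((2 * Real.pi * ⟪ξ, x⟫ : ℝ) : ℂ) * Complex.I) *
        (starRingEnd ℂ (g x) * (waveSym k z ξ * 𝓕 f ξ)) := by
    intro ξ
    rw [Real.fourier_eq' g, ← integral_conj, ← integral_const_mul]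
    congr 1; ext x
    rw [smul_eq_mul, map_mul, ← Complex.exp_conj, map_mul, Complex.conj_I, Complex.conj_ofReal,
      real_inner_comm x ξ]
    rw [show ((-2 * Real.pi * ⟪x, ξ⟫ : ℝ) : ℂ) * -Complex.I =
      ((2 * Real.pi * ⟪x, ξ⟫ : ℝ) : ℂ) * Complex.I by push_cast; ring]
    ring
  simp only [h1, h2]
  have hF := continuous_fourier hf
  have hm : Integrable fun ξ => waveSym k z ξ * 𝓕 f ξ :=
    ((integrable_waveSym k hz).mul_bdd (c := ∫ y, ‖f y‖) hF.aestronglyMeasurable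
      (Eventually.of_forall (norm_fourier_le f)))
  refine integral_integral_swap ?_
  refine ((hg.mul_prod hm)).mono ?_ (Eventually.of_forall fun p => ?_)
  · refine AEStronglyMeasurable.mul (Continuous.aestronglyMeasurable (by fun_prop)) ?_
    exact (Complex.continuous_conj.comp_aestronglyMeasurable hg.aestronglyMeasurable.comp_fst).mul
      hm.aestronglyMeasurable.comp_snd
  · simp only [Function.uncurry]
    rw [norm_mul, Complex.norm_exp_ofReal_mul_I, one_mul, norm_mul, norm_mul (g p.1),
      RCLike.norm_conj, norm_mul]

lemma lintegral_waveOp_sq (k : ℕ) {z : ℂ} (hz : 0 < z.re)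
    {f : EuclideanSpace ℝ (Fin n) → ℂ} (hf : Integrable f) :
    ∫⁻ x, ‖waveOp k z f x‖ₑ ^ (2:ℝ) = ∫⁻ ξ, ENNReal.ofReal (‖waveSym k z ξ‖ ^ 2 * ‖𝓕 f ξ‖ ^ 2) := by
  have hF := continuous_fourier hf
  have hO := continuous_waveOp k hz hf
  have hOi := integrable_waveOp k hz hf
  obtain ⟨C, hC, hb⟩ := norm_waveOp_le_integral (n := n) k hz
  have h := integral_conj_mul_waveOp k hz hf hOi
  simp only [fourier_waveOp k hz hf, Complex.mul_conj] at h
  simp only [mul_comm (starRingEnd ℂ _), Complex.mul_conj, integral_complex_ofReal] at h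
  have h := Complex.ofReal_injective h
  simp only [Complex.normSq_eq_norm_sq, norm_mul, mul_pow] at h
  have i1 : Integrable fun x => ‖waveOp k z f x‖ ^ 2 := by
    simp only [pow_two]
    exact hOi.norm.mul_bdd (c := C * ∫ y, ‖f y‖) (by fun_prop)
      (Eventually.of_forall fun x => by simpa using hb f hf x)
  have i2 : Integrable fun ξ => ‖waveSym k z ξ‖ ^ 2 * ‖𝓕 f ξ‖ ^ 2 := by
    have := integrable_waveSym (n := n) (k + k) (z := z + z) (by simpa using hz)
    refine this.norm.mul_bdd (c := (∫ y, ‖f y‖) ^ 2) (g := fun ξ => ‖𝓕 f ξ‖ ^ 2)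
      (by fun_prop) (Eventually.of_forall fun x => ?_) |>.congr
      (Eventually.of_forall fun x => ?_)
    · rw [norm_pow, norm_norm]
      exact pow_le_pow_left₀ (norm_nonneg _) (norm_fourier_le f x) 2
    · simp only [← waveSym_mul, norm_mul, pow_two]
  rw [← ofReal_integral_eq_lintegral_ofReal i2 (Eventually.of_forall fun x => by positivity), ← h,
    ofReal_integral_eq_lintegral_ofReal i1 (Eventually.of_forall fun x => by positivity)]
  refine lintegral_congr fun x => ?_
  rw [ENNReal.rpow_ofNat, ← ofReal_norm, ENNReal.ofReal_pow (norm_nonneg _)]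

/-- The dilated majorant has integral bounded independently of the scale. -/
lemma exists_lintegral_majorant_le (n : ℕ) : ∃ C : ℝ, 0 < C ∧
    ∀ s : ℝ, 0 < s → ∀ x : EuclideanSpace ℝ (Fin n),
    ∫⁻ y, ENNReal.ofReal ((s ^ n)⁻¹ * (1 + ‖x - y‖ / s) ^ (-((n : ℝ) + 1))) ≤ ENNReal.ofReal C := by
  set V : ℝ≥0∞ := volume (ball (0 : EuclideanSpace ℝ (Fin n)) 1) with hV
  have hVt : V ≠ ∞ := measure_ball_lt_top.ne
  have hV0 : V ≠ 0 := (measure_ball_pos _ _ one_pos).ne'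
  refine ⟨2 ^ (n + 2) * V.toReal, mul_pos (by positivity) (ENNReal.toReal_pos hV0 hVt),
    fun s hs x => ?_⟩
  have h := lintegral_rpow_le_hlMax (fun _ => 1) measurable_const x hs
  simp only [mul_one] at h
  refine h.trans ?_
  rw [ENNReal.ofReal_mul (by positivity), ENNReal.ofReal_toReal hVt]
  refine mul_le_mul_right (iSup₂_le fun r hr => ?_) _
  rw [setLIntegral_const, one_mul, Measure.addHaar_closedBall _ _ hr.le,
    finrank_euclideanSpace_fin]
  refine ENNReal.div_le_of_le_mul ?_
  rw [mul_comm]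

/-- Kernels of a dilation family are dominated by dilates of one integrable majorant. -/
lemma exists_norm_waveKer_dilate_le (k : ℕ) {z : ℂ} (hz : 0 < z.re) : ∃ C : ℝ, 0 < C ∧
    ∀ a : ℝ, 0 < a → ∀ x : EuclideanSpace ℝ (Fin n), ‖((a ^ k : ℝ) : ℂ) * waveKer k (a * z) x‖ ≤
      C * ((a ^ n)⁻¹ * (1 + ‖x‖ / a) ^ (-((n : ℝ) + 1))) := by
  obtain ⟨C, hC, h⟩ := exists_norm_waveKer_le (n := n) k hz
  refine ⟨C, hC, fun a ha x => ?_⟩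
  have h1 := waveKer_smul k z ha (a⁻¹ • x)
  rw [smul_inv_smul₀ ha.ne'] at h1
  rw [h1, ← mul_assoc, ← Complex.ofReal_mul, norm_mul, Complex.norm_real, Real.norm_of_nonneg
    (by positivity), pow_add]
  have h2 := h (a⁻¹ • x)
  rw [norm_smul, norm_inv, Real.norm_of_nonneg ha.le, inv_mul_eq_div] at h2
  calc _ = (a ^ n)⁻¹ * ‖waveKer k z (a⁻¹ • x)‖ := by field_simp
    _ ≤ (a ^ n)⁻¹ * _ := mul_le_mul_of_nonneg_left h2 (by positivity)
    _ = _ := by ring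

/-- A quadratic form bound for the Poisson semigroup. -/
lemma exists_lintegral_exp_mul_fourier_sq_le (n : ℕ) : ∃ C : ℝ, 0 < C ∧
    ∀ a : ℝ, 0 < a → ∀ f : EuclideanSpace ℝ (Fin n) → ℂ, Measurable f → Integrable f →
    ∫⁻ ξ : EuclideanSpace ℝ (Fin n), ENNReal.ofReal (Real.exp (-(2 * Real.pi * ‖ξ‖) * a) * ‖𝓕 f ξ‖ ^ 2) ≤
      ENNReal.ofReal C * ∫⁻ x, ‖f x‖ₑ ^ (2:ℝ) := by
  obtain ⟨C, hC, hK⟩ := exists_norm_waveKer_dilate_le (n := n) 0 (z := 1) (by simp)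
  obtain ⟨D, hD, hM⟩ := exists_lintegral_majorant_le n
  refine ⟨2 * (C * D), by positivity, fun a ha f hfm hf => ?_⟩
  have haz : 0 < (a : ℂ).re := by simpa using ha
  have hF := continuous_fourier hf
  have h := integral_conj_mul_waveOp 0 haz hf hf
  have e : ∀ ξ, waveSym 0 (a : ℂ) ξ * 𝓕 f ξ * starRingEnd ℂ (𝓕 f ξ) =
      ((Real.exp (-(2 * Real.pi * ‖ξ‖) * a) * ‖𝓕 f ξ‖ ^ 2 : ℝ) : ℂ) := by
    intro ξ
    rw [mul_assoc, Complex.mul_conj, Complex.normSq_eq_norm_sq]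
    simp [waveSym]
  simp only [e, integral_complex_ofReal] at h
  have i2 : Integrable fun ξ => Real.exp (-(2 * Real.pi * ‖ξ‖) * a) * ‖𝓕 f ξ‖ ^ 2 := by
    have := integrable_waveSym (n := n) 0 haz
    refine this.norm.mul_bdd (c := (∫ y, ‖f y‖) ^ 2) (g := fun ξ => ‖𝓕 f ξ‖ ^ 2)
      (by fun_prop) (Eventually.of_forall fun x => ?_) |>.congr
      (Eventually.of_forall fun x => ?_)
    · rw [norm_pow, norm_norm]
      exact pow_le_pow_left₀ (norm_nonneg _) (norm_fourier_le f x) 2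
    · simp only [norm_waveSym]
      simp [mul_right_comm]
  have hKb : ∀ x : EuclideanSpace ℝ (Fin n), ‖waveKer 0 (a : ℂ) x‖ₑ ≤ ENNReal.ofReal C *
      ENNReal.ofReal ((a ^ n)⁻¹ * (1 + ‖x‖ / a) ^ (-((n : ℝ) + 1))) := by
    intro x
    rw [← ENNReal.ofReal_mul hC.le, ← ofReal_norm]
    refine ENNReal.ofReal_le_ofReal ?_
    simpa using hK a ha x
  have hKm : Measurable fun x => ‖waveKer 0 (a : ℂ) (x : EuclideanSpace ℝ (Fin n))‖ₑ :=
    (continuous_waveKer 0 haz).measurable.enorm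
  have hKi : ∀ x, ∫⁻ y : EuclideanSpace ℝ (Fin n), ‖waveKer 0 (a : ℂ) (x - y)‖ₑ ≤ ENNReal.ofReal (C * D) := by
    intro x
    refine (lintegral_mono fun y => hKb (x - y)).trans ?_
    rw [lintegral_const_mul' _ _ ENNReal.ofReal_ne_top, ENNReal.ofReal_mul hC.le]
    exact mul_le_mul_right (hM a ha x) _
  have hφ := hfm.enorm.pow_const (2 : ℝ)
  rw [← ofReal_integral_eq_lintegral_ofReal i2 (Eventually.of_forall fun x => by positivity)]
  calc _ = ‖∫ x, starRingEnd ℂ (f x) * waveOp 0 (a : ℂ) f x‖ₑ := by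
        rw [h, ← ofReal_norm, Complex.norm_real, Real.norm_of_nonneg]
        exact integral_nonneg fun x => by positivity
    _ ≤ ∫⁻ x, ‖f x‖ₑ * ∫⁻ y, ‖waveKer 0 (a : ℂ) (x - y)‖ₑ * ‖f y‖ₑ := by
        refine (enorm_integral_le_lintegral_enorm _).trans (lintegral_mono fun x => ?_)
        simp only [enorm_mul, RCLike.enorm_conj]
        refine mul_le_mul_right ((enorm_integral_le_lintegral_enorm _).trans_eq ?_) _
        simp only [enorm_mul]
    _ ≤ ∫⁻ x, ∫⁻ y, (‖f x‖ₑ ^ (2:ℝ) * ‖waveKer 0 (a : ℂ) (x - y)‖ₑ +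
          ‖f y‖ₑ ^ (2:ℝ) * ‖waveKer 0 (a : ℂ) (x - y)‖ₑ) := by
        refine lintegral_mono fun x => ?_
        rw [← lintegral_const_mul' _ _ enorm_ne_top]
        refine lintegral_mono fun y => ?_
        rw [mul_left_comm, ← add_mul, mul_comm]
        refine mul_le_mul_left ?_ _
        simp only [ENNReal.rpow_ofNat, pow_two]
        rcases le_total ‖f x‖ₑ ‖f y‖ₑ with h | h
        · exact (mul_le_mul_left h _).trans le_add_self
        · exact (mul_le_mul_right h _).trans le_self_add
    _ = (∫⁻ x, ∫⁻ y, ‖f x‖ₑ ^ (2:ℝ) * ‖waveKer 0 (a : ℂ) (x - y)‖ₑ) +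
         ∫⁻ x, ∫⁻ y, ‖f y‖ₑ ^ (2:ℝ) * ‖waveKer 0 (a : ℂ) (x - y)‖ₑ := by
        rw [← lintegral_add_left]
        · congr 1; ext x
          exact lintegral_add_left (measurable_const.mul (hKm.comp (measurable_const.sub measurable_id))) _
        · exact Measurable.lintegral_prod_right'
            (f := fun p : EuclideanSpace ℝ (Fin n) × EuclideanSpace ℝ (Fin n) =>
              ‖f p.1‖ₑ ^ (2:ℝ) * ‖waveKer 0 (a : ℂ) (p.1 - p.2)‖ₑ)
            ((hφ.comp measurable_fst).mul (hKm.comp (measurable_fst.sub measurable_snd)))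
    _ = (∫⁻ x, ∫⁻ y, ‖f x‖ₑ ^ (2:ℝ) * ‖waveKer 0 (a : ℂ) (x - y)‖ₑ) +
         ∫⁻ y, ∫⁻ x, ‖f y‖ₑ ^ (2:ℝ) * ‖waveKer 0 (a : ℂ) (y - x)‖ₑ := by
        congr 1
        rw [lintegral_lintegral_swap]
        · simp only [waveKer_sub_comm]
        · exact ((hφ.comp measurable_snd).mul
            (hKm.comp (measurable_fst.sub measurable_snd))).aemeasurable
    _ ≤ ENNReal.ofReal (C * D) * (∫⁻ x, ‖f x‖ₑ ^ (2:ℝ)) +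
        ENNReal.ofReal (C * D) * (∫⁻ x, ‖f x‖ₑ ^ (2:ℝ)) := by
        rw [← lintegral_const_mul' _ _ ENNReal.ofReal_ne_top]
        refine add_le_add ?_ ?_ <;>
        · refine lintegral_mono fun x => ?_
          rw [lintegral_const_mul' _ _ (by simp), mul_comm]
          exact mul_le_mul_left (hKi x) _
    _ = _ := by
        rw [← two_mul, ← mul_assoc, ENNReal.ofReal_mul (p := 2) (by norm_num)]
        simp

lemma sq_mul_exp_neg_le {x : ℝ} (hx : 0 ≤ x) :
    x ^ 2 * Real.exp (-x) ≤ 16 * (Real.exp (-(x / 4)) - Real.exp (-(x / 2))) := by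
  set u := Real.exp (x / 4) with hu
  have hu1 : 1 + x / 4 ≤ u := by linarith [Real.add_one_le_exp (x / 4)]
  have hu0 : 0 < u := Real.exp_pos _
  have e1 : Real.exp (-x) = u⁻¹ ^ 4 := by
    rw [hu, ← Real.exp_neg, ← Real.exp_nat_mul]; congr 1; push_cast; ring
  have e2 : Real.exp (-(x / 2)) = u⁻¹ ^ 2 := by
    rw [hu, ← Real.exp_neg, ← Real.exp_nat_mul]; congr 1; push_cast; ring
  have e3 : Real.exp (-(x / 4)) = u⁻¹ := by rw [hu, ← Real.exp_neg]
  rw [e1, e2, e3]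
  have h : x ^ 2 ≤ 16 * (u ^ 2 * (u - 1)) := by
    have h1 : x / 4 ≤ u - 1 := by linarith
    have h2 : x / 4 ≤ u ^ 2 := by nlinarith
    nlinarith [mul_le_mul h2 h1 (by positivity) (by positivity)]
  calc x ^ 2 * u⁻¹ ^ 4 ≤ 16 * (u ^ 2 * (u - 1)) * u⁻¹ ^ 4 := by gcongr
    _ = _ := by field_simp

lemma sum_sq_mul_exp_neg_le {s : ℝ} (hs : 0 < s) (F : Finset ℤ) : ∃ a : ℝ, 0 < a ∧
    ∀ θ : ℝ, 0 ≤ θ → ∑ κ ∈ F, (s * 2 ^ κ * θ) ^ 2 * Real.exp (-(s * 2 ^ κ * θ)) ≤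
      16 * Real.exp (-θ * a) := by
  obtain ⟨N, hN⟩ := F.bddBelow
  obtain ⟨M, hM⟩ := F.bddAbove
  have hsub : F ⊆ (Finset.range (M - N + 1).toNat).image fun j : ℕ => N + (j : ℤ) := by
    intro κ hκ
    have h1 := hN hκ
    have h2 := hM hκ
    rw [Finset.mem_image]
    exact ⟨(κ - N).toNat, by rw [Finset.mem_range]; omega, by omega⟩
  refine ⟨s * 2 ^ N / 4, by positivity, fun θ hθ => ?_⟩
  refine (Finset.sum_le_sum_of_subset_of_nonneg hsub fun _ _ _ => by positivity).trans ?_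
  rw [Finset.sum_image (fun a _ b _ h => by simpa using h)]
  set g : ℕ → ℝ := fun j => Real.exp (-(s * 2 ^ (N + (j : ℤ)) * θ / 4)) with hg
  calc _ ≤ ∑ j ∈ Finset.range (M - N + 1).toNat, 16 * (g j - g (j + 1)) := by
        refine Finset.sum_le_sum fun j _ => ?_
        refine (sq_mul_exp_neg_le (by positivity)).trans_eq ?_
        simp only [hg]
        congr 4
        push_cast
        rw [← add_assoc, zpow_add_one₀ (by norm_num)]
        ring
    _ = 16 * (g 0 - g (M - N + 1).toNat) := by
        rw [← Finset.mul_sum, Finset.sum_range_sub']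
    _ ≤ 16 * g 0 := by
        have : 0 < g (M - N + 1).toNat := Real.exp_pos _
        linarith
    _ = _ := by
        simp only [hg]
        congr 2
        simp
        ring

/-- Littlewood–Paley operators. -/
noncomputable def lpOp (b : ℝ) (f : EuclideanSpace ℝ (Fin n) → ℂ) (x : EuclideanSpace ℝ (Fin n)) :
    ℂ :=
  (b : ℂ) * waveOp 1 ((b / 2 : ℝ) : ℂ) f x

lemma continuous_lpOp {b : ℝ} (hb : 0 < b) {f : EuclideanSpace ℝ (Fin n) → ℂ}
    (hf : Integrable f) : Continuous (lpOp b f) :=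
  continuous_const.mul (continuous_waveOp 1 (by rw [Complex.ofReal_re]; positivity) hf)

lemma integrable_lpOp {b : ℝ} (hb : 0 < b) {f : EuclideanSpace ℝ (Fin n) → ℂ}
    (hf : Integrable f) : Integrable (lpOp b f) :=
  (integrable_waveOp 1 (by rw [Complex.ofReal_re]; positivity) hf).const_mul _

lemma lpOp_add {b : ℝ} (hb : 0 < b) {f g : EuclideanSpace ℝ (Fin n) → ℂ}
    (hf : Integrable f) (hg : Integrable g) (x) : lpOp b (f + g) x = lpOp b f x + lpOp b g x := by
  rw [lpOp, waveOp_add 1 (by rw [Complex.ofReal_re]; positivity) hf hg, mul_add]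
  rfl

lemma exists_sum_lintegral_lpOp_sq_le (n : ℕ) : ∃ C : ℝ, 0 < C ∧
    ∀ s : ℝ, 0 < s → ∀ f : EuclideanSpace ℝ (Fin n) → ℂ, Measurable f → Integrable f →
    ∑' κ : ℤ, ∫⁻ x, ‖lpOp (s * 2 ^ κ) f x‖ₑ ^ (2:ℝ) ≤
      ENNReal.ofReal C * ∫⁻ x, ‖f x‖ₑ ^ (2:ℝ) := by
  obtain ⟨C, hC, h⟩ := exists_lintegral_exp_mul_fourier_sq_le n
  refine ⟨16 * C, by positivity, fun s hs f hfm hf => ?_⟩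
  rw [ENNReal.tsum_eq_iSup_sum]
  refine iSup_le fun F => ?_
  obtain ⟨a, ha, hF⟩ := sum_sq_mul_exp_neg_le hs F
  have hFc := continuous_fourier hf
  have e : ∀ b : ℝ, 0 < b → ∫⁻ x, ‖lpOp b f x‖ₑ ^ (2:ℝ) =
      ∫⁻ ξ, ENNReal.ofReal ((b * (2 * Real.pi * ‖ξ‖)) ^ 2 *
        Real.exp (-(b * (2 * Real.pi * ‖ξ‖))) * ‖𝓕 f ξ‖ ^ 2) := by
    intro b hb
    have h1 := lintegral_waveOp_sq 1 (z := ((b / 2 : ℝ) : ℂ))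
      (by rw [Complex.ofReal_re]; positivity) hf
    simp only [lpOp, enorm_mul, ENNReal.mul_rpow_of_nonneg _ _ (zero_le_two (α := ℝ))]
    rw [lintegral_const_mul' _ _ (by simp), h1, ← lintegral_const_mul' _ _ (by simp)]
    refine lintegral_congr fun ξ => ?_
    rw [← ofReal_norm, ENNReal.ofReal_rpow_of_nonneg (norm_nonneg _) zero_le_two,
      ← ENNReal.ofReal_mul (by positivity)]
    congr 1
    rw [norm_waveSym, Complex.norm_real, Complex.ofReal_re, Real.norm_of_nonneg hb.le,
      Real.rpow_ofNat, show -(b * (2 * Real.pi * ‖ξ‖)) =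
      ((2 : ℕ) : ℝ) * (-(2 * Real.pi * (b / 2) * ‖ξ‖)) by push_cast; ring, Real.exp_nat_mul]
    ring
  simp only [fun κ : ℤ => e (s * 2 ^ κ) (by positivity)]
  rw [← lintegral_finsetSum _ (fun κ _ => by fun_prop)]
  calc _ ≤ ∫⁻ ξ : EuclideanSpace ℝ (Fin n), ENNReal.ofReal 16 *
        ENNReal.ofReal (Real.exp (-(2 * Real.pi * ‖ξ‖) * a) * ‖𝓕 f ξ‖ ^ 2) := by
        refine lintegral_mono fun ξ => ?_
        rw [← ENNReal.ofReal_sum_of_nonneg fun _ _ => by positivity,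
          ← ENNReal.ofReal_mul (by norm_num), ← Finset.sum_mul, ← mul_assoc]
        refine ENNReal.ofReal_le_ofReal (mul_le_mul_of_nonneg_right ?_ (by positivity))
        exact hF _ (by positivity)
    _ ≤ _ := by
        rw [lintegral_const_mul' _ _ ENNReal.ofReal_ne_top, ENNReal.ofReal_mul (by norm_num),
          mul_assoc]
        exact mul_le_mul_right (h a ha f hfm hf) _

lemma exists_enorm_lpOp_le (n : ℕ) : ∃ C : ℝ, 0 < C ∧
    ∀ b : ℝ, 0 < b → ∀ f : EuclideanSpace ℝ (Fin n) → ℂ, ∀ t : ℝ≥0∞, (∀ x, ‖f x‖ₑ ≤ t) →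
    ∀ x, ‖lpOp b f x‖ₑ ≤ ENNReal.ofReal C * t := by
  obtain ⟨C, hC, hK⟩ := exists_norm_waveKer_dilate_le (n := n) 1 (z := (2⁻¹ : ℝ))
    (by rw [Complex.ofReal_re]; positivity)
  obtain ⟨D, hD, hM⟩ := exists_lintegral_majorant_le n
  refine ⟨C * D, by positivity, fun b hb f t hft x => ?_⟩
  have e : lpOp b f x = ∫ y, (b : ℂ) * waveKer 1 ((b / 2 : ℝ) : ℂ) (x - y) * f y := by
    rw [lpOp, waveOp, ← integral_const_mul]
    simp only [mul_assoc]
  rw [e]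
  calc _ ≤ ∫⁻ y : EuclideanSpace ℝ (Fin n), ENNReal.ofReal C *
        ENNReal.ofReal ((b ^ n)⁻¹ * (1 + ‖x - y‖ / b) ^ (-((n : ℝ) + 1))) * t := by
        refine (enorm_integral_le_lintegral_enorm _).trans (lintegral_mono fun y => ?_)
        rw [enorm_mul]
        refine mul_le_mul' ?_ (hft y)
        rw [← ENNReal.ofReal_mul hC.le, ← ofReal_norm]
        refine ENNReal.ofReal_le_ofReal ?_
        have := hK b hb (x - y)
        rwa [pow_one, ← Complex.ofReal_mul, ← div_eq_mul_inv] at this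
    _ ≤ _ := by
        rw [lintegral_mul_const _ (by fun_prop), lintegral_const_mul' _ _ ENNReal.ofReal_ne_top,
          ENNReal.ofReal_mul hC.le]
        exact mul_le_mul_left (mul_le_mul_right (hM b hb x) _) _

/-- Littlewood–Paley inequality in `L^q`, `q ≥ 2`. -/
lemma exists_tsum_lintegral_lpOp_rpow_le (n : ℕ) {q : ℝ} (hq : 2 ≤ q) : ∃ C : ℝ, 0 < C ∧
    ∀ s : ℝ, 0 < s → ∀ f : EuclideanSpace ℝ (Fin n) → ℂ, Measurable f → Integrable f →
    ∑' κ : ℤ, ∫⁻ x, ‖lpOp (s * 2 ^ κ) f x‖ₑ ^ q ≤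
      ENNReal.ofReal C * ∫⁻ x, ‖f x‖ₑ ^ q := by
  obtain ⟨C, hC, h2⟩ := exists_sum_lintegral_lpOp_sq_le n
  rcases hq.eq_or_lt with rfl | hq
  · exact ⟨C, hC, h2⟩
  obtain ⟨D, hD, hinf⟩ := exists_enorm_lpOp_le n
  set A : ℝ := 1 + D + C with hA
  have hA0 : 0 < A := by positivity
  refine ⟨(2 * A) ^ q * (q / (q - 2) + q / (q + 1 - q)), ?_, fun s hs f hfm hf => ?_⟩
  · have : 0 < q - 2 := by linarith
    have : 0 < q + 1 - q := by linarith
    positivity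
  have hb : ∀ κ : ℤ, 0 < s * 2 ^ κ := fun κ => by positivity
  set F : EuclideanSpace ℝ (Fin n) × ℤ → ℝ≥0∞ := fun p => ‖lpOp (s * 2 ^ p.2) f p.1‖ₑ with hF
  have hFm : Measurable F := measurable_from_prod_countable_left fun κ =>
    (continuous_lpOp (hb κ) hf).measurable.enorm
  have h2A : ENNReal.ofReal (2 * A) ≠ 0 := by simpa using hA0
  have hcount : ∀ G : EuclideanSpace ℝ (Fin n) × ℤ → ℝ≥0∞, Measurable G →
      ∫⁻ p, G p ∂(volume.prod Measure.count) = ∑' κ, ∫⁻ x, G (x, κ) := by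
    intro G hG
    rw [lintegral_prod_symm _ hG.aemeasurable, lintegral_count]
  have key := lintegral_rpow_le_of_distribution (μ := (volume : Measure (EuclideanSpace ℝ (Fin n))).prod
    (Measure.count : Measure ℤ)) (ν := volume) (F := fun p => F p / ENNReal.ofReal (2 * A))
    (hFm.div_const _) (φ := fun x => ‖f x‖ₑ) hfm.enorm (fun x => enorm_ne_top) zero_lt_two hq
    (show q < q + 1 by linarith) (fun t ht => ?_)
  · rw [← hcount (fun p => F p ^ q) (hFm.pow_const _)]
    have e : ∀ p, F p ^ q = ENNReal.ofReal ((2 * A) ^ q) *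
        (F p / ENNReal.ofReal (2 * A)) ^ q := by
      intro p
      rw [← ENNReal.ofReal_rpow_of_pos (by positivity), ← ENNReal.mul_rpow_of_nonneg _ _
        (by linarith), ENNReal.mul_div_cancel h2A ENNReal.ofReal_ne_top]
    simp_rw [e]
    rw [lintegral_const_mul' _ _ ENNReal.ofReal_ne_top,
      ENNReal.ofReal_mul (p := (2 * A) ^ q) (by positivity), mul_assoc]
    exact mul_le_mul_right key _
  · refine le_add_right ?_
    set S : Set (EuclideanSpace ℝ (Fin n)) := {x | ENNReal.ofReal t < ‖f x‖ₑ} with hS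
    have hSm : MeasurableSet S := measurableSet_lt measurable_const hfm.enorm
    have hsum : f = S.indicator f + Sᶜ.indicator f := (Set.indicator_self_add_compl S f).symm
    have hsmall : ∀ x, ‖Sᶜ.indicator f x‖ₑ ≤ ENNReal.ofReal t := by
      intro x
      by_cases hx : x ∈ S
      · rw [Set.indicator_of_notMem (by simpa using hx)]; simp
      · rw [Set.indicator_of_mem (by simpa using hx)]
        exact not_lt.1 hx
    set G : EuclideanSpace ℝ (Fin n) × ℤ → ℝ≥0∞ :=
      fun p => ‖lpOp (s * 2 ^ p.2) (S.indicator f) p.1‖ₑ ^ (2:ℝ) with hG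
    have hGm : Measurable G := measurable_from_prod_countable_left fun κ =>
      (continuous_lpOp (hb κ) (hf.indicator hSm)).measurable.enorm.pow_const _
    have hAt : 0 < ENNReal.ofReal (A * t) ^ (2:ℝ) :=
      ENNReal.rpow_pos (by simpa using mul_pos hA0 ht) ENNReal.ofReal_ne_top
    calc _ ≤ (volume.prod Measure.count) {p | ENNReal.ofReal (A * t) ^ (2:ℝ) ≤ G p} := by
          refine measure_mono fun p hp => ?_
          have hp : ENNReal.ofReal t < F p / ENNReal.ofReal (2 * A) := hp
          by_contra hcon
          have hcon : ¬ (ENNReal.ofReal (A * t) ^ (2:ℝ) ≤ G p) := hcon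
          rw [ENNReal.rpow_le_rpow_iff zero_lt_two, not_le] at hcon
          refine absurd hp (not_lt.2 (ENNReal.div_le_of_le_mul ?_))
          have h3 := lpOp_add (hb p.2) (hf.indicator hSm) (hf.indicator hSm.compl) p.1
          rw [← hsum] at h3
          simp only [hF]
          rw [h3]
          refine (enorm_add_le _ _).trans ((add_le_add hcon.le (hinf _ (hb p.2) _ _ hsmall _)).trans ?_)
          rw [← ENNReal.ofReal_mul hD.le, ← ENNReal.ofReal_add (by positivity) (by positivity),
            ← ENNReal.ofReal_mul ht.le]
          refine ENNReal.ofReal_le_ofReal ?_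
          nlinarith
      _ ≤ (∫⁻ p, G p ∂(volume.prod Measure.count)) / ENNReal.ofReal (A * t) ^ (2:ℝ) :=
          meas_ge_le_lintegral_div hGm.aemeasurable hAt.ne' (by simp)
      _ ≤ (ENNReal.ofReal C * ∫⁻ x, ‖S.indicator f x‖ₑ ^ (2:ℝ)) / ENNReal.ofReal (A * t) ^ (2:ℝ) := by
          rw [hcount G hGm]
          exact ENNReal.div_le_div_right (h2 s hs _ (hfm.indicator hSm) (hf.indicator hSm)) _
      _ = ENNReal.ofReal (C / (A * t) ^ 2) * ∫⁻ x, ‖S.indicator f x‖ₑ ^ (2:ℝ) := by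
          rw [ENNReal.ofReal_rpow_of_pos (by positivity), mul_comm, mul_div_assoc, mul_comm,
            ← ENNReal.ofReal_div_of_pos (by positivity), Real.rpow_ofNat]
      _ ≤ ENNReal.ofReal (t ^ (-2:ℝ)) * ∫⁻ x, ‖S.indicator f x‖ₑ ^ (2:ℝ) := by
          refine mul_le_mul_left (ENNReal.ofReal_le_ofReal ?_) _
          rw [Real.rpow_neg ht.le, Real.rpow_ofNat, mul_pow, ← div_div, ← one_div]
          refine div_le_div_of_nonneg_right ?_ (by positivity)
          rw [div_le_one (by positivity)]
          nlinarith
      _ = _ := by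
          congr 1
          refine lintegral_congr fun x => ?_
          by_cases hx : x ∈ S
          · rw [Set.indicator_of_mem hx, Set.indicator_of_mem hx]
          · rw [Set.indicator_of_notMem hx, Set.indicator_of_notMem hx]
            simp

end

/-- Almost orthogonality: vectors sorted into slabs, with strong decay inside each slab and
between distant slabs. -/
lemma norm_sum_sq_le_of_slabs {H ι : Type*} [NormedAddCommGroup H] [InnerProductSpace ℂ H]
    (s : Finset ι) (v : ι → H) (m : ι → ℤ) (L : ℕ) {C₁ C₂ : ℝ}
    (h₁ : ∀ z ∈ s, ∑ z' ∈ s with m z' = m z, ‖inner ℂ (v z) (v z')‖ ≤ C₁)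
    (h₂ : ∀ z ∈ s, ∑ z' ∈ s with (L : ℤ) < |m z - m z'|, ‖inner ℂ (v z) (v z')‖ ≤ C₂) :
    ‖∑ z ∈ s, v z‖ ^ 2 ≤ ((2 * L + 1) * C₁ + C₂) * s.card := by
  classical
  set T := s.image m with hT
  set V : ℤ → H := fun a => ∑ z ∈ s with m z = a, v z with hV
  have hm : ∀ z ∈ s, m z ∈ T := fun z hz => Finset.mem_image_of_mem m hz
  have hsum : ∑ z ∈ s, v z = ∑ a ∈ T, V a := (Finset.sum_fiberwise_of_maps_to hm v).symm
  have hinner : ∀ a b, ‖inner ℂ (V a) (V b)‖ ≤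
      ∑ z ∈ s with m z = a, ∑ z' ∈ s with m z' = b, ‖inner ℂ (v z) (v z')‖ := by
    intro a b
    simp only [hV, sum_inner]
    refine (norm_sum_le _ _).trans (Finset.sum_le_sum fun z _ => ?_)
    rw [inner_sum]
    exact norm_sum_le _ _
  have hVsq : ∀ a, ‖V a‖ ^ 2 ≤ ∑ z ∈ s with m z = a, C₁ := by
    intro a
    have h := hinner a a
    rw [inner_self_eq_norm_sq_to_K, norm_pow] at h
    simp only [RCLike.norm_ofReal, abs_norm] at h
    refine h.trans (Finset.sum_le_sum fun z hz => ?_)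
    rw [Finset.mem_filter] at hz
    have := h₁ z hz.1
    rwa [hz.2] at this
  have hVtot : ∑ a ∈ T, ‖V a‖ ^ 2 ≤ C₁ * s.card := by
    refine (Finset.sum_le_sum fun a _ => hVsq a).trans_eq ?_
    rw [Finset.sum_fiberwise_of_maps_to hm (fun _ => C₁), Finset.sum_const, nsmul_eq_mul, mul_comm]
  have hcard : ∀ a, ((T.filter fun b => |a - b| ≤ (L : ℤ)).card : ℝ) ≤ 2 * L + 1 := by
    intro a
    have : T.filter (fun b => |a - b| ≤ (L : ℤ)) ⊆ Finset.Icc (a - L) (a + L) := by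
      intro b hb
      rw [Finset.mem_filter, abs_le] at hb
      rw [Finset.mem_Icc]
      omega
    have h := Finset.card_le_card this
    rw [Int.card_Icc] at h
    have h' : (T.filter fun b => |a - b| ≤ (L : ℤ)).card ≤ 2 * L + 1 := by omega
    exact_mod_cast h'
  have hnear : ∑ a ∈ T, ∑ b ∈ T with |a - b| ≤ (L : ℤ), ‖inner ℂ (V a) (V b)‖ ≤
      (2 * L + 1) * (C₁ * s.card) := by
    calc _ ≤ ∑ a ∈ T, ∑ b ∈ T with |a - b| ≤ (L : ℤ), (‖V a‖ ^ 2 / 2 + ‖V b‖ ^ 2 / 2) := by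
          refine Finset.sum_le_sum fun a _ => Finset.sum_le_sum fun b _ => ?_
          refine (norm_inner_le_norm _ _).trans ?_
          nlinarith [sq_nonneg (‖V a‖ - ‖V b‖)]
      _ = ∑ a ∈ T, ∑ b ∈ T with |a - b| ≤ (L : ℤ), ‖V a‖ ^ 2 := by
          simp only [Finset.sum_add_distrib, Finset.sum_filter]
          nth_rewrite 2 [Finset.sum_comm]
          rw [← Finset.sum_add_distrib]
          refine Finset.sum_congr rfl fun a _ => ?_
          rw [← Finset.sum_add_distrib]
          refine Finset.sum_congr rfl fun b _ => ?_
          rw [abs_sub_comm b a]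
          split_ifs <;> ring
      _ = ∑ a ∈ T, ((T.filter fun b => |a - b| ≤ (L : ℤ)).card : ℝ) * ‖V a‖ ^ 2 := by
          simp only [Finset.sum_const, nsmul_eq_mul]
      _ ≤ ∑ a ∈ T, (2 * L + 1) * ‖V a‖ ^ 2 :=
          Finset.sum_le_sum fun a _ => mul_le_mul_of_nonneg_right (hcard a) (by positivity)
      _ ≤ _ := by
          rw [← Finset.mul_sum]
          exact mul_le_mul_of_nonneg_left hVtot (by positivity)
  have hfar : ∑ a ∈ T, ∑ b ∈ T with ¬ |a - b| ≤ (L : ℤ), ‖inner ℂ (V a) (V b)‖ ≤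
      C₂ * s.card := by
    calc _ ≤ ∑ a ∈ T, ∑ b ∈ T with ¬ |a - b| ≤ (L : ℤ),
          ∑ z ∈ s with m z = a, ∑ z' ∈ s with m z' = b, ‖inner ℂ (v z) (v z')‖ :=
          Finset.sum_le_sum fun a _ => Finset.sum_le_sum fun b _ => hinner a b
      _ = ∑ a ∈ T, ∑ z ∈ s with m z = a, ∑ b ∈ T, ∑ z' ∈ s with m z' = b,
          if (L : ℤ) < |m z - m z'| then ‖inner ℂ (v z) (v z')‖ else 0 := by
          refine Finset.sum_congr rfl fun a _ => ?_
          rw [Finset.sum_comm]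
          refine Finset.sum_congr rfl fun z hz => ?_
          rw [Finset.mem_filter] at hz
          rw [Finset.sum_filter]
          refine Finset.sum_congr rfl fun b _ => ?_
          by_cases h : |a - b| ≤ (L : ℤ)
          · rw [if_neg (not_not.2 h)]
            refine (Finset.sum_eq_zero fun z' hz' => ?_).symm
            rw [Finset.mem_filter] at hz'
            rw [hz.2, hz'.2, if_neg (not_lt.2 h)]
          · rw [if_pos h]
            refine Finset.sum_congr rfl fun z' hz' => ?_
            rw [Finset.mem_filter] at hz'
            rw [hz.2, hz'.2, if_pos (not_le.1 h)]
      _ = ∑ z ∈ s, ∑ z' ∈ s, if (L : ℤ) < |m z - m z'| then ‖inner ℂ (v z) (v z')‖ else 0 := by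
          rw [Finset.sum_fiberwise_of_maps_to hm]
          refine Finset.sum_congr rfl fun z _ => ?_
          rw [Finset.sum_fiberwise_of_maps_to hm]
      _ ≤ ∑ z ∈ s, C₂ := by
          refine Finset.sum_le_sum fun z hz => ?_
          rw [← Finset.sum_filter]
          exact h₂ z hz
      _ = _ := by rw [Finset.sum_const, nsmul_eq_mul, mul_comm]
  calc ‖∑ z ∈ s, v z‖ ^ 2 = ‖inner ℂ (∑ a ∈ T, V a) (∑ b ∈ T, V b)‖ := by
        rw [hsum, inner_self_eq_norm_sq_to_K, norm_pow]
        simp only [RCLike.norm_ofReal, abs_norm]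
    _ ≤ ∑ a ∈ T, ∑ b ∈ T, ‖inner ℂ (V a) (V b)‖ := by
        rw [sum_inner]
        refine (norm_sum_le _ _).trans (Finset.sum_le_sum fun z _ => ?_)
        rw [inner_sum]
        exact norm_sum_le _ _
    _ = ∑ a ∈ T, (∑ b ∈ T with |a - b| ≤ (L : ℤ), ‖inner ℂ (V a) (V b)‖ +
        ∑ b ∈ T with ¬ |a - b| ≤ (L : ℤ), ‖inner ℂ (V a) (V b)‖) :=
        Finset.sum_congr rfl fun a _ => (Finset.sum_filter_add_sum_filter_not _ _ _).symm
    _ ≤ _ := by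
        rw [Finset.sum_add_distrib]
        linarith

section
variable {n : ℕ}

/-- Sums of a decaying function over a separated set are bounded. -/
lemma exists_sum_one_add_norm_rpow_le (n : ℕ) : ∃ C : ℝ, 0 < C ∧
    ∀ Y : Finset (EuclideanSpace ℝ (Fin n)),
    (∀ y ∈ Y, ∀ y' ∈ Y, y ≠ y' → 1 ≤ dist y y') → ∀ w : EuclideanSpace ℝ (Fin n),
    ∑ y ∈ Y, (1 + ‖w - y‖) ^ (-((n : ℝ) + 1)) ≤ C := by
  obtain ⟨D, hD, hM⟩ := exists_lintegral_majorant_le n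
  set V : ℝ≥0∞ := volume (ball (0 : EuclideanSpace ℝ (Fin n)) 1) with hV
  have hVt : V ≠ ∞ := measure_ball_lt_top.ne
  have hV0 : 0 < V.toReal := ENNReal.toReal_pos (measure_ball_pos _ _ one_pos).ne' hVt
  have hc : 0 < (2⁻¹ : ℝ) ^ n * V.toReal := by positivity
  refine ⟨2 ^ ((n : ℝ) + 1) * D / ((2⁻¹ : ℝ) ^ n * V.toReal), by positivity, fun Y hY w => ?_⟩
  rw [le_div_iff₀ hc, ← ENNReal.ofReal_le_ofReal_iff (by positivity), Finset.sum_mul,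
    ENNReal.ofReal_sum_of_nonneg (fun _ _ => by positivity)]
  have hvol : ∀ y : EuclideanSpace ℝ (Fin n), volume (ball y 2⁻¹) =
      ENNReal.ofReal ((2⁻¹ : ℝ) ^ n * V.toReal) := by
    intro y
    rw [Measure.addHaar_ball_of_pos _ _ (by norm_num), finrank_euclideanSpace_fin,
      ENNReal.ofReal_mul (by positivity), ENNReal.ofReal_toReal hVt]
  calc _ ≤ ∑ y ∈ Y, ∫⁻ v in ball y 2⁻¹, ENNReal.ofReal (2 ^ ((n : ℝ) + 1)) *
        ENNReal.ofReal ((1 + ‖w - v‖) ^ (-((n : ℝ) + 1))) := by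
        refine Finset.sum_le_sum fun y hy => ?_
        rw [ENNReal.ofReal_mul (by positivity), ← hvol y, ← setLIntegral_const]
        refine setLIntegral_mono' measurableSet_ball fun v hv => ?_
        rw [← ENNReal.ofReal_mul (by positivity)]
        refine ENNReal.ofReal_le_ofReal ?_
        rw [Real.rpow_neg (by positivity), Real.rpow_neg (by positivity), ← div_eq_mul_inv,
          ← Real.div_rpow (by norm_num) (by positivity), ← Real.inv_rpow (by positivity)]
        refine Real.rpow_le_rpow (by positivity) ?_ (by positivity)
        rw [inv_eq_one_div, div_le_div_iff₀ (by positivity) (by positivity)]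
        have h1 : ‖w - v‖ ≤ ‖w - y‖ + ‖v - y‖ := by
          rw [show w - v = (w - y) - (v - y) by abel]
          exact norm_sub_le _ _
        rw [mem_ball, dist_eq_norm] at hv
        have := norm_nonneg (w - y)
        linarith
    _ = ∫⁻ v in ⋃ y ∈ Y, ball y 2⁻¹, ENNReal.ofReal (2 ^ ((n : ℝ) + 1)) *
        ENNReal.ofReal ((1 + ‖w - v‖) ^ (-((n : ℝ) + 1))) := by
        rw [lintegral_biUnion_finset _ (fun _ _ => measurableSet_ball)]
        intro y hy y' hy' hne
        refine ball_disjoint_ball ?_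
        have := hY y hy y' hy' hne
        norm_num
        linarith
    _ ≤ ∫⁻ v, ENNReal.ofReal (2 ^ ((n : ℝ) + 1)) *
        ENNReal.ofReal ((1 + ‖w - v‖) ^ (-((n : ℝ) + 1))) := setLIntegral_le_lintegral _ _
    _ ≤ _ := by
        rw [lintegral_const_mul' _ _ ENNReal.ofReal_ne_top, ENNReal.ofReal_mul (by positivity)]
        have := hM 1 one_pos w
        simp only [one_pow, inv_one, one_mul, div_one] at this
        exact mul_le_mul_right this _

lemma pow_sub_pow_le_mul {a b : ℝ} (ha : 0 ≤ a) (hab : a ≤ b) (m : ℕ) :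
    b ^ (m + 1) - a ^ (m + 1) ≤ (m + 1) * ((b - a) * b ^ m) := by
  induction m with
  | zero => simp
  | succ m ih =>
    have h1 : a ^ (m + 1) ≤ b ^ (m + 1) := pow_le_pow_left₀ ha hab _
    have h2 := mul_le_mul_of_nonneg_left ih (ha.trans hab)
    have h3 := mul_le_mul_of_nonneg_right h1 (sub_nonneg.2 hab)
    push_cast
    calc b ^ (m + 1 + 1) - a ^ (m + 1 + 1)
        = b * (b ^ (m + 1) - a ^ (m + 1)) + a ^ (m + 1) * (b - a) := by ring
      _ ≤ b * ((m + 1) * ((b - a) * b ^ m)) + b ^ (m + 1) * (b - a) := add_le_add h2 h3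
      _ = _ := by ring

/-- Volume of a spherical shell. -/
lemma volume_shell_le (hn : 0 < n) : ∃ C : ℝ, 0 < C ∧ ∀ y : EuclideanSpace ℝ (Fin n), ∀ t h : ℝ,
    0 ≤ t → 0 ≤ h → volume {w | abs (‖w - y‖ - t) ≤ h} ≤
      ENNReal.ofReal (C * (h * (t + h) ^ (n - 1))) := by
  have : Nonempty (Fin n) := ⟨⟨0, hn⟩⟩
  obtain ⟨V, hV0, hV⟩ : ∃ V : ℝ, 0 < V ∧
      volume (ball (0 : EuclideanSpace ℝ (Fin n)) 1) = ENNReal.ofReal V :=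
    ⟨_, ENNReal.toReal_pos (measure_ball_pos _ _ one_pos).ne' measure_ball_lt_top.ne,
      (ENNReal.ofReal_toReal measure_ball_lt_top.ne).symm⟩
  refine ⟨2 * n * V, by positivity, fun y t h ht hh => ?_⟩
  obtain ⟨r, hr⟩ : ∃ r, r = max (t - h) 0 := ⟨_, rfl⟩
  have hr0 : 0 ≤ r := hr ▸ le_max_right _ _
  have hrt : r ≤ t + h := hr ▸ max_le (by linarith) (by linarith)
  have hr2 : t - h ≤ r := hr ▸ le_max_left _ _
  have hsub : {w | abs (‖w - y‖ - t) ≤ h} ⊆ closedBall y (t + h) \ ball y r := by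
    intro w hw
    have hw : abs (‖w - y‖ - t) ≤ h := hw
    rw [abs_le] at hw
    rw [Set.mem_sdiff, mem_closedBall, mem_ball, dist_eq_norm, not_lt, hr]
    exact ⟨by linarith, max_le (by linarith) (norm_nonneg _)⟩
  refine (measure_mono hsub).trans ?_
  rw [measure_sdiff (ball_subset_closedBall.trans (closedBall_subset_closedBall hrt))
    measurableSet_ball.nullMeasurableSet measure_ball_lt_top.ne,
    Measure.addHaar_closedBall _ _ (by linarith), Measure.addHaar_ball _ _ hr0,
    finrank_euclideanSpace_fin, hV, ← ENNReal.ofReal_mul (by positivity),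
    ← ENNReal.ofReal_mul (by positivity), ← ENNReal.ofReal_sub _ (by positivity)]
  refine ENNReal.ofReal_le_ofReal ?_
  rw [← sub_mul, mul_right_comm _ V]
  refine mul_le_mul_of_nonneg_right ?_ hV0.le
  obtain ⟨m, rfl⟩ : ∃ m, n = m + 1 := ⟨n - 1, by omega⟩
  refine (pow_sub_pow_le_mul hr0 hrt m).trans ?_
  rw [Nat.add_sub_cancel]
  push_cast
  have : t + h - r ≤ 2 * h := by linarith
  have h2 := mul_le_mul_of_nonneg_right this (by positivity : 0 ≤ (t + h) ^ m)
  nlinarith [mul_le_mul_of_nonneg_left h2 (by positivity : (0:ℝ) ≤ m + 1)]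

end

/-- The complex time of the localized propagators. -/
noncomputable def locTime (R t : ℝ) : ℂ := ((t / R - 1 / 2 : ℝ) : ℂ) - (t : ℂ) * Complex.I

lemma locTime_re (R t : ℝ) : (locTime R t).re = t / R - 1 / 2 := by
  simp only [locTime, Complex.sub_re, Complex.ofReal_re, Complex.mul_re, Complex.I_re,
    Complex.ofReal_im, Complex.I_im]
  ring

lemma locTime_im (R t : ℝ) : (locTime R t).im = -t := by
  simp only [locTime, Complex.sub_im, Complex.ofReal_im, Complex.mul_im, Complex.I_re,
    Complex.ofReal_re, Complex.I_im]
  ring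

lemma locTime_re_mem {R t : ℝ} (hR : 1 ≤ R) (ht : t ∈ Set.Icc R (2 * R)) :
    1 / 2 ≤ (locTime R t).re ∧ (locTime R t).re ≤ 3 / 2 := by
  have hR0 : 0 < R := by linarith
  rw [locTime_re]
  have h1 : 1 ≤ t / R := (one_le_div hR0).2 ht.1
  have h2 : t / R ≤ 2 := (div_le_iff₀ hR0).2 ht.2
  constructor <;> linarith

section
variable {n : ℕ}

lemma norm_waveKer_le_inv_pow (hn : 1 ≤ n) (k : ℕ) : ∃ C : ℝ, 0 < C ∧ ∀ z : ℂ, 1 / 2 ≤ z.re →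
    z.re ≤ 3 → ∀ x : EuclideanSpace ℝ (Fin n),
      ‖waveKer k z x‖ ≤ C * ((1 + abs (‖x‖ - |z.im|))⁻¹ ^ k) := by
  obtain ⟨C, hC, h⟩ := norm_waveKer_le n k
  refine ⟨C, hC, fun z h1 h2 x => (h z h1 h2 x).trans ?_⟩
  set A := 1 + ‖x‖ + |z.im|
  have hA : 1 ≤ A := by simp only [A]; linarith [norm_nonneg x, abs_nonneg z.im]
  set B := 1 + abs (‖x‖ - |z.im|)
  have hB : 1 ≤ B := by simp only [B]; linarith [abs_nonneg (‖x‖ - |z.im|)]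
  have hAB : A ≤ A * B := le_mul_of_one_le_right (by linarith) hB
  have hexp : (A * B) ^ (-(((n:ℝ) + 1) / 2)) ≤ A⁻¹ := by
    calc (A * B) ^ (-(((n:ℝ) + 1) / 2)) ≤ (A * B) ^ (-1 : ℝ) := by
          refine Real.rpow_le_rpow_of_exponent_le (hA.trans hAB) ?_
          have : (1:ℝ) ≤ n := by exact_mod_cast hn
          linarith
      _ = (A * B)⁻¹ := Real.rpow_neg_one _
      _ ≤ A⁻¹ := inv_anti₀ (by linarith) hAB
  have : A * (A * B) ^ (-(((n:ℝ) + 1) / 2)) ≤ 1 := by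
    refine (mul_le_mul_of_nonneg_left hexp (by linarith)).trans_eq ?_
    exact mul_inv_cancel₀ (by linarith)
  have hBk : (0:ℝ) ≤ B⁻¹ ^ k := by positivity
  nlinarith [mul_le_mul_of_nonneg_right this hBk]

lemma norm_waveKer_le_rpow (n k : ℕ) : ∃ C : ℝ, 0 < C ∧ ∀ z : ℂ, 1 / 2 ≤ z.re →
    z.re ≤ 3 → ∀ x : EuclideanSpace ℝ (Fin n),
      ‖waveKer k z x‖ ≤ C * (1 + ‖x‖ + |z.im|) ^ (-(((n:ℝ) - 1) / 2)) := by
  obtain ⟨C, hC, h⟩ := norm_waveKer_le n k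
  refine ⟨C, hC, fun z h1 h2 x => (h z h1 h2 x).trans ?_⟩
  set A := 1 + ‖x‖ + |z.im|
  have hA : 1 ≤ A := by simp only [A]; linarith [norm_nonneg x, abs_nonneg z.im]
  set B := 1 + abs (‖x‖ - |z.im|)
  have hB : 1 ≤ B := by simp only [B]; linarith [abs_nonneg (‖x‖ - |z.im|)]
  have hAB : A ≤ A * B := le_mul_of_one_le_right (by linarith) hB
  have hexp : (A * B) ^ (-(((n:ℝ) + 1) / 2)) ≤ A ^ (-(((n:ℝ) + 1) / 2)) :=
    Real.rpow_le_rpow_of_nonpos (by linarith) hAB (by linarith [(Nat.cast_nonneg n : (0:ℝ) ≤ n)])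
  have hBk : B⁻¹ ^ k ≤ 1 := pow_le_one₀ (by positivity) (inv_le_one_of_one_le₀ hB)
  have hfin : A * A ^ (-(((n:ℝ) + 1) / 2)) = A ^ (-(((n:ℝ) - 1) / 2)) := by
    nth_rewrite 1 [← Real.rpow_one A]
    rw [← Real.rpow_add (by linarith)]
    congr 1; ring
  rw [← mul_assoc C]
  calc C * (A * (A * B) ^ (-(((n:ℝ) + 1) / 2))) * B⁻¹ ^ k
      ≤ C * (A * A ^ (-(((n:ℝ) + 1) / 2))) * 1 := by gcongr
    _ = _ := by rw [mul_one, hfin]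

/-- Decay of the localized kernels away from the light cone. -/
lemma norm_waveKer_locTime_le (hn : 1 ≤ n) {ε : ℝ} (hε : 0 < ε) (hε1 : ε ≤ 1) {k : ℕ}
    (hk : (n : ℝ) + 1 ≤ ε * k) : ∃ C : ℝ, 0 < C ∧ ∀ R : ℝ, 1 ≤ R → ∀ t ∈ Set.Icc R (2 * R),
    ∀ x : EuclideanSpace ℝ (Fin n), R ^ ε < abs (‖x‖ - t) →
      ‖waveKer k (locTime R t) x‖ ≤ C * (1 + ‖x‖) ^ (-((n : ℝ) + 1)) := by
  obtain ⟨C, hC, h⟩ := norm_waveKer_le_inv_pow hn k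
  refine ⟨C * 5 ^ k, by positivity, fun R hR t ht x hx => ?_⟩
  obtain ⟨h1, h2⟩ := locTime_re_mem hR ht
  refine (h _ h1 (by linarith) x).trans ?_
  have ht0 : 0 ≤ t := by linarith [ht.1]
  rw [locTime_im, abs_neg, abs_of_nonneg ht0, mul_assoc]
  refine mul_le_mul_of_nonneg_left ?_ hC.le
  have hx0 := norm_nonneg x
  have hB : (1 + ‖x‖) ^ ε / 5 ≤ 1 + abs (‖x‖ - t) := by
    rcases le_or_gt ‖x‖ (2 * t) with hxt | hxt
    · have h5 : (1 + ‖x‖) / 5 ≤ R := by linarith [ht.2]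
      have h6 : ((1 + ‖x‖) / 5) ^ ε ≤ R ^ ε := Real.rpow_le_rpow (by positivity) h5 hε.le
      rw [Real.div_rpow (by positivity) (by norm_num)] at h6
      have h7 : (5:ℝ) ^ ε ≤ 5 := by
        simpa using Real.rpow_le_rpow_of_exponent_le (by norm_num : (1:ℝ) ≤ 5) hε1
      have h8 : (1 + ‖x‖) ^ ε / 5 ≤ (1 + ‖x‖) ^ ε / 5 ^ ε := by gcongr
      linarith
    · have h6 : (1 + ‖x‖) ^ ε ≤ 1 + ‖x‖ := by
        simpa using Real.rpow_le_rpow_of_exponent_le (by linarith : (1:ℝ) ≤ 1 + ‖x‖) hε1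
      have h7 : ‖x‖ - t ≤ abs (‖x‖ - t) := le_abs_self _
      linarith
  have hp : 0 < (1 + ‖x‖) ^ ε / 5 := by positivity
  calc (1 + abs (‖x‖ - t))⁻¹ ^ k ≤ ((1 + ‖x‖) ^ ε / 5)⁻¹ ^ k :=
        pow_le_pow_left₀ (by positivity) (inv_anti₀ hp hB) _
    _ = 5 ^ k * (1 + ‖x‖) ^ (-(ε * k)) := by
        rw [inv_div, div_pow, Real.rpow_neg (by positivity), Real.rpow_mul (by positivity),
          Real.rpow_natCast, div_eq_mul_inv]
    _ ≤ _ := by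
        gcongr
        linarith

lemma exists_sum_one_add_rpow_le {a : ℝ} (ha : 1 < a) : ∃ C : ℝ, 0 < C ∧
    ∀ {ι : Type} (S : Finset ι) (d : ι → ℝ) (L M u : ℝ), 1 ≤ L → 0 ≤ u →
    (∀ z ∈ S, L < d z ∧ d z ≤ M) →
    (∀ ρ, 1 ≤ ρ → ρ ≤ 2 * M → ((S.filter fun z => d z ≤ ρ).card : ℝ) ≤ u * ρ) →
    ∑ z ∈ S, (1 + d z) ^ (-a) ≤ C * (u * L ^ (-(a - 1))) := by
  set r : ℝ := 2 ^ (-(a - 1)) with hr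
  have hr0 : 0 < r := by positivity
  have hr1 : r < 1 := Real.rpow_lt_one_of_one_lt_of_neg (by norm_num) (by linarith)
  have h1r : 0 < 1 - r := by linarith
  refine ⟨2 * 2 ^ (a - 1) * (1 - r)⁻¹, by positivity, fun {ι} S d L M u hL hu hS hcard => ?_⟩
  classical
  rcases S.eq_empty_or_nonempty with rfl | hne
  · simp only [Finset.sum_empty]; positivity
  have hex : ∀ z, ∃ j : ℕ, z ∈ S → (2:ℝ) ^ j ≤ d z ∧ d z < 2 ^ (j + 1) := by
    intro z
    by_cases hz : z ∈ S
    · obtain ⟨j, hj⟩ := exists_nat_pow_near (hL.trans (hS z hz).1.le) (one_lt_two : (1:ℝ) < 2)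
      exact ⟨j, fun _ => hj⟩
    · exact ⟨0, fun h => absurd h hz⟩
  choose j hj using hex
  set F := S.image j with hF
  have hFne : F.Nonempty := hne.image j
  have hrj : ∀ i : ℕ, (2:ℝ) ^ i * ((2:ℝ) ^ i) ^ (-a) = r ^ i := by
    intro i
    have h2 : (0:ℝ) < 2 ^ i := by positivity
    nth_rewrite 1 [← Real.rpow_one ((2:ℝ) ^ i)]
    rw [← Real.rpow_add h2, hr, ← Real.rpow_natCast, ← Real.rpow_natCast, ← Real.rpow_mul (by norm_num),
      ← Real.rpow_mul (by norm_num)]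
    congr 1; ring
  have hsum : ∑ z ∈ S, (1 + d z) ^ (-a) ≤ ∑ i ∈ F, 2 * u * r ^ i := by
    rw [← Finset.sum_fiberwise_of_maps_to (t := F) (g := j)
      (fun z hz => Finset.mem_image_of_mem j hz)]
    refine Finset.sum_le_sum fun i hi => ?_
    have hb : ∀ z ∈ S.filter (fun z => j z = i), (1 + d z) ^ (-a) ≤ ((2:ℝ) ^ i) ^ (-a) := by
      intro z hz
      obtain ⟨hzS, rfl⟩ := Finset.mem_filter.1 hz
      exact Real.rpow_le_rpow_of_nonpos (by positivity) (by linarith [(hj z hzS).1]) (by linarith)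
    refine (Finset.sum_le_card_nsmul _ _ _ hb).trans ?_
    rw [nsmul_eq_mul]
    obtain ⟨z₀, hz₀, rfl⟩ := Finset.mem_image.1 hi
    have hc : ((S.filter fun z => j z = j z₀).card : ℝ) ≤ u * 2 ^ (j z₀ + 1) := by
      refine le_trans ?_ (hcard (2 ^ (j z₀ + 1)) (one_le_pow₀ (by norm_num)) ?_)
      · refine Nat.cast_le.2 (Finset.card_le_card fun z hz => ?_)
        obtain ⟨hzS, h⟩ := Finset.mem_filter.1 hz
        exact Finset.mem_filter.2 ⟨hzS, h ▸ (hj z hzS).2.le⟩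
      · rw [pow_succ]
        linarith [(hj z₀ hz₀).1, (hS z₀ hz₀).2]
    calc _ ≤ u * 2 ^ (j z₀ + 1) * ((2:ℝ) ^ j z₀) ^ (-a) := by gcongr
      _ = 2 * u * (2 ^ j z₀ * ((2:ℝ) ^ j z₀) ^ (-a)) := by ring
      _ = _ := by rw [hrj]
  refine hsum.trans ?_
  set j₀ := F.min' hFne
  obtain ⟨z₀, hz₀, hjz⟩ := Finset.mem_image.1 (F.min'_mem hFne)
  have hge : ∀ i ∈ F, j₀ ≤ i := fun i hi => F.min'_le i hi
  have hinj : Set.InjOn (fun i => i - j₀) (F : Set ℕ) := by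
    intro x hx y hy hxy
    have := hge x hx; have := hge y hy
    simp only at hxy
    omega
  have hgeo : ∑ i ∈ F, r ^ i ≤ r ^ j₀ * (1 - r)⁻¹ := by
    calc ∑ i ∈ F, r ^ i = r ^ j₀ * ∑ i ∈ F, r ^ (i - j₀) := by
          rw [Finset.mul_sum]
          exact Finset.sum_congr rfl fun i hi => by rw [← pow_add, Nat.add_sub_cancel' (hge i hi)]
      _ = r ^ j₀ * ∑ i ∈ F.image (fun i => i - j₀), r ^ i := by
          rw [Finset.sum_image hinj]
      _ ≤ r ^ j₀ * (1 - r)⁻¹ := by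
          refine mul_le_mul_of_nonneg_left ?_ (by positivity)
          rw [← tsum_geometric_of_lt_one hr0.le hr1]
          exact (summable_geometric_of_lt_one hr0.le hr1).sum_le_tsum _ (fun i _ => by positivity)
  have hj₀ : r ^ j₀ ≤ 2 ^ (a - 1) * L ^ (-(a - 1)) := by
    have h1 : L / 2 ≤ 2 ^ j₀ := by
      have := (hj z₀ hz₀).2
      rw [hjz, pow_succ] at this
      linarith [(hS z₀ hz₀).1]
    calc r ^ j₀ = ((2:ℝ) ^ j₀) ^ (-(a - 1)) := by
          rw [hr, ← Real.rpow_natCast, ← Real.rpow_natCast, ← Real.rpow_mul (by norm_num),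
            ← Real.rpow_mul (by norm_num), mul_comm]
      _ ≤ (L / 2) ^ (-(a - 1)) :=
          Real.rpow_le_rpow_of_nonpos (by linarith) h1 (by linarith)
      _ = _ := by
          rw [Real.div_rpow (by linarith) (by norm_num), Real.rpow_neg (by norm_num : (0:ℝ) ≤ 2),
            div_inv_eq_mul, mul_comm]
  rw [← Finset.mul_sum]
  calc 2 * u * ∑ i ∈ F, r ^ i ≤ 2 * u * (2 ^ (a - 1) * L ^ (-(a - 1)) * (1 - r)⁻¹) := by
        gcongr
        exact hgeo.trans (by gcongr)
    _ = _ := by ring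

lemma memLp_two_waveKer_sub (k : ℕ) {z : ℂ} (hz : 0 < z.re) (x : EuclideanSpace ℝ (Fin n)) :
    MemLp (fun w => waveKer k z (x - w)) 2 := by
  have hc : Continuous fun w => waveKer k z (x - w) :=
    (continuous_waveKer k hz).comp (continuous_const.sub continuous_id)
  obtain ⟨C, hC, hb⟩ := norm_waveKer_le_const (n := n) k hz
  refine (memLp_two_iff_integrable_sq_norm hc.aestronglyMeasurable).2 ?_
  refine Integrable.mono' (((integrable_waveKer (n := n) k hz).comp_sub_left x).norm.const_mul C)
    (hc.norm.pow 2).aestronglyMeasurable (Eventually.of_forall fun w => ?_)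
  rw [Real.norm_of_nonneg (by positivity), sq]
  exact mul_le_mul_of_nonneg_right (hb _) (norm_nonneg _)

lemma lintegral_enorm_sq_eq {v : Lp ℂ 2 (volume : Measure (EuclideanSpace ℝ (Fin n)))}
    {f : EuclideanSpace ℝ (Fin n) → ℂ} (h : v =ᵐ[volume] f) :
    ∫⁻ w, ‖f w‖ₑ ^ (2:ℝ) = ENNReal.ofReal (‖v‖ ^ 2) := by
  have h1 : ∫⁻ w, ‖f w‖ₑ ^ (2:ℝ) = ∫⁻ w, ‖v w‖ₑ ^ (2:ℝ) :=
    lintegral_congr_ae (h.mono fun w hw => by simp only [hw])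
  rw [h1, ENNReal.ofReal_pow (norm_nonneg _), ofReal_norm, Lp.enorm_def,
    eLpNorm_eq_lintegral_rpow_enorm_toReal two_ne_zero ENNReal.ofNat_ne_top, ENNReal.toReal_ofNat,
    ← ENNReal.rpow_natCast, ← ENNReal.rpow_mul]
  norm_num

/-- The Hilbert space vectors attached to finitely many wave packets. -/
lemma exists_waveVec (k : ℕ) {R : ℝ} (hR : 1 ≤ R) (S : Finset (EuclideanSpace ℝ (Fin n) × ℝ))
    (ht : ∀ z ∈ S, z.2 ∈ Set.Icc R (2 * R)) (γ : EuclideanSpace ℝ (Fin n) × ℝ → ℂ)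
    (hγ : ∀ z, ‖γ z‖ ≤ 1) :
    ∃ v : EuclideanSpace ℝ (Fin n) × ℝ → Lp ℂ 2 (volume : Measure (EuclideanSpace ℝ (Fin n))),
      (∀ z ∈ S, ∀ z' ∈ S, ‖inner ℂ (v z) (v z')‖ ≤
        ‖waveKer (k + k) (locTime R z'.2 + (starRingEnd ℂ) (locTime R z.2)) (z'.1 - z.1)‖) ∧
      ∫⁻ w, ‖∑ z ∈ S, γ z * waveKer k (locTime R z.2) (z.1 - w)‖ₑ ^ (2:ℝ) =
        ENNReal.ofReal (‖∑ z ∈ S, v z‖ ^ 2) := by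
  have hre : ∀ z ∈ S, 0 < (locTime R z.2).re := fun z hz => by
    linarith [(locTime_re_mem hR (ht z hz)).1]
  have hex : ∀ z, ∃ v : Lp ℂ 2 (volume : Measure (EuclideanSpace ℝ (Fin n))), z ∈ S →
      v =ᵐ[volume] fun w => γ z * waveKer k (locTime R z.2) (z.1 - w) := by
    intro z
    by_cases hz : z ∈ S
    · exact ⟨((memLp_two_waveKer_sub k (hre z hz) z.1).const_mul (γ z)).toLp _,
        fun _ => MemLp.coeFn_toLp _⟩
    · exact ⟨0, fun h => absurd h hz⟩
  choose v hv using hex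
  refine ⟨v, fun z hz z' hz' => ?_, lintegral_enorm_sq_eq ?_⟩
  · have h1 : inner ℂ (v z) (v z') = γ z' * (starRingEnd ℂ) (γ z) *
        waveKer (k + k) (locTime R z'.2 + (starRingEnd ℂ) (locTime R z.2)) (z'.1 - z.1) := by
      rw [← integral_waveKer_mul_conj k (hre z' hz') (hre z hz), ← integral_const_mul, L2.inner_def]
      refine integral_congr_ae ?_
      filter_upwards [hv z hz, hv z' hz'] with w h h'
      rw [h, h', RCLike.inner_apply, map_mul]
      ring
    rw [h1, norm_mul, norm_mul, RCLike.norm_conj]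
    have : ‖γ z'‖ * ‖γ z‖ ≤ 1 := mul_le_one₀ (hγ _) (norm_nonneg _) (hγ _)
    exact mul_le_of_le_one_left (norm_nonneg _) this
  · refine (Lp.coeFn_finsetSum S v).trans ?_
    have : ∀ᵐ w, ∀ z ∈ S, v z w = γ z * waveKer k (locTime R z.2) (z.1 - w) :=
      (Finset.eventually_all S).2 fun z hz => hv z hz
    filter_upwards [this] with w hw
    rw [Finset.sum_apply]
    exact Finset.sum_congr rfl hw

lemma exists_sum_fst_one_add_norm_rpow_le (n : ℕ) : ∃ C : ℝ, 0 < C ∧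
    ∀ S : Finset (EuclideanSpace ℝ (Fin n) × ℝ),
    (∀ z ∈ S, ∀ z' ∈ S, z ≠ z' → 1 ≤ dist z.1 z'.1) → ∀ w : EuclideanSpace ℝ (Fin n),
    ∑ z ∈ S, (1 + ‖w - z.1‖) ^ (-((n : ℝ) + 1)) ≤ C := by
  obtain ⟨C, hC, h⟩ := exists_sum_one_add_norm_rpow_le n
  refine ⟨C, hC, fun S hS w => ?_⟩
  classical
  have hinj : Set.InjOn Prod.fst (S : Set (EuclideanSpace ℝ (Fin n) × ℝ)) := by
    intro z hz z' hz' hzz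
    by_contra hne
    have := hS z hz z' hz' hne
    rw [hzz, dist_self] at this
    linarith
  rw [← Finset.sum_image (f := fun y => (1 + ‖w - y‖) ^ (-((n : ℝ) + 1))) hinj]
  refine h _ (fun y hy y' hy' hne => ?_) w
  obtain ⟨z, hz, rfl⟩ := Finset.mem_image.1 hy
  obtain ⟨z', hz', rfl⟩ := Finset.mem_image.1 hy'
  exact hS z hz z' hz' fun h => hne (by rw [h])

lemma abs_sub_gt_of_floor {L : ℕ} {t t' : ℝ} (h : (L : ℤ) < |⌊t⌋ - ⌊t'⌋|) : (L : ℝ) < |t - t'| := by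
  have h1 := Int.floor_le t
  have h2 := Int.lt_floor_add_one t
  have h3 := Int.floor_le t'
  have h4 := Int.lt_floor_add_one t'
  rcases le_total 0 (⌊t⌋ - ⌊t'⌋) with hs | hs
  · rw [abs_of_nonneg hs] at h
    have h5 : ((L : ℤ) : ℝ) + 1 ≤ ⌊t⌋ - ⌊t'⌋ := by exact_mod_cast h
    simp only [Int.cast_natCast] at h5
    exact lt_of_lt_of_le (by linarith) (le_abs_self _)
  · rw [abs_of_nonpos hs] at h
    have h5 : ((L : ℤ) : ℝ) + 1 ≤ -(⌊t⌋ - ⌊t'⌋) := by exact_mod_cast h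
    simp only [Int.cast_natCast] at h5
    exact lt_of_lt_of_le (by linarith) (neg_le_abs _)

lemma abs_sub_le_one_of_floor {t t' : ℝ} (h : ⌊t'⌋ = ⌊t⌋) : |t - t'| ≤ 1 :=
  (Int.abs_sub_lt_one_of_floor_eq_floor h.symm).le

/-- Almost orthogonality of wave packets whose base points are sparse. -/
lemma lintegral_sum_waveKer_sq_le (hn : 4 ≤ n) {k : ℕ} (hk : n + 1 ≤ k + k) :
    ∃ C : ℝ, 0 < C ∧ ∀ R u : ℝ, 1 ≤ R → 1 ≤ u →
    ∀ S : Finset (EuclideanSpace ℝ (Fin n) × ℝ),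
    (∀ z ∈ S, ∀ z' ∈ S, z ≠ z' → 1 ≤ dist z.1 z'.1) →
    (∀ z ∈ S, z.2 ∈ Set.Icc R (2 * R)) →
    (∀ z ∈ S, ∀ ρ, 1 ≤ ρ → ρ ≤ 16 * R → ((S.filter fun z' => dist z' z ≤ ρ).card : ℝ) ≤ 2 * u * ρ) →
    ∀ γ : EuclideanSpace ℝ (Fin n) × ℝ → ℂ, (∀ z, ‖γ z‖ ≤ 1) →
      ∫⁻ w, ‖∑ z ∈ S, γ z * waveKer k (locTime R z.2) (z.1 - w)‖ₑ ^ (2:ℝ) ≤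
        ENNReal.ofReal (C * min (u ^ (2 / ((n : ℝ) - 1))) R * S.card) := by
  have hn' : (4:ℝ) ≤ n := by exact_mod_cast hn
  set a : ℝ := ((n:ℝ) - 1) / 2 with ha
  have ha1 : 1 < a := by rw [ha]; linarith
  obtain ⟨B₀, hB₀, hsep⟩ := exists_sum_fst_one_add_norm_rpow_le n
  obtain ⟨B₁, hB₁, hnear⟩ := norm_waveKer_le_of_abs_im_le n (k + k)
  obtain ⟨B₂, hB₂, hmid⟩ := norm_waveKer_le_rpow n (k + k)
  obtain ⟨B₃, hB₃, hfar⟩ := norm_waveKer_le_inv_pow (n := n) (by omega) (k + k)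
  obtain ⟨B₄, hB₄, hgeo⟩ := exists_sum_one_add_rpow_le ha1
  refine ⟨5 * (B₁ * B₀) + B₃ * 2 ^ (k + k) * B₀ + 2 * B₂ * B₄, by positivity, ?_⟩
  intro R u hR hu S hS ht hcard γ hγ
  obtain ⟨v, hv, hInt⟩ := exists_waveVec k hR S ht γ hγ
  rw [hInt]
  refine ENNReal.ofReal_le_ofReal ?_
  have hre : ∀ z ∈ S, ∀ z' ∈ S, 1 / 2 ≤ (locTime R z'.2 + (starRingEnd ℂ) (locTime R z.2)).re ∧
      (locTime R z'.2 + (starRingEnd ℂ) (locTime R z.2)).re ≤ 3 ∧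
      |(locTime R z'.2 + (starRingEnd ℂ) (locTime R z.2)).im| = |z.2 - z'.2| := by
    intro z hz z' hz'
    have h1 := locTime_re_mem hR (ht z hz)
    have h2 := locTime_re_mem hR (ht z' hz')
    rw [Complex.add_re, Complex.conj_re, Complex.add_im, Complex.conj_im, locTime_im, locTime_im]
    refine ⟨by linarith, by linarith, by congr 1; ring⟩
  have hsum : ∀ z : EuclideanSpace ℝ (Fin n) × ℝ, ∀ T ⊆ S,
      ∑ z' ∈ T, (1 + ‖z'.1 - z.1‖) ^ (-((n : ℝ) + 1)) ≤ B₀ := by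
    intro z T hT
    refine (Finset.sum_le_sum_of_subset_of_nonneg hT fun _ _ _ => by positivity).trans ?_
    refine le_trans (Finset.sum_le_sum fun z' _ => ?_) (hsep S hS z.1)
    rw [norm_sub_rev]
  have hC₁ : ∀ z ∈ S, ∑ z' ∈ S with ⌊z'.2⌋ = ⌊z.2⌋, ‖inner ℂ (v z) (v z')‖ ≤ B₁ * B₀ := by
    intro z hz
    refine le_trans (Finset.sum_le_sum fun z' hz' => ?_)
      ((Finset.mul_sum _ _ _).symm.trans_le
        (mul_le_mul_of_nonneg_left (hsum z _ (Finset.filter_subset _ _)) hB₁.le))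
    obtain ⟨hz'S, hfl⟩ := Finset.mem_filter.1 hz'
    obtain ⟨h1, h2, h3⟩ := hre z hz z' hz'S
    exact (hv z hz z' hz'S).trans (hnear _ h1 h2 (h3.trans_le (abs_sub_le_one_of_floor hfl)) _)
  have htt : ∀ z ∈ S, ∀ z' ∈ S, |z.2 - z'.2| ≤ R := by
    intro z hz z' hz'
    have h1 := ht z hz
    have h2 := ht z' hz'
    rw [abs_le]
    constructor <;> linarith [h1.1, h1.2, h2.1, h2.2]
  have hdist : ∀ z z' : EuclideanSpace ℝ (Fin n) × ℝ,
      dist z' z = max ‖z'.1 - z.1‖ |z.2 - z'.2| := by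
    intro z z'
    rw [Prod.dist_eq, dist_eq_norm, dist_comm z'.2, Real.dist_eq]
  have hpt : ∀ z ∈ S, ∀ z' ∈ S, ‖inner ℂ (v z) (v z')‖ ≤
      B₃ * 2 ^ (k + k) * (1 + ‖z'.1 - z.1‖) ^ (-((n : ℝ) + 1)) +
        if dist z' z ≤ 8 * R then B₂ * (1 + dist z' z) ^ (-a) else 0 := by
    intro z hz z' hz'
    obtain ⟨h1, h2, h3⟩ := hre z hz z' hz'
    have hx0 := norm_nonneg (z'.1 - z.1)
    have ht0 := abs_nonneg (z.2 - z'.2)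
    refine (hv z hz z' hz').trans ?_
    split_ifs with hd
    · refine (hmid _ h1 h2 _).trans (le_add_of_nonneg_of_le (by positivity) ?_)
      rw [h3]
      refine mul_le_mul_of_nonneg_left (Real.rpow_le_rpow_of_nonpos (by positivity) ?_
        (by linarith)) hB₂.le
      rw [hdist, add_assoc]
      gcongr
      exact max_le (by linarith) (by linarith)
    · rw [add_zero]
      refine (hfar _ h1 h2 _).trans ?_
      rw [h3, mul_assoc]
      refine mul_le_mul_of_nonneg_left ?_ hB₃.le
      have hx : 8 * R < ‖z'.1 - z.1‖ := by
        rw [hdist, not_le, lt_max_iff] at hd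
        rcases hd with h | h
        · exact h
        · linarith [htt z hz z' hz']
      have hlow : (1 + ‖z'.1 - z.1‖) / 2 ≤ 1 + abs (‖z'.1 - z.1‖ - |z.2 - z'.2|) := by
        have := le_abs_self (‖z'.1 - z.1‖ - |z.2 - z'.2|)
        linarith [htt z hz z' hz']
      calc (1 + abs (‖z'.1 - z.1‖ - |z.2 - z'.2|))⁻¹ ^ (k + k)
          ≤ ((1 + ‖z'.1 - z.1‖) / 2)⁻¹ ^ (k + k) :=
            pow_le_pow_left₀ (by positivity) (inv_anti₀ (by positivity) hlow) _
        _ = 2 ^ (k + k) * (1 + ‖z'.1 - z.1‖) ^ (-((k + k : ℕ) : ℝ)) := by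
            rw [inv_div, div_pow, Real.rpow_neg (by positivity), Real.rpow_natCast, div_eq_mul_inv]
        _ ≤ _ := by
            refine mul_le_mul_of_nonneg_left (Real.rpow_le_rpow_of_exponent_le (by linarith) ?_)
              (by positivity)
            have : ((n + 1 : ℕ) : ℝ) ≤ (k + k : ℕ) := by exact_mod_cast hk
            push_cast at this ⊢
            linarith
  have hC₂ : ∀ L : ℕ, 1 ≤ L → ∀ z ∈ S,
      ∑ z' ∈ S with (L:ℤ) < |⌊z.2⌋ - ⌊z'.2⌋|, ‖inner ℂ (v z) (v z')‖ ≤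
        B₃ * 2 ^ (k + k) * B₀ + B₂ * (B₄ * (2 * u * (L:ℝ) ^ (-(a - 1)))) := by
    intro L hL z hz
    refine (Finset.sum_le_sum fun z' hz' => hpt z hz z' (Finset.mem_filter.1 hz').1).trans ?_
    rw [Finset.sum_add_distrib, ← Finset.mul_sum, ← Finset.sum_filter, ← Finset.mul_sum]
    gcongr
    · exact hsum z _ (Finset.filter_subset _ _)
    · refine hgeo _ (fun z' => dist z' z) L (8 * R) (2 * u) (by exact_mod_cast hL) (by linarith) ?_ ?_
      · intro z' hz'
        obtain ⟨hz', h8⟩ := Finset.mem_filter.1 hz'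
        refine ⟨?_, h8⟩
        rw [hdist]
        exact lt_max_of_lt_right (abs_sub_gt_of_floor (Finset.mem_filter.1 hz').2)
      · intro ρ hρ hρ2
        refine le_trans (Nat.cast_le.2 (Finset.card_le_card ?_)) (hcard z hz ρ hρ (by linarith))
        intro z' hz'
        obtain ⟨h1, h2⟩ := Finset.mem_filter.1 hz'
        exact Finset.mem_filter.2
          ⟨(Finset.mem_filter.1 (Finset.mem_filter.1 h1).1).1, h2⟩
  set W : ℝ := u ^ (2 / ((n:ℝ) - 1)) with hW
  have hn1 : (0:ℝ) < (n:ℝ) - 1 := by linarith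
  have hW1 : 1 ≤ W := Real.one_le_rpow hu (by positivity)
  have hWa : W ^ a = u := by
    rw [hW, ← Real.rpow_mul (by linarith), ha]
    have : 2 / ((n:ℝ) - 1) * (((n:ℝ) - 1) / 2) = 1 := by field_simp
    rw [this, Real.rpow_one]
  have hceil : ∀ X : ℝ, 1 ≤ X → 1 ≤ ⌈X⌉₊ ∧ (⌈X⌉₊ : ℝ) ≤ 2 * X := by
    intro X hX
    refine ⟨Nat.one_le_ceil_iff.2 (by linarith), ?_⟩
    have := (Nat.ceil_lt_add_one (by linarith : (0:ℝ) ≤ X)).le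
    linarith
  have hB : 0 < B₁ * B₀ := by positivity
  have hB' : 0 < B₃ * 2 ^ (k + k) * B₀ := by positivity
  have hB'' : 0 < B₂ * B₄ := by positivity
  rcases le_or_gt W R with hWR | hWR
  · obtain ⟨h1, h2⟩ := hceil W hW1
    refine (norm_sum_sq_le_of_slabs S v (fun z => ⌊z.2⌋) ⌈W⌉₊ hC₁ (hC₂ _ h1)).trans ?_
    rw [min_eq_left hWR]
    refine mul_le_mul_of_nonneg_right ?_ (Nat.cast_nonneg _)
    have h3 : u * (⌈W⌉₊ : ℝ) ^ (-(a - 1)) ≤ W := by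
      calc u * (⌈W⌉₊ : ℝ) ^ (-(a - 1)) ≤ u * W ^ (-(a - 1)) := by
            refine mul_le_mul_of_nonneg_left ?_ (by linarith)
            exact Real.rpow_le_rpow_of_nonpos (by linarith) (Nat.le_ceil _) (by linarith)
        _ = W := by
            rw [← hWa, ← Real.rpow_add (by linarith)]
            simp
    have h4 : (2 * (⌈W⌉₊ : ℝ) + 1) * (B₁ * B₀) ≤ 5 * W * (B₁ * B₀) := by gcongr; linarith
    have h5 : B₂ * (B₄ * (2 * u * (⌈W⌉₊ : ℝ) ^ (-(a - 1)))) ≤ 2 * B₂ * B₄ * W := by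
      calc _ = 2 * (B₂ * B₄) * (u * (⌈W⌉₊ : ℝ) ^ (-(a - 1))) := by ring
        _ ≤ 2 * (B₂ * B₄) * W := by gcongr
        _ = _ := by ring
    nlinarith
  · obtain ⟨h1, h2⟩ := hceil R hR
    have hC₂' : ∀ z ∈ S, ∑ z' ∈ S with ((⌈R⌉₊ : ℕ):ℤ) < |⌊z.2⌋ - ⌊z'.2⌋|,
        ‖inner ℂ (v z) (v z')‖ ≤ 0 := by
      intro z hz
      refine (Finset.sum_eq_zero fun z' hz' => ?_).le
      exfalso
      obtain ⟨h3, h4⟩ := Finset.mem_filter.1 hz'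
      have := abs_sub_gt_of_floor h4
      linarith [htt z hz z' h3, Nat.le_ceil R]
    refine (norm_sum_sq_le_of_slabs S v (fun z => ⌊z.2⌋) ⌈R⌉₊ hC₁ hC₂').trans ?_
    rw [min_eq_right hWR.le]
    refine mul_le_mul_of_nonneg_right ?_ (Nat.cast_nonneg _)
    have h4 : (2 * (⌈R⌉₊ : ℝ) + 1) * (B₁ * B₀) ≤ 5 * R * (B₁ * B₀) := by gcongr; linarith
    have h5 : 0 ≤ (B₃ * 2 ^ (k + k) * B₀ + 2 * B₂ * B₄) * R := by positivity
    nlinarith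

/-- The light cones through points of high density are contained in a small set. -/
lemma exists_cover_of_dense (hn : 0 < n) {ε : ℝ} (hε : 0 < ε) (hε1 : ε ≤ 1) :
    ∃ C : ℝ, 0 < C ∧ ∀ R u : ℝ, 1 ≤ R → 1 ≤ u →
    ∀ Z S : Finset (EuclideanSpace ℝ (Fin n) × ℝ),
    (∀ z ∈ S, z.2 ∈ Set.Icc R (2 * R)) →
    (∀ z ∈ S, ∃ ρ, 1 ≤ ρ ∧ ρ ≤ 16 * R ∧ u * ρ ≤ ((Z.filter fun z' => dist z' z ≤ ρ).card : ℝ)) →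
    ∃ A : Set (EuclideanSpace ℝ (Fin n)), MeasurableSet A ∧
      volume A ≤ ENNReal.ofReal (C * (R ^ ((n:ℝ) - 1 + ε) * (Z.card / u))) ∧
      ∀ w ∉ A, ∀ z ∈ S, R ^ ε < abs (‖z.1 - w‖ - z.2) := by
  obtain ⟨C, hC, hvol⟩ := volume_shell_le hn
  refine ⟨C * (9 * 131 ^ (n - 1)), by positivity, fun R u hR hu Z S ht hd => ?_⟩
  classical
  have hex : ∀ z, ∃ ρ : ℝ, z ∈ S → 1 ≤ ρ ∧ ρ ≤ 16 * R ∧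
      u * ρ ≤ ((Z.filter fun z' => dist z' z ≤ ρ).card : ℝ) := by
    intro z
    by_cases hz : z ∈ S
    · obtain ⟨ρ, h⟩ := hd z hz
      exact ⟨ρ, fun _ => h⟩
    · exact ⟨0, fun h => absurd h hz⟩
  choose ρ hρ using hex
  obtain ⟨J', hJS, hdisj, hcov⟩ := Vitali.exists_disjoint_subfamily_covering_enlargement_closedBall
    (S : Set (EuclideanSpace ℝ (Fin n) × ℝ)) id ρ (16 * R) (fun a ha => (hρ a ha).2.1) 4
    (by norm_num)
  have hfin : J'.Finite := S.finite_toSet.subset hJS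
  lift J' to Finset (EuclideanSpace ℝ (Fin n) × ℝ) using hfin with J
  have hR1 : 1 ≤ R ^ ε := Real.one_le_rpow hR hε.le
  have hRR : R ^ ε ≤ R := by simpa using Real.rpow_le_rpow_of_exponent_le hR hε1
  have hsumρ : ∑ z ∈ J, ρ z ≤ Z.card / u := by
    rw [le_div_iff₀ (by linarith), Finset.sum_mul]
    calc ∑ z ∈ J, ρ z * u ≤ ∑ z ∈ J, ((Z.filter fun z' => dist z' z ≤ ρ z).card : ℝ) := by
          refine Finset.sum_le_sum fun z hz => ?_
          rw [mul_comm]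
          exact (hρ z (hJS hz)).2.2
      _ = ((J.biUnion fun z => Z.filter fun z' => dist z' z ≤ ρ z).card : ℝ) := by
          rw [Finset.card_biUnion]
          · push_cast; rfl
          · intro z hz z' hz' hne
            refine Finset.disjoint_left.2 ?_
            intro w hw hw'
            exact Set.disjoint_left.1 (hdisj hz hz' hne) (Finset.mem_filter.1 hw).2
              (Finset.mem_filter.1 hw').2
      _ ≤ Z.card := by
          refine Nat.cast_le.2 (Finset.card_le_card ?_)
          exact Finset.biUnion_subset.2 fun z _ => Finset.filter_subset _ _
  refine ⟨⋃ z ∈ J, {w | abs (‖w - z.1‖ - z.2) ≤ 8 * ρ z + R ^ ε}, ?_, ?_, ?_⟩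
  · refine Finset.measurableSet_biUnion _ fun z _ => ?_
    exact (isClosed_le (by fun_prop) continuous_const).measurableSet
  · have hsh : ∀ z ∈ J, volume {w : EuclideanSpace ℝ (Fin n) | abs (‖w - z.1‖ - z.2) ≤ 8 * ρ z + R ^ ε} ≤
        ENNReal.ofReal (C * (9 * 131 ^ (n - 1)) * (R ^ ((n:ℝ) - 1 + ε)) * ρ z) := by
      intro z hz
      obtain ⟨h1, h2, -⟩ := hρ z (hJS hz)
      obtain ⟨h3, h4⟩ := ht z (hJS hz)
      refine (hvol z.1 z.2 (8 * ρ z + R ^ ε) (by linarith) (by positivity)).trans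
        (ENNReal.ofReal_le_ofReal ?_)
      have h5 : 8 * ρ z + R ^ ε ≤ 9 * ρ z * R ^ ε := by nlinarith
      have h6 : z.2 + (8 * ρ z + R ^ ε) ≤ 131 * R := by linarith
      have h8 : 0 ≤ z.2 + (8 * ρ z + R ^ ε) := by linarith
      have h7 : R ^ ((n:ℝ) - 1 + ε) = R ^ (n - 1) * R ^ ε := by
        rw [Real.rpow_add (by linarith), ← Real.rpow_natCast, Nat.cast_sub hn, Nat.cast_one]
      calc C * ((8 * ρ z + R ^ ε) * (z.2 + (8 * ρ z + R ^ ε)) ^ (n - 1))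
          ≤ C * ((9 * ρ z * R ^ ε) * (131 * R) ^ (n - 1)) := by
            gcongr
        _ = _ := by rw [h7, mul_pow]; ring
    refine (measure_biUnion_finset_le J _).trans ((Finset.sum_le_sum hsh).trans ?_)
    rw [← ENNReal.ofReal_sum_of_nonneg
      (fun z hz => by have := (hρ z (hJS hz)).1; positivity), ← Finset.mul_sum]
    refine ENNReal.ofReal_le_ofReal ?_
    rw [mul_assoc (C * _)]
    gcongr
  · intro w hw z hz
    by_contra! hcon
    obtain ⟨b, hb, hsub⟩ := hcov z hz
    refine hw (Set.mem_biUnion hb ?_)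
    have hzb : dist z b ≤ 4 * ρ b :=
      hsub (mem_closedBall_self (by linarith [(hρ z hz).1]))
    rw [Prod.dist_eq, max_le_iff, dist_eq_norm, Real.dist_eq] at hzb
    have h1 : abs (‖z.1 - w‖ - ‖w - b.1‖) ≤ ‖z.1 - b.1‖ := by
      rw [norm_sub_rev w]
      refine (abs_norm_sub_norm_le _ _).trans_eq ?_
      congr 1; abel
    show abs (‖w - b.1‖ - b.2) ≤ 8 * ρ b + R ^ ε
    rw [abs_le] at h1 hcon ⊢
    have h2 := abs_le.1 hzb.2
    constructor <;> linarith [h1.1, h1.2, h2.1, h2.2, hcon.1, hcon.2, hzb.1]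

lemma exists_lintegral_sum_majorant_rpow_le (n : ℕ) {r : ℝ} (hr : 1 ≤ r) : ∃ C : ℝ, 0 < C ∧
    ∀ S : Finset (EuclideanSpace ℝ (Fin n) × ℝ),
    (∀ z ∈ S, ∀ z' ∈ S, z ≠ z' → 1 ≤ dist z.1 z'.1) →
    ∫⁻ w, ENNReal.ofReal (∑ z ∈ S, (1 + ‖z.1 - w‖) ^ (-((n : ℝ) + 1))) ^ r ≤
      ENNReal.ofReal C * S.card := by
  obtain ⟨C, hC, hsep⟩ := exists_sum_fst_one_add_norm_rpow_le n
  obtain ⟨D, hD, hInt⟩ := exists_lintegral_majorant_le n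
  refine ⟨C ^ (r - 1) * D, by positivity, fun S hS => ?_⟩
  have hpt : ∀ w, ENNReal.ofReal (∑ z ∈ S, (1 + ‖z.1 - w‖) ^ (-((n : ℝ) + 1))) ^ r ≤
      ENNReal.ofReal (C ^ (r - 1)) *
        ∑ z ∈ S, ENNReal.ofReal ((1 + ‖z.1 - w‖) ^ (-((n : ℝ) + 1))) := by
    intro w
    set G := ∑ z ∈ S, (1 + ‖z.1 - w‖) ^ (-((n : ℝ) + 1)) with hG
    have hG0 : 0 ≤ G := Finset.sum_nonneg fun _ _ => by positivity
    have hGC : G ≤ C := by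
      refine le_trans (Finset.sum_le_sum fun z _ => ?_) (hsep S hS w)
      rw [norm_sub_rev]
    rw [← ENNReal.ofReal_sum_of_nonneg (fun _ _ => by positivity), ← hG,
      ← ENNReal.ofReal_mul (by positivity), ENNReal.ofReal_rpow_of_nonneg hG0 (by linarith)]
    refine ENNReal.ofReal_le_ofReal ?_
    rcases hG0.eq_or_lt with h0 | h0
    · rw [← h0, Real.zero_rpow (by linarith), mul_zero]
    · calc G ^ r = G ^ (r - 1) * G := by
            rw [← Real.rpow_add_one h0.ne']; congr 1; ring
        _ ≤ _ := by gcongr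
  refine (lintegral_mono hpt).trans ?_
  rw [lintegral_const_mul' _ _ ENNReal.ofReal_ne_top, lintegral_finsetSum' _ (fun z _ => by fun_prop),
    ENNReal.ofReal_mul (by positivity), mul_assoc]
  gcongr
  calc _ ≤ ∑ z ∈ S, ENNReal.ofReal D := Finset.sum_le_sum fun z _ => by
        simpa using hInt 1 one_pos z.1
    _ = _ := by rw [Finset.sum_const, nsmul_eq_mul, mul_comm]

end

lemma exists_unimodular_mul (c : ℂ) : ∃ γ : ℂ, ‖γ‖ ≤ 1 ∧ γ * c = (‖c‖ : ℂ) := by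
  by_cases h : c = 0
  · exact ⟨0, by simp, by simp [h]⟩
  · refine ⟨(‖c‖ : ℂ) / c, ?_, div_mul_cancel₀ _ h⟩
    rw [norm_div, Complex.norm_real, norm_norm, div_self (norm_ne_zero_iff.2 h)]

lemma min_rpow_mul_rpow_le {d R u β : ℝ} (hd : 1 ≤ d) (hR : 1 ≤ R) (hu : 1 ≤ u) (hβ : 0 ≤ β)
    (hdβ : d * β ≤ 1) :
    (min (u ^ (2 / d)) R) ^ (1 / 2 : ℝ) * u ^ (-β) ≤ R ^ (1 / 2 - d * β / 2) := by
  set W := min (u ^ (2 / d)) R with hW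
  have hW1 : 1 ≤ W := le_min (Real.one_le_rpow hu (by positivity)) hR
  have hWu : W ^ (d / 2) ≤ u := by
    calc W ^ (d / 2) ≤ (u ^ (2 / d)) ^ (d / 2) := by
          gcongr
          exact min_le_left _ _
      _ = u := by
          rw [← Real.rpow_mul (by linarith)]
          have : 2 / d * (d / 2) = 1 := by field_simp
          rw [this, Real.rpow_one]
  calc W ^ (1 / 2 : ℝ) * u ^ (-β) ≤ W ^ (1 / 2 : ℝ) * (W ^ (d / 2)) ^ (-β) := by
        refine mul_le_mul_of_nonneg_left ?_ (by positivity)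
        exact Real.rpow_le_rpow_of_nonpos (by positivity) hWu (by linarith)
    _ = W ^ (1 / 2 - d * β / 2) := by
        rw [← Real.rpow_mul (by linarith), ← Real.rpow_add (by linarith)]
        congr 1; ring
    _ ≤ _ := Real.rpow_le_rpow (by linarith) (min_le_right _ _) (by linarith)

lemma layer_constant_le {d R u β ε C₁ C₂ s N : ℝ} (hd : 1 ≤ d) (hR : 1 ≤ R) (hu : 1 ≤ u)
    (hβ : 0 ≤ β) (hβ1 : β ≤ 1) (hdβ : d * β ≤ 1) (hε : 0 ≤ ε) (hC₁ : 0 ≤ C₁) (hC₂ : 0 ≤ C₂)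
    (hs : 0 ≤ s) (hsN : s ≤ N) :
    (C₁ * min (u ^ (2 / d)) R * s) ^ (1 / 2 : ℝ) * (C₂ * (R ^ (d + ε) * (N / u))) ^ β ≤
      C₁ ^ (1 / 2 : ℝ) * C₂ ^ β * R ^ (1 / 2 + d / 2 * β + ε) * N ^ (1 / 2 + β) := by
  have hW : 0 ≤ min (u ^ (2 / d)) R := le_min (by positivity) (by linarith)
  have hN : 0 ≤ N := hs.trans hsN
  have hR0 : 0 < R := by linarith
  have hu0 : 0 < u := by linarith
  calc (C₁ * min (u ^ (2 / d)) R * s) ^ (1 / 2 : ℝ) * (C₂ * (R ^ (d + ε) * (N / u))) ^ β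
      ≤ (C₁ * min (u ^ (2 / d)) R * N) ^ (1 / 2 : ℝ) * (C₂ * (R ^ (d + ε) * (N / u))) ^ β := by
        gcongr
    _ = C₁ ^ (1 / 2 : ℝ) * C₂ ^ β * (R ^ ((d + ε) * β) *
          ((min (u ^ (2 / d)) R) ^ (1 / 2 : ℝ) * u ^ (-β))) * (N ^ (1 / 2 : ℝ) * N ^ β) := by
        rw [Real.mul_rpow (by positivity) hN, Real.mul_rpow hC₁ hW, Real.mul_rpow hC₂ (by positivity),
          Real.mul_rpow (by positivity) (by positivity), Real.div_rpow hN hu0.le,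
          Real.rpow_neg hu0.le, ← Real.rpow_mul hR0.le]
        ring
    _ ≤ C₁ ^ (1 / 2 : ℝ) * C₂ ^ β * (R ^ ((d + ε) * β) * R ^ (1 / 2 - d * β / 2)) *
          (N ^ (1 / 2 : ℝ) * N ^ β) := by
        gcongr
        exact min_rpow_mul_rpow_le hd hR hu hβ hdβ
    _ ≤ _ := by
        rw [← Real.rpow_add hR0, ← Real.rpow_add_of_nonneg hN (by norm_num) hβ]
        refine mul_le_mul_of_nonneg_right (mul_le_mul_of_nonneg_left
          (Real.rpow_le_rpow_of_exponent_le hR ?_) (by positivity)) (by positivity)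
        nlinarith

section
variable {n : ℕ}

/-- The contribution of the points at which the density is comparable to `u`. -/
lemma sum_waveOp_le_of_density (hn : 4 ≤ n) {q ε : ℝ} (hq : 2 ≤ q)
    (hqn : ((n:ℝ) - 1) * (1 / 2 - 1 / q) ≤ 1) (hε : 0 < ε) (hε1 : ε ≤ 1) {k : ℕ}
    (hk : (n : ℝ) + 1 ≤ ε * k) :
    ∃ C : ℝ, 0 < C ∧ ∀ R u : ℝ, 1 ≤ R → 1 ≤ u →
    ∀ Z S : Finset (EuclideanSpace ℝ (Fin n) × ℝ), S ⊆ Z →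
    (∀ z ∈ Z, ∀ z' ∈ Z, z ≠ z' → 1 ≤ dist z.1 z'.1) →
    (∀ z ∈ Z, z.2 ∈ Set.Icc R (2 * R)) →
    (∀ z ∈ S, ∃ ρ, 1 ≤ ρ ∧ ρ ≤ 16 * R ∧ u * ρ ≤ ((Z.filter fun z' => dist z' z ≤ ρ).card : ℝ)) →
    (∀ z ∈ S, ∀ ρ, 1 ≤ ρ → ρ ≤ 16 * R → ((Z.filter fun z' => dist z' z ≤ ρ).card : ℝ) ≤ 2 * u * ρ) →
    ∀ f : EuclideanSpace ℝ (Fin n) → ℂ, Measurable f → Integrable f →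
      ENNReal.ofReal (∑ z ∈ S, ‖waveOp k (locTime R z.2) f z.1‖) ≤
        ENNReal.ofReal (C * R ^ (1 / 2 + ((n:ℝ) - 1) / 2 * (1 / 2 - 1 / q) + ε)) *
          (Z.card : ℝ≥0∞) ^ (1 - 1 / q) * (∫⁻ w, ‖f w‖ₑ ^ q) ^ (1 / q) := by
  have hn' : (4:ℝ) ≤ n := by exact_mod_cast hn
  have hk2 : n + 1 ≤ k + k := by
    have h1 : ε * k ≤ k := mul_le_of_le_one_left (Nat.cast_nonneg _) hε1
    have h2 : ((n + 1 : ℕ) : ℝ) ≤ k := by push_cast; linarith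
    have h3 : n + 1 ≤ k := by exact_mod_cast h2
    omega
  set β : ℝ := 1 / 2 - 1 / q with hβ
  have hqi : 1 / q ≤ 1 / 2 := one_div_le_one_div_of_le (by norm_num) hq
  have hqi0 : 0 < 1 / q := by positivity
  have hβ0 : 0 ≤ β := by rw [hβ]; linarith
  set r : ℝ := q.conjExponent with hr
  have hc : r.HolderConjugate q := (Real.HolderConjugate.conjExponent (by linarith)).symm
  have hri : 1 / r = 1 - 1 / q := by
    have := hc.inv_add_inv_eq_one
    rw [one_div, one_div]; linarith
  have hr1 : 1 < r := hc.lt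
  have hr2 : r ≤ 2 := by
    rw [← one_div_le_one_div (by norm_num) (by linarith), hri]; linarith
  obtain ⟨C₁, hC₁, hL2⟩ := lintegral_sum_waveKer_sq_le hn hk2
  obtain ⟨C₂, hC₂, hcover⟩ := exists_cover_of_dense (n := n) (by omega) hε hε1
  obtain ⟨C₃, hC₃, hoff⟩ := norm_waveKer_locTime_le (n := n) (by omega) hε hε1 hk
  obtain ⟨C₄, hC₄, hmaj⟩ := exists_lintegral_sum_majorant_rpow_le n hr1.le
  refine ⟨C₁ ^ (1 / 2 : ℝ) * C₂ ^ β + C₃ * C₄ ^ (1 / r), by positivity, ?_⟩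
  intro R u hR hu Z S hSZ hsep ht hlow hup f hfm hf
  have hre : ∀ z ∈ S, 0 < (locTime R z.2).re := fun z hz => by
    linarith [(locTime_re_mem hR (ht z (hSZ hz))).1]
  choose γ hγ hγc using fun z : EuclideanSpace ℝ (Fin n) × ℝ =>
    exists_unimodular_mul (waveOp k (locTime R z.2) f z.1)
  set Φ : EuclideanSpace ℝ (Fin n) → ℂ :=
    fun w => ∑ z ∈ S, γ z * waveKer k (locTime R z.2) (z.1 - w) with hΦ
  have hΦc : Continuous Φ := by
    refine continuous_finsetSum _ fun z hz => continuous_const.mul ?_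
    exact (continuous_waveKer k (hre z hz)).comp (continuous_const.sub continuous_id)
  obtain ⟨A, hAm, hAvol, hA⟩ := hcover R u hR hu Z S (fun z hz => ht z (hSZ hz)) hlow
  set F : ℝ≥0∞ := (∫⁻ w, ‖f w‖ₑ ^ q) ^ (1 / q) with hF
  have hcard : (S.card : ℝ) ≤ Z.card := Nat.cast_le.2 (Finset.card_le_card hSZ)
  have hstart : ENNReal.ofReal (∑ z ∈ S, ‖waveOp k (locTime R z.2) f z.1‖) ≤
      ∫⁻ w, ‖Φ w‖ₑ * ‖f w‖ₑ := by
    have h1 : ((∑ z ∈ S, ‖waveOp k (locTime R z.2) f z.1‖ : ℝ) : ℂ) = ∫ w, Φ w * f w := by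
      push_cast
      simp only [hΦ, Finset.sum_mul, mul_assoc]
      rw [integral_finsetSum _ fun z hz =>
        (integrable_waveKer_mul k (hre z hz) hf z.1).const_mul (γ z)]
      refine Finset.sum_congr rfl fun z _ => ?_
      rw [integral_const_mul, ← hγc z, waveOp]
    have h2 : (∑ z ∈ S, ‖waveOp k (locTime R z.2) f z.1‖) = ‖∫ w, Φ w * f w‖ := by
      rw [← h1, Complex.norm_real, Real.norm_of_nonneg (Finset.sum_nonneg fun _ _ => norm_nonneg _)]
    rw [h2, ofReal_norm]
    refine (enorm_integral_le_lintegral_enorm _).trans_eq ?_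
    simp only [enorm_mul]
  have hFle : ∀ B : Set (EuclideanSpace ℝ (Fin n)), (∫⁻ w in B, ‖f w‖ₑ ^ q) ^ (1 / q) ≤ F :=
    fun B => ENNReal.rpow_le_rpow (setLIntegral_le_lintegral _ _) (by positivity)
  have hon : ∫⁻ w in A, ‖Φ w‖ₑ * ‖f w‖ₑ ≤
      ENNReal.ofReal (C₁ ^ (1 / 2 : ℝ) * C₂ ^ β *
        R ^ (1 / 2 + ((n:ℝ) - 1) / 2 * β + ε)) * (Z.card : ℝ≥0∞) ^ (1 - 1 / q) * F := by
    refine (ENNReal.lintegral_mul_le_Lp_mul_Lq (volume.restrict A) hc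
      hΦc.enorm.measurable.aemeasurable hfm.enorm.aemeasurable).trans ?_
    refine mul_le_mul' ?_ (hFle A)
    have h1 := eLpNorm'_le_eLpNorm'_mul_rpow_measure_univ (μ := volume.restrict A) (by linarith : 0 < r)
      hr2 hΦc.aestronglyMeasurable
    simp only [eLpNorm'_eq_lintegral_enorm, Measure.restrict_apply_univ] at h1
    refine h1.trans ?_
    have h2 : 1 / r - 1 / 2 = β := by rw [hri, hβ]; ring
    rw [h2]
    have h3 : (∫⁻ w in A, ‖Φ w‖ₑ ^ (2:ℝ)) ^ (1 / 2 : ℝ) ≤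
        ENNReal.ofReal ((C₁ * min (u ^ (2 / ((n : ℝ) - 1))) R * S.card) ^ (1 / 2 : ℝ)) := by
      have hp : 0 ≤ min (u ^ (2 / ((n : ℝ) - 1))) R := le_min (by positivity) (by linarith)
      rw [← ENNReal.ofReal_rpow_of_nonneg (by positivity) (by norm_num)]
      refine ENNReal.rpow_le_rpow ((setLIntegral_le_lintegral _ _).trans ?_) (by norm_num)
      refine hL2 R u hR hu S (fun z hz z' hz' => hsep z (hSZ hz) z' (hSZ hz'))
        (fun z hz => ht z (hSZ hz)) (fun z hz ρ hρ hρ' => ?_) γ hγ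
      refine le_trans (Nat.cast_le.2 (Finset.card_le_card ?_)) (hup z hz ρ hρ hρ')
      exact Finset.filter_subset_filter _ hSZ
    have h4 : volume A ^ β ≤
        ENNReal.ofReal ((C₂ * (R ^ ((n:ℝ) - 1 + ε) * (Z.card / u))) ^ β) := by
      rw [← ENNReal.ofReal_rpow_of_nonneg (by positivity) hβ0]
      exact ENNReal.rpow_le_rpow hAvol hβ0
    refine (mul_le_mul' h3 h4).trans ?_
    have h5 : (Z.card : ℝ≥0∞) ^ (1 - 1 / q) = ENNReal.ofReal ((Z.card : ℝ) ^ (1 / 2 + β)) := by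
      rw [← ENNReal.ofReal_rpow_of_nonneg (Nat.cast_nonneg _) (by linarith), ENNReal.ofReal_natCast]
      congr 1; rw [hβ]; ring
    rw [h5, ← ENNReal.ofReal_mul (by positivity), ← ENNReal.ofReal_mul (by positivity)]
    refine ENNReal.ofReal_le_ofReal ?_
    exact layer_constant_le (by linarith) hR hu hβ0 (by rw [hβ]; linarith) hqn hε.le hC₁.le hC₂.le
      (Nat.cast_nonneg _) hcard
  have hoffA : ∫⁻ w in Aᶜ, ‖Φ w‖ₑ * ‖f w‖ₑ ≤
      ENNReal.ofReal (C₃ * C₄ ^ (1 / r)) * (Z.card : ℝ≥0∞) ^ (1 - 1 / q) * F := by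
    set G : EuclideanSpace ℝ (Fin n) → ℝ :=
      fun w => ∑ z ∈ S, (1 + ‖z.1 - w‖) ^ (-((n : ℝ) + 1)) with hG
    have hpt : ∀ w ∈ Aᶜ, ‖Φ w‖ₑ * ‖f w‖ₑ ≤
        ENNReal.ofReal C₃ * ((fun w => ENNReal.ofReal (G w)) * fun w => ‖f w‖ₑ) w := by
      intro w hw
      rw [Pi.mul_apply, ← mul_assoc, ← ENNReal.ofReal_mul hC₃.le]
      refine mul_le_mul' ?_ le_rfl
      rw [← ofReal_norm]
      refine ENNReal.ofReal_le_ofReal ((norm_sum_le _ _).trans ?_)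
      rw [hG, Finset.mul_sum]
      refine Finset.sum_le_sum fun z hz => ?_
      rw [norm_mul]
      refine (mul_le_of_le_one_left (norm_nonneg _) (hγ z)).trans ?_
      exact hoff R hR z.2 (ht z (hSZ hz)) _ (hA w hw z hz)
    have hGm : Measurable fun w => ENNReal.ofReal (G w) := by
      refine ENNReal.measurable_ofReal.comp ?_
      exact Finset.measurable_fun_sum _ fun z _ => by fun_prop
    refine (setLIntegral_mono' hAm.compl hpt).trans ?_
    refine (setLIntegral_le_lintegral _ _).trans ?_
    rw [lintegral_const_mul' _ _ ENNReal.ofReal_ne_top]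
    refine (mul_le_mul' le_rfl (ENNReal.lintegral_mul_le_Lp_mul_Lq volume hc hGm.aemeasurable
      hfm.enorm.aemeasurable)).trans ?_
    rw [← mul_assoc]
    refine mul_le_mul' ?_ le_rfl
    rw [ENNReal.ofReal_mul hC₃.le, mul_assoc]
    refine mul_le_mul' le_rfl ?_
    calc (∫⁻ w, ENNReal.ofReal (G w) ^ r) ^ (1 / r)
        ≤ (ENNReal.ofReal C₄ * S.card) ^ (1 / r) :=
          ENNReal.rpow_le_rpow (hmaj S fun z hz z' hz' => hsep z (hSZ hz) z' (hSZ hz')) (by positivity)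
      _ ≤ (ENNReal.ofReal C₄ * Z.card) ^ (1 / r) := by
          gcongr
      _ = _ := by
          rw [ENNReal.mul_rpow_of_nonneg _ _ (by positivity),
            ENNReal.ofReal_rpow_of_nonneg hC₄.le (by positivity), hri]
  have hone : 1 ≤ R ^ (1 / 2 + ((n:ℝ) - 1) / 2 * β + ε) :=
    Real.one_le_rpow hR (by have := mul_nonneg (by linarith : 0 ≤ ((n:ℝ) - 1) / 2) hβ0; linarith)
  rw [← lintegral_add_compl _ hAm] at hstart
  refine hstart.trans ((add_le_add hon hoffA).trans ?_)
  rw [← add_mul, ← add_mul, ← ENNReal.ofReal_add (by positivity) (by positivity)]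
  refine mul_le_mul' (mul_le_mul' (ENNReal.ofReal_le_ofReal ?_) le_rfl) le_rfl
  rw [add_mul]
  have : 0 < C₃ * C₄ ^ (1 / r) := by positivity
  nlinarith

end

lemma exists_exponent_bound {D m ε : ℝ} (hD : 1 ≤ D) (hm : 0 < m) (hε : 0 < ε) :
    ∃ C : ℝ, 0 < C ∧ ∀ R : ℝ, 1 ≤ R → ∀ i : ℕ, (2:ℝ) ^ i ≤ D * R ^ m → (i : ℝ) ≤ C * R ^ ε := by
  set a : ℝ := Real.log 2 * (ε / m) with ha
  have ha0 : 0 < a := mul_pos (Real.log_pos (by norm_num)) (by positivity)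
  refine ⟨a⁻¹ * D ^ (ε / m), by positivity, fun R hR i hi => ?_⟩
  have hR0 : 0 < R := by linarith
  have h1 : a * i ≤ ((2:ℝ) ^ i) ^ (ε / m) := by
    rw [← Real.rpow_natCast, ← Real.rpow_mul (by norm_num), Real.rpow_def_of_pos (by norm_num)]
    have := Real.add_one_le_exp (Real.log 2 * (i * (ε / m)))
    have h2 : Real.log 2 * (i * (ε / m)) = a * i := by rw [ha]; ring
    linarith
  have h2 : ((2:ℝ) ^ i) ^ (ε / m) ≤ D ^ (ε / m) * R ^ ε := by
    calc ((2:ℝ) ^ i) ^ (ε / m) ≤ (D * R ^ m) ^ (ε / m) := by gcongr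
      _ = _ := by
        rw [Real.mul_rpow (by linarith) (by positivity), ← Real.rpow_mul hR0.le]
        congr 2; field_simp
  rw [mul_assoc, ← div_eq_inv_mul, le_div_iff₀ ha0]
  linarith

section
variable {n : ℕ}

lemma exists_card_closedBall_le (n : ℕ) : ∃ C : ℝ, 1 ≤ C ∧
    ∀ Z : Finset (EuclideanSpace ℝ (Fin n) × ℝ),
    (∀ z ∈ Z, ∀ z' ∈ Z, z ≠ z' → 1 ≤ dist z.1 z'.1) → ∀ R ρ : ℝ, 1 ≤ R → 1 ≤ ρ → ρ ≤ 16 * R →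
    ∀ z, ((Z.filter fun z' => dist z' z ≤ ρ).card : ℝ) ≤ C * R ^ ((n:ℝ) + 1) := by
  obtain ⟨C, hC, h⟩ := exists_sum_fst_one_add_norm_rpow_le n
  refine ⟨max 1 (C * 17 ^ ((n:ℝ) + 1)), le_max_left _ _, fun Z hZ R ρ hR hρ hρR z => ?_⟩
  refine le_trans ?_ (mul_le_mul_of_nonneg_right (le_max_right _ _) (by positivity))
  have h1 : ((Z.filter fun z' => dist z' z ≤ ρ).card : ℝ) * (17 * R) ^ (-((n:ℝ) + 1)) ≤ C := by
    calc ((Z.filter fun z' => dist z' z ≤ ρ).card : ℝ) * (17 * R) ^ (-((n:ℝ) + 1))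
        = ∑ z' ∈ Z.filter fun z' => dist z' z ≤ ρ, (17 * R) ^ (-((n:ℝ) + 1)) := by
          rw [Finset.sum_const, nsmul_eq_mul]
      _ ≤ ∑ z' ∈ Z.filter fun z' => dist z' z ≤ ρ, (1 + ‖z.1 - z'.1‖) ^ (-((n : ℝ) + 1)) := by
          refine Finset.sum_le_sum fun z' hz' => ?_
          refine Real.rpow_le_rpow_of_nonpos (by positivity) ?_
            (by linarith [(Nat.cast_nonneg n : (0:ℝ) ≤ n)])
          have h2 := (Finset.mem_filter.1 hz').2
          rw [Prod.dist_eq, max_le_iff, dist_comm, dist_eq_norm] at h2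
          linarith [h2.1]
      _ ≤ ∑ z' ∈ Z, (1 + ‖z.1 - z'.1‖) ^ (-((n : ℝ) + 1)) :=
          Finset.sum_le_sum_of_subset_of_nonneg (Finset.filter_subset _ _)
            fun _ _ _ => by positivity
      _ ≤ C := h Z hZ z.1
  rw [Real.rpow_neg (by positivity), ← div_eq_mul_inv, div_le_iff₀ (by positivity),
    Real.mul_rpow (by norm_num) (by linarith)] at h1
  linarith

lemma sum_waveOp_le (hn : 4 ≤ n) {q ε : ℝ} (hq : 2 ≤ q)
    (hqn : ((n:ℝ) - 1) * (1 / 2 - 1 / q) ≤ 1) (hε : 0 < ε) (hε1 : ε ≤ 1) {k : ℕ}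
    (hk : (n : ℝ) + 1 ≤ ε * k) :
    ∃ C : ℝ, 0 < C ∧ ∀ R : ℝ, 1 ≤ R → ∀ Z : Finset (EuclideanSpace ℝ (Fin n) × ℝ),
    (∀ z ∈ Z, ∀ z' ∈ Z, z ≠ z' → 1 ≤ dist z.1 z'.1) →
    (∀ z ∈ Z, z.2 ∈ Set.Icc R (2 * R)) →
    ∀ f : EuclideanSpace ℝ (Fin n) → ℂ, Measurable f → Integrable f →
      ENNReal.ofReal (∑ z ∈ Z, ‖waveOp k (locTime R z.2) f z.1‖) ≤
        ENNReal.ofReal (C * R ^ (1 / 2 + ((n:ℝ) - 1) / 2 * (1 / 2 - 1 / q) + 2 * ε)) *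
          (Z.card : ℝ≥0∞) ^ (1 - 1 / q) * (∫⁻ w, ‖f w‖ₑ ^ q) ^ (1 / q) := by
  classical
  obtain ⟨C, hC, hlayer⟩ := sum_waveOp_le_of_density hn hq hqn hε hε1 hk
  obtain ⟨D, hD, hball⟩ := exists_card_closedBall_le n
  obtain ⟨B, hB, hexp⟩ := exists_exponent_bound hD (by positivity : 0 < (n:ℝ) + 1) hε
  refine ⟨(B + 1) * C, by positivity, fun R hR Z hsep ht f hfm hf => ?_⟩
  have hRε : 1 ≤ R ^ ε := Real.one_le_rpow hR hε.le
  set P : ℕ → EuclideanSpace ℝ (Fin n) × ℝ → Prop := fun i z =>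
    ∃ ρ, 1 ≤ ρ ∧ ρ ≤ 16 * R ∧ (2:ℝ) ^ i * ρ ≤ ((Z.filter fun z' => dist z' z ≤ ρ).card : ℝ) with hP
  have hPle : ∀ i z, P i z → (i:ℝ) ≤ B * R ^ ε := by
    rintro i z ⟨ρ, h1, h2, h3⟩
    refine hexp R hR i (le_trans ?_ (hball Z hsep R ρ hR h1 h2 z))
    exact (le_mul_of_one_le_right (by positivity) h1).trans h3
  set M := ⌊B * R ^ ε⌋₊ with hM
  set j : EuclideanSpace ℝ (Fin n) × ℝ → ℕ := fun z => Nat.findGreatest (fun i => P i z) M with hj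
  have hmaps : ∀ z ∈ Z, j z ∈ Finset.range (M + 1) := fun z _ =>
    Finset.mem_range.2 (Nat.lt_succ_of_le (Nat.findGreatest_le _))
  have hP0 : ∀ z ∈ Z, P 0 z := by
    intro z hz
    refine ⟨1, le_rfl, by linarith, ?_⟩
    simp only [pow_zero, mul_one, Nat.one_le_cast]
    exact Finset.one_le_card.2 ⟨z, Finset.mem_filter.2 ⟨hz, by simp⟩⟩
  have hPj : ∀ z ∈ Z, P (j z) z := fun z hz =>
    Nat.findGreatest_spec (P := fun i => P i z) (Nat.zero_le M) (hP0 z hz)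
  have hPj' : ∀ z, ¬ P (j z + 1) z := by
    intro z h
    have h1 : j z + 1 ≤ M := Nat.le_floor (by exact_mod_cast hPle _ _ h)
    exact absurd (Nat.le_findGreatest (P := fun i => P i z) h1 h) (by simp [hj])
  rw [← Finset.sum_fiberwise_of_maps_to hmaps,
    ENNReal.ofReal_sum_of_nonneg fun _ _ => Finset.sum_nonneg fun _ _ => norm_nonneg _]
  set X : ℝ≥0∞ := ENNReal.ofReal (C * R ^ (1 / 2 + ((n:ℝ) - 1) / 2 * (1 / 2 - 1 / q) + ε)) *
          (Z.card : ℝ≥0∞) ^ (1 - 1 / q) * (∫⁻ w, ‖f w‖ₑ ^ q) ^ (1 / q) with hX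
  have hstep : ∀ i ∈ Finset.range (M + 1), ENNReal.ofReal (∑ z ∈ Z with j z = i,
      ‖waveOp k (locTime R z.2) f z.1‖) ≤ X := by
    intro i _
    refine hlayer R (2 ^ i) hR (one_le_pow₀ (by norm_num)) Z _ (Finset.filter_subset _ _) hsep ht
      (fun z hz => ?_) (fun z hz ρ h1 h2 => ?_) f hfm hf
    · obtain ⟨hzZ, rfl⟩ := Finset.mem_filter.1 hz
      exact hPj z hzZ
    · obtain ⟨-, rfl⟩ := Finset.mem_filter.1 hz
      by_contra! hcon
      refine hPj' z ⟨ρ, h1, h2, le_of_eq_of_le ?_ hcon.le⟩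
      rw [pow_succ]; ring
  refine (Finset.sum_le_sum hstep).trans ?_
  rw [Finset.sum_const, Finset.card_range, nsmul_eq_mul, hX, ← mul_assoc, ← mul_assoc]
  refine mul_le_mul' (mul_le_mul' ?_ le_rfl) le_rfl
  rw [← ENNReal.ofReal_natCast, ← ENNReal.ofReal_mul (Nat.cast_nonneg _)]
  refine ENNReal.ofReal_le_ofReal ?_
  have hMle : ((M + 1 : ℕ) : ℝ) ≤ (B + 1) * R ^ ε := by
    push_cast
    have := Nat.floor_le (by positivity : 0 ≤ B * R ^ ε)
    linarith
  calc _ ≤ (B + 1) * R ^ ε * (C * R ^ (1 / 2 + ((n:ℝ) - 1) / 2 * (1 / 2 - 1 / q) + ε)) := by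
        gcongr
    _ = (B + 1) * C * (R ^ (1 / 2 + ((n:ℝ) - 1) / 2 * (1 / 2 - 1 / q) + ε) * R ^ ε) := by ring
    _ = _ := by
        rw [← Real.rpow_add (by linarith)]
        congr 2; ring

lemma volume_le_of_card_separated_le (U : Set (EuclideanSpace ℝ (Fin n))) (M : ℝ)
    (h : ∀ Y : Finset (EuclideanSpace ℝ (Fin n)), (Y : Set (EuclideanSpace ℝ (Fin n))) ⊆ U →
      (∀ y ∈ Y, ∀ y' ∈ Y, y ≠ y' → 1 ≤ dist y y') → (Y.card : ℝ) ≤ M) :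
    volume U ≤ ENNReal.ofReal M * volume (ball (0 : EuclideanSpace ℝ (Fin n)) 1) := by
  classical
  set T : Set ℕ := {N | ∃ Y : Finset (EuclideanSpace ℝ (Fin n)),
    (Y : Set (EuclideanSpace ℝ (Fin n))) ⊆ U ∧
      (∀ y ∈ Y, ∀ y' ∈ Y, y ≠ y' → 1 ≤ dist y y') ∧ Y.card = N} with hT
  have hT0 : T.Nonempty := ⟨0, ∅, by simp⟩
  have hTb : BddAbove T := by
    refine ⟨⌊M⌋₊, ?_⟩
    rintro N ⟨Y, h1, h2, rfl⟩
    exact Nat.le_floor (h Y h1 h2)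
  obtain ⟨Y, h1, h2, h3⟩ := Nat.sSup_mem hT0 hTb
  have hcov : U ⊆ ⋃ y ∈ Y, ball y 1 := by
    intro x hx
    by_contra hcon
    simp only [Set.mem_iUnion, mem_ball, not_exists, not_lt] at hcon
    have hxY : x ∉ Y := fun hxY => by
      have := hcon x hxY
      rw [dist_self] at this
      linarith
    have hmem : Y.card + 1 ∈ T := by
      refine ⟨insert x Y, ?_, ?_, Finset.card_insert_of_notMem hxY⟩
      · rw [Finset.coe_insert]
        exact Set.insert_subset hx h1
      · intro y hy y' hy' hne
        rcases Finset.mem_insert.1 hy with h3 | h3 <;> rcases Finset.mem_insert.1 hy' with h4 | h4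
        · exact absurd (h3.trans h4.symm) hne
        · exact h3 ▸ hcon y' h4
        · rw [dist_comm]
          exact h4 ▸ hcon y h3
        · exact h2 y h3 y' h4 hne
    have := le_csSup hTb hmem
    omega
  calc volume U ≤ ∑ y ∈ Y, volume (ball y 1) :=
        (measure_mono hcov).trans (measure_biUnion_finset_le _ _)
    _ = Y.card * volume (ball (0 : EuclideanSpace ℝ (Fin n)) 1) := by
        simp only [Measure.addHaar_ball_center, Finset.sum_const, nsmul_eq_mul]
    _ ≤ _ := by
        refine mul_le_mul' ?_ le_rfl
        rw [← ENNReal.ofReal_natCast]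
        exact ENNReal.ofReal_le_ofReal (h Y h1 h2)

/-- The weak type estimate for the maximal function over a single dyadic range of times. -/
lemma volume_locTime_gt_le (hn : 4 ≤ n) {q ε : ℝ} (hq : 2 ≤ q)
    (hqn : ((n:ℝ) - 1) * (1 / 2 - 1 / q) ≤ 1) (hε : 0 < ε) (hε1 : ε ≤ 1) {k : ℕ}
    (hk : (n : ℝ) + 1 ≤ ε * k) :
    ∃ C : ℝ, 0 < C ∧ ∀ R : ℝ, 1 ≤ R →
    ∀ f : EuclideanSpace ℝ (Fin n) → ℂ, Measurable f → Integrable f → ∀ s : ℝ, 0 < s →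
      volume {x | ∃ t ∈ Set.Icc R (2 * R), s < ‖waveOp k (locTime R t) f x‖} ≤
        ENNReal.ofReal ((s / (C * R ^ (1 / 2 + ((n:ℝ) - 1) / 2 * (1 / 2 - 1 / q) + 2 * ε))) ^ (-q)) *
          ∫⁻ w, ‖f w‖ₑ ^ q := by
  classical
  obtain ⟨C, hC, hsum⟩ := sum_waveOp_le hn hq hqn hε hε1 hk
  obtain ⟨v, hv, hV⟩ : ∃ v : ℝ, 0 < v ∧
      volume (ball (0 : EuclideanSpace ℝ (Fin n)) 1) = ENNReal.ofReal v :=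
    ⟨_, ENNReal.toReal_pos (measure_ball_pos _ _ one_pos).ne' measure_ball_lt_top.ne,
      (ENNReal.ofReal_toReal measure_ball_lt_top.ne).symm⟩
  have hq0 : 0 < q := by linarith
  refine ⟨C * v ^ (1 / q), by positivity, fun R hR f hfm hf s hs => ?_⟩
  have hR0 : 0 < R := by linarith
  set e := 1 / 2 + ((n:ℝ) - 1) / 2 * (1 / 2 - 1 / q) + 2 * ε with he
  set I := ∫⁻ w, ‖f w‖ₑ ^ q with hI
  have hconst : 0 < (s / (C * v ^ (1 / q) * R ^ e)) ^ (-q) := by positivity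
  rcases eq_or_ne I ∞ with hI' | hI'
  · rw [hI', ENNReal.mul_top (by simpa using hconst)]
    exact le_top
  obtain ⟨a, ha, hIa⟩ : ∃ a : ℝ, 0 ≤ a ∧ I = ENNReal.ofReal a :=
    ⟨_, ENNReal.toReal_nonneg, (ENNReal.ofReal_toReal hI').symm⟩
  refine (volume_le_of_card_separated_le _ ((C * R ^ e / s) ^ q * a) fun Y hYU hY => ?_).trans_eq ?_
  · rcases Nat.eq_zero_or_pos Y.card with h0 | h0
    · rw [h0, Nat.cast_zero]; positivity
    have hN : (0:ℝ) < Y.card := by exact_mod_cast h0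
    have hex : ∀ y, ∃ t : ℝ, y ∈ Y → t ∈ Set.Icc R (2 * R) ∧ s < ‖waveOp k (locTime R t) f y‖ := by
      intro y
      by_cases hy : y ∈ Y
      · obtain ⟨t, h⟩ := hYU hy
        exact ⟨t, fun _ => h⟩
      · exact ⟨0, fun h => absurd h hy⟩
    choose t ht using hex
    have hinj : Set.InjOn (fun y => (y, t y)) (Y : Set (EuclideanSpace ℝ (Fin n))) :=
      fun y _ y' _ h => (Prod.ext_iff.1 h).1
    have h1 := hsum R hR (Y.image fun y => (y, t y)) (by
      intro z hz z' hz' hne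
      obtain ⟨y, hy, rfl⟩ := Finset.mem_image.1 hz
      obtain ⟨y', hy', rfl⟩ := Finset.mem_image.1 hz'
      exact hY y hy y' hy' fun h => hne (by rw [h])) (by
      intro z hz
      obtain ⟨y, hy, rfl⟩ := Finset.mem_image.1 hz
      exact (ht y hy).1) f hfm hf
    rw [Finset.sum_image hinj, Finset.card_image_of_injOn hinj] at h1
    have h2 : s * Y.card ≤ ∑ y ∈ Y, ‖waveOp k (locTime R (t y)) f y‖ := by
      rw [mul_comm, ← nsmul_eq_mul]
      exact Finset.card_nsmul_le_sum _ _ _ fun y hy => (ht y hy).2.le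
    have hqi : 0 ≤ 1 - 1 / q := by
      have : 1 / q ≤ 1 / 1 := one_div_le_one_div_of_le one_pos (by linarith)
      linarith
    have h3 := (ENNReal.ofReal_le_ofReal h2).trans h1
    rw [← hI, hIa, ← ENNReal.ofReal_natCast, ENNReal.ofReal_rpow_of_nonneg hN.le hqi,
      ENNReal.ofReal_rpow_of_nonneg ha (by positivity), ← ENNReal.ofReal_mul (by positivity),
      ← ENNReal.ofReal_mul (by positivity), ENNReal.ofReal_le_ofReal_iff (by positivity)] at h3
    have h4 : (Y.card : ℝ) ^ (1 / q) ≤ C * R ^ e / s * a ^ (1 / q) := by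
      have h5 : (Y.card : ℝ) = (Y.card : ℝ) ^ (1 - 1 / q) * (Y.card : ℝ) ^ (1 / q) := by
        rw [← Real.rpow_add hN, sub_add_cancel, Real.rpow_one]
      have h6 : 0 < (Y.card : ℝ) ^ (1 - 1 / q) := Real.rpow_pos_of_pos hN _
      rw [div_mul_eq_mul_div, le_div_iff₀ hs]
      refine le_of_mul_le_mul_left ?_ h6
      calc (Y.card : ℝ) ^ (1 - 1 / q) * ((Y.card : ℝ) ^ (1 / q) * s) = s * Y.card := by
            nth_rewrite 3 [h5]; ring
        _ ≤ _ := h3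
        _ = _ := by ring
    calc (Y.card : ℝ) = ((Y.card : ℝ) ^ (1 / q)) ^ q := by
          rw [← Real.rpow_mul hN.le, one_div, inv_mul_cancel₀ hq0.ne', Real.rpow_one]
      _ ≤ (C * R ^ e / s * a ^ (1 / q)) ^ q := by gcongr
      _ = _ := by
          rw [Real.mul_rpow (by positivity) (by positivity), ← Real.rpow_mul ha, one_div,
            inv_mul_cancel₀ hq0.ne', Real.rpow_one]
  · rw [hV, hIa, ← ENNReal.ofReal_mul (by positivity), ← ENNReal.ofReal_mul (by positivity)]
    congr 1
    have : (s / (C * v ^ (1 / q) * R ^ e)) ^ (-q) = (C * R ^ e / s) ^ q * v := by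
      rw [Real.rpow_neg (by positivity), ← Real.inv_rpow (by positivity), inv_div]
      have h7 : C * v ^ (1 / q) * R ^ e / s = C * R ^ e / s * v ^ (1 / q) := by ring
      rw [h7, Real.mul_rpow (by positivity) (by positivity), ← Real.rpow_mul hv.le, one_div,
        inv_mul_cancel₀ hq0.ne', Real.rpow_one]
    rw [this]; ring

/-- The maximal function `sup_{a > 0} |(2π a|D|)^k e^{-2π a (1 - iR) |D|} f|`, up to sign. -/
noncomputable def waveMax (k : ℕ) (R : ℝ) (f : EuclideanSpace ℝ (Fin n) → ℂ)
    (x : EuclideanSpace ℝ (Fin n)) : ℝ≥0∞ :=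
  ⨆ (a : ℝ) (_ : 0 < a), ‖((a ^ k : ℝ) : ℂ) * waveOp k ((a : ℂ) * (1 - (R : ℂ) * Complex.I)) f x‖ₑ

lemma mul_one_sub_mul_I_re (a R : ℝ) : ((a : ℂ) * (1 - (R : ℂ) * Complex.I)).re = a := by
  simp

lemma measurable_waveMax (k : ℕ) (R : ℝ) {f : EuclideanSpace ℝ (Fin n) → ℂ} (hf : Integrable f) :
    Measurable (waveMax k R f) := by
  have : LowerSemicontinuous (waveMax k R f) := by
    unfold waveMax
    refine lowerSemicontinuous_biSup fun a ha => Continuous.lowerSemicontinuous ?_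
    have := continuous_waveOp (n := n) k (z := (a : ℂ) * (1 - (R : ℂ) * Complex.I))
      (by rwa [mul_one_sub_mul_I_re]) hf
    fun_prop
  exact this.measurable

lemma waveMax_add_le (k : ℕ) (R : ℝ) {f g : EuclideanSpace ℝ (Fin n) → ℂ} (hf : Integrable f)
    (hg : Integrable g) (x : EuclideanSpace ℝ (Fin n)) :
    waveMax k R (f + g) x ≤ waveMax k R f x + waveMax k R g x := by
  refine iSup₂_le fun a ha => ?_
  rw [waveOp_add k (by rwa [mul_one_sub_mul_I_re]) hf hg, mul_add]
  refine (enorm_add_le _ _).trans (add_le_add ?_ ?_)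
  · exact le_iSup₂ (f := fun (a : ℝ) (_ : 0 < a) =>
      ‖((a ^ k : ℝ) : ℂ) * waveOp k ((a : ℂ) * (1 - (R : ℂ) * Complex.I)) f x‖ₑ) a ha
  · exact le_iSup₂ (f := fun (a : ℝ) (_ : 0 < a) =>
      ‖((a ^ k : ℝ) : ℂ) * waveOp k ((a : ℂ) * (1 - (R : ℂ) * Complex.I)) g x‖ₑ) a ha

lemma waveOp_const_mul (k : ℕ) (z c : ℂ) (f : EuclideanSpace ℝ (Fin n) → ℂ)
    (x : EuclideanSpace ℝ (Fin n)) :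
    waveOp k z (fun y => c * f y) x = c * waveOp k z f x := by
  simp only [waveOp]
  rw [← integral_const_mul]
  exact integral_congr_ae (.of_forall fun y => by ring)

lemma waveOp_eq_lpOp (k : ℕ) {R a b : ℝ} (hR : 1 ≤ R) (hb : 0 < b) (hab : b ≤ a) (hab' : a ≤ 2 * b)
    {f : EuclideanSpace ℝ (Fin n) → ℂ} (hf : Integrable f) (y : EuclideanSpace ℝ (Fin n)) :
    ((a ^ (k + 1) : ℝ) : ℂ) * waveOp (k + 1) ((a : ℂ) * (1 - (R : ℂ) * Complex.I)) f (b • y) =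
      (((a / b) ^ (k + 1) : ℝ) : ℂ) *
        waveOp k (locTime R (a * R / b)) (fun w => lpOp b f (b • w)) y := by
  have hR0 : 0 < R := by linarith
  have hτ : a * R / b ∈ Set.Icc R (2 * R) := by
    constructor
    · rw [le_div_iff₀ hb]; nlinarith
    · rw [div_le_iff₀ hb]; nlinarith
  have hre := (locTime_re_mem hR hτ).1
  have hbc : (b : ℂ) ≠ 0 := by exact_mod_cast hb.ne'
  have hRc : (R : ℂ) ≠ 0 := by exact_mod_cast hR0.ne'
  have hz : (a : ℂ) * (1 - (R : ℂ) * Complex.I) =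
      (b : ℂ) * locTime R (a * R / b) + ((b / 2 : ℝ) : ℂ) := by
    simp only [locTime]
    push_cast
    field_simp
    ring
  have h := waveOp_smul k (locTime R (a * R / b)) hb (lpOp b f) y
  have h2 : waveOp k ((b : ℂ) * locTime R (a * R / b)) (lpOp b f) (b • y) =
      b * waveOp (k + 1) ((a : ℂ) * (1 - (R : ℂ) * Complex.I)) f (b • y) := by
    rw [hz, ← waveOp_waveOp k 1 (by simp; positivity) (by simpa using hb) hf]
    exact waveOp_const_mul _ _ _ _ _
  have h3 : waveOp k (locTime R (a * R / b)) (fun w => lpOp b f (b • w)) y =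
      ((b ^ (k + 1) : ℝ) : ℂ) * waveOp (k + 1) ((a : ℂ) * (1 - (R : ℂ) * Complex.I)) f (b • y) := by
    rw [h2] at h
    push_cast at h ⊢
    rw [pow_succ, mul_assoc, h, mul_inv_cancel_left₀ (pow_ne_zero _ hbc)]
  rw [h3, ← mul_assoc, ← Complex.ofReal_mul, ← mul_pow, div_mul_cancel₀ _ hb.ne']

open scoped Pointwise in
lemma waveMax_gt_subset (k : ℕ) {R : ℝ} (hR : 1 ≤ R) {f : EuclideanSpace ℝ (Fin n) → ℂ}
    (hf : Integrable f) (s : ℝ) :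
    {x | ENNReal.ofReal s < waveMax (k + 1) R f x} ⊆ ⋃ κ : ℤ, ((2 : ℝ) ^ κ) •
      {y | ∃ τ ∈ Set.Icc R (2 * R), s / 2 ^ (k + 1) <
        ‖waveOp k (locTime R τ) (fun w => lpOp ((2 : ℝ) ^ κ) f (((2 : ℝ) ^ κ) • w)) y‖} := by
  intro x hx
  simp only [Set.mem_ofPred_eq, waveMax, lt_iSup_iff] at hx
  obtain ⟨a, ha, hx⟩ := hx
  obtain ⟨κ, hκ, hκ'⟩ := exists_mem_Ico_zpow ha (one_lt_two (α := ℝ))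
  have hb : (0 : ℝ) < 2 ^ κ := by positivity
  rw [zpow_add_one₀ two_ne_zero] at hκ'
  refine Set.mem_iUnion.2 ⟨κ, Set.mem_smul_set_iff_inv_smul_mem₀ hb.ne' _ _ |>.2 ?_⟩
  refine ⟨a * R / 2 ^ κ, ⟨?_, ?_⟩, ?_⟩
  · rw [le_div_iff₀ hb]; nlinarith
  · rw [div_le_iff₀ hb]; nlinarith
  · have h := waveOp_eq_lpOp k hR hb hκ (by linarith) hf (((2 : ℝ) ^ κ)⁻¹ • x)
    rw [smul_inv_smul₀ hb.ne'] at h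
    rw [h, ← ofReal_norm, norm_mul, Complex.norm_real, Real.norm_of_nonneg (by positivity)] at hx
    have hx' := (ENNReal.ofReal_lt_ofReal_iff'.1 hx).1
    have hq : (a / 2 ^ κ) ^ (k + 1) ≤ 2 ^ (k + 1) := by
      gcongr
      rw [div_le_iff₀ hb]; linarith
    rw [div_lt_iff₀ (by positivity)]
    nlinarith [norm_nonneg (waveOp k (locTime R (a * R / 2 ^ κ))
      (fun w => lpOp ((2 : ℝ) ^ κ) f (((2 : ℝ) ^ κ) • w)) (((2 : ℝ) ^ κ)⁻¹ • x))]

lemma lintegral_comp_smul_eq {φ : EuclideanSpace ℝ (Fin n) → ℝ≥0∞} (hφ : Measurable φ) {b : ℝ}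
    (hb : b ≠ 0) : ENNReal.ofReal |b ^ Module.finrank ℝ (EuclideanSpace ℝ (Fin n))| *
      ∫⁻ w, φ (b • w) = ∫⁻ w, φ w := by
  rw [← lintegral_map hφ (measurable_const_smul b), Measure.map_addHaar_smul _ hb,
    lintegral_smul_measure, smul_eq_mul, ← mul_assoc, ← ENNReal.ofReal_mul (abs_nonneg _),
    ← abs_mul, mul_inv_cancel₀ (pow_ne_zero _ hb), abs_one, ENNReal.ofReal_one, one_mul]

open scoped Pointwise in
lemma waveMax_weakType (hn : 4 ≤ n) {q ε : ℝ} (hq : 2 ≤ q)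
    (hqn : ((n : ℝ) - 1) * (1 / 2 - 1 / q) ≤ 1) (hε : 0 < ε) (hε1 : ε ≤ 1) {k : ℕ}
    (hk : (n : ℝ) + 1 ≤ ε * k) : ∃ C : ℝ, 0 < C ∧ ∀ R : ℝ, 1 ≤ R →
      ∀ f : EuclideanSpace ℝ (Fin n) → ℂ, Measurable f → Integrable f → ∀ s : ℝ, 0 < s →
      volume {x | ENNReal.ofReal s < waveMax (k + 1) R f x} ≤
        ENNReal.ofReal ((s / (C * R ^ (1 / 2 + ((n : ℝ) - 1) / 2 * (1 / 2 - 1 / q) + 2 * ε))) ^ (-q)) *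
          ∫⁻ w, ‖f w‖ₑ ^ q := by
  obtain ⟨C, hC, h⟩ := volume_locTime_gt_le hn hq hqn hε hε1 hk
  obtain ⟨C', hC', h'⟩ := exists_tsum_lintegral_lpOp_rpow_le n hq
  refine ⟨C * 2 ^ (k + 1) * C' ^ (1 / q), by positivity, fun R hR f hfm hf s hs => ?_⟩
  set e := 1 / 2 + ((n : ℝ) - 1) / 2 * (1 / 2 - 1 / q) + 2 * ε
  have hR0 : 0 < R := by linarith
  have hRe : 0 < R ^ e := Real.rpow_pos_of_pos hR0 _
  calc volume {x | ENNReal.ofReal s < waveMax (k + 1) R f x}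
      ≤ ∑' κ : ℤ, volume (((2 : ℝ) ^ κ) •
      {y | ∃ τ ∈ Set.Icc R (2 * R), s / 2 ^ (k + 1) <
        ‖waveOp k (locTime R τ) (fun w => lpOp ((2 : ℝ) ^ κ) f (((2 : ℝ) ^ κ) • w)) y‖}) :=
        (measure_mono (waveMax_gt_subset k hR hf s)).trans (measure_iUnion_le _)
    _ ≤ ∑' κ : ℤ, ENNReal.ofReal ((s / 2 ^ (k + 1) / (C * R ^ e)) ^ (-q)) *
        ∫⁻ x, ‖lpOp (1 * (2 : ℝ) ^ κ) f x‖ₑ ^ q := by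
        refine ENNReal.tsum_le_tsum fun κ => ?_
        have hb : (0 : ℝ) < 2 ^ κ := by positivity
        have hc := continuous_lpOp hb hf
        have hi := integrable_lpOp hb hf
        have h1 := h R hR (fun w => lpOp ((2 : ℝ) ^ κ) f (((2 : ℝ) ^ κ) • w))
          (hc.comp (continuous_const_smul _)).measurable (hi.comp_smul hb.ne')
          (s / 2 ^ (k + 1)) (by positivity)
        rw [Measure.addHaar_smul]
        refine (mul_le_mul' le_rfl h1).trans ?_
        rw [mul_left_comm, lintegral_comp_smul_eq (hc.measurable.enorm.pow_const q) hb.ne', one_mul]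
    _ ≤ ENNReal.ofReal ((s / 2 ^ (k + 1) / (C * R ^ e)) ^ (-q)) * (ENNReal.ofReal C' * ∫⁻ w, ‖f w‖ₑ ^ q) := by
        rw [ENNReal.tsum_mul_left]
        exact mul_le_mul' le_rfl (h' 1 one_pos f hfm hf)
    _ = _ := by
        rw [← mul_assoc, ← ENNReal.ofReal_mul (by positivity)]
        congr 2
        have : C' = (C' ^ (1 / q)) ^ q := by
          rw [← Real.rpow_mul hC'.le, one_div_mul_cancel (by positivity), Real.rpow_one]
        nth_rw 1 [this]
        rw [Real.rpow_neg (by positivity), Real.rpow_neg (by positivity), ← Real.inv_rpow (by positivity),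
          ← Real.inv_rpow (by positivity), ← Real.mul_rpow (by positivity) (by positivity)]
        congr 1
        field_simp

lemma enorm_integral_mul_le_hlMax {K : EuclideanSpace ℝ (Fin n) → ℂ} {C s : ℝ} (hC : 0 ≤ C)
    (hs : 0 < s) (hK : ∀ x, ‖K x‖ ≤ C * ((s ^ n)⁻¹ * (1 + ‖x‖ / s) ^ (-((n : ℝ) + 1))))
    {f : EuclideanSpace ℝ (Fin n) → ℂ} (hf : Measurable f) (x : EuclideanSpace ℝ (Fin n)) :
    ‖∫ y, K (x - y) * f y‖ₑ ≤ ENNReal.ofReal (C * 2 ^ (n + 2)) * hlMax (fun y => ‖f y‖ₑ) x := by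
  refine (enorm_integral_le_lintegral_enorm _).trans ?_
  rw [ENNReal.ofReal_mul hC, mul_assoc]
  refine le_trans ?_ (mul_le_mul' le_rfl (lintegral_rpow_le_hlMax _ hf.enorm x hs))
  rw [← lintegral_const_mul' _ _ ENNReal.ofReal_ne_top]
  refine lintegral_mono fun y => ?_
  rw [enorm_mul, ← mul_assoc, ← ENNReal.ofReal_mul hC, ← ofReal_norm (K _)]
  exact mul_le_mul' (ENNReal.ofReal_le_ofReal (hK _)) le_rfl

lemma exists_norm_waveKer_le_of_one_le (n : ℕ) {k : ℕ} (hn : 1 ≤ n) (hk : n + 1 ≤ k) :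
    ∃ C : ℝ, 0 < C ∧ ∀ R : ℝ, 1 ≤ R → ∀ x : EuclideanSpace ℝ (Fin n),
      ‖waveKer k (1 - (R : ℂ) * Complex.I) x‖ ≤
        C * R ^ (((n : ℝ) + 1) / 2) * ((R ^ n)⁻¹ * (1 + ‖x‖ / R) ^ (-((n : ℝ) + 1))) := by
  obtain ⟨C, hC, h⟩ := norm_waveKer_le n k
  refine ⟨C * 3 ^ (n + 1), by positivity, fun R hR x => ?_⟩
  have hR0 : 0 < R := by linarith
  refine (h _ (by simp; norm_num) (by simp) x).trans ?_
  have him : |(1 - (R : ℂ) * Complex.I).im| = R := by simp [abs_of_pos hR0]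
  rw [him]
  set r := ‖x‖
  have hr : 0 ≤ r := norm_nonneg x
  set D := 1 + abs (r - R)
  have hD : 1 ≤ D := by simp [D]
  have hn1 : (1 : ℝ) ≤ n := by exact_mod_cast hn
  have e1 : (1 + r + R) * ((1 + r + R) * D) ^ (-(((n : ℝ) + 1) / 2)) * D⁻¹ ^ k ≤
      (1 + r + R) ^ (-(((n : ℝ) - 1) / 2)) * (D ^ (n + 1))⁻¹ := by
    rw [Real.mul_rpow (by positivity) (by positivity), ← mul_assoc]
    have : (1 + r + R) * (1 + r + R) ^ (-(((n : ℝ) + 1) / 2)) = (1 + r + R) ^ (-(((n : ℝ) - 1) / 2)) := by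
      nth_rw 1 [← Real.rpow_one (1 + r + R)]
      rw [← Real.rpow_add (by positivity)]
      congr 1; ring
    rw [this, mul_assoc]
    refine mul_le_mul_of_nonneg_left ?_ (by positivity)
    have h1 : D ^ (-(((n : ℝ) + 1) / 2)) ≤ 1 := Real.rpow_le_one_of_one_le_of_nonpos hD (by linarith)
    have h2 : D⁻¹ ^ k ≤ (D ^ (n + 1))⁻¹ := by
      rw [inv_pow]
      gcongr
    calc _ ≤ 1 * (D ^ (n + 1))⁻¹ := mul_le_mul h1 h2 (by positivity) zero_le_one
      _ = _ := one_mul _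
  have e2 : (1 + r / R) ^ (-((n : ℝ) + 1)) = R ^ (n + 1) / (R + r) ^ (n + 1) := by
    rw [Real.rpow_neg (by positivity), show (n : ℝ) + 1 = ((n + 1 : ℕ) : ℝ) by push_cast; rfl,
      Real.rpow_natCast, show 1 + r / R = (R + r) / R by field_simp, div_pow, inv_div]
  have e3 : R ^ (((n : ℝ) + 1) / 2) = R ^ (-(((n : ℝ) - 1) / 2)) * R ^ n := by
    rw [← Real.rpow_natCast, ← Real.rpow_add hR0]
    congr 1; ring
  have key : (1 + r + R) ^ (-(((n : ℝ) - 1) / 2)) * (D ^ (n + 1))⁻¹ ≤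
      3 ^ (n + 1) * (R ^ (-(((n : ℝ) - 1) / 2)) * R ^ (n + 1) / (R + r) ^ (n + 1)) := by
    rcases le_total r (2 * R) with hrR | hrR
    · have h1 : (1 + r + R) ^ (-(((n : ℝ) - 1) / 2)) ≤ R ^ (-(((n : ℝ) - 1) / 2)) :=
        Real.rpow_le_rpow_of_nonpos hR0 (by linarith) (by linarith)
      have h2 : (D ^ (n + 1))⁻¹ ≤ 1 := inv_le_one_of_one_le₀ (one_le_pow₀ hD)
      have h3 : 1 ≤ 3 ^ (n + 1) * R ^ (n + 1) / (R + r) ^ (n + 1) := by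
        rw [one_le_div (by positivity), ← mul_pow]
        gcongr
        linarith
      calc _ ≤ R ^ (-(((n : ℝ) - 1) / 2)) * 1 := mul_le_mul h1 h2 (by positivity) (by positivity)
        _ ≤ R ^ (-(((n : ℝ) - 1) / 2)) * (3 ^ (n + 1) * R ^ (n + 1) / (R + r) ^ (n + 1)) := by
          gcongr
        _ = _ := by ring
    · have h1 : (1 + r + R) ^ (-(((n : ℝ) - 1) / 2)) ≤ 1 :=
        Real.rpow_le_one_of_one_le_of_nonpos (by linarith) (by linarith)
      have h2 : (D ^ (n + 1))⁻¹ ≤ 3 ^ (n + 1) / (R + r) ^ (n + 1) := by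
        rw [← div_pow, ← inv_pow]
        have : (R + r) / 3 ≤ D := by
          have := le_abs_self (r - R)
          simp only [D]; linarith
        rw [← inv_div]
        gcongr
      have h3 : 1 ≤ R ^ (-(((n : ℝ) - 1) / 2)) * R ^ (n + 1) := by
        rw [← Real.rpow_natCast, ← Real.rpow_add hR0]
        refine Real.one_le_rpow hR ?_
        push_cast; linarith
      calc _ ≤ 1 * (3 ^ (n + 1) / (R + r) ^ (n + 1)) := mul_le_mul h1 h2 (by positivity) (by positivity)
        _ ≤ (R ^ (-(((n : ℝ) - 1) / 2)) * R ^ (n + 1)) * (3 ^ (n + 1) / (R + r) ^ (n + 1)) := by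
          gcongr
        _ = _ := by ring
  calc _ ≤ C * (3 ^ (n + 1) * (R ^ (-(((n : ℝ) - 1) / 2)) * R ^ (n + 1) / (R + r) ^ (n + 1))) :=
        mul_le_mul_of_nonneg_left (e1.trans key) hC.le
    _ = _ := by
      rw [e2, e3]
      field_simp

lemma waveMax_weakType_one (hn : 1 ≤ n) {k : ℕ} (hk : n + 1 ≤ k) : ∃ C : ℝ, 0 < C ∧
    ∀ R : ℝ, 1 ≤ R → ∀ f : EuclideanSpace ℝ (Fin n) → ℂ, Measurable f → ∀ s : ℝ, 0 < s →
      volume {x | ENNReal.ofReal s < waveMax k R f x} ≤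
        ENNReal.ofReal ((s / (C * R ^ (((n : ℝ) + 1) / 2))) ^ (-(1 : ℝ))) * ∫⁻ w, ‖f w‖ₑ ^ (1 : ℝ) := by
  obtain ⟨C, hC, h⟩ := exists_norm_waveKer_le_of_one_le n hn hk
  obtain ⟨A, hA, hw⟩ := hlMax_weakType_rpow (n := n) hn le_rfl
  refine ⟨C * 2 ^ (n + 2) * A, by positivity, fun R hR f hf s hs => ?_⟩
  have hR0 : 0 < R := by linarith
  set Q := R ^ (((n : ℝ) + 1) / 2)
  have hQ : 0 < Q := Real.rpow_pos_of_pos hR0 _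
  have hb : ∀ x, waveMax k R f x ≤
      ENNReal.ofReal (C * Q * 2 ^ (n + 2)) * hlMax (fun y => ‖f y‖ₑ) x := by
    refine fun x => iSup₂_le fun a ha => ?_
    have hK : ∀ w : EuclideanSpace ℝ (Fin n),
        ‖((a ^ k : ℝ) : ℂ) * waveKer k ((a : ℂ) * (1 - (R : ℂ) * Complex.I)) w‖ ≤
          C * Q * (((a * R) ^ n)⁻¹ * (1 + ‖w‖ / (a * R)) ^ (-((n : ℝ) + 1))) := by
      intro w
      have hw' := waveKer_smul k (1 - (R : ℂ) * Complex.I) ha (a⁻¹ • w)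
      rw [smul_inv_smul₀ ha.ne'] at hw'
      rw [hw', ← mul_assoc, ← Complex.ofReal_mul, norm_mul, Complex.norm_real,
        Real.norm_of_nonneg (by positivity)]
      have hx := h R hR (a⁻¹ • w)
      rw [norm_smul, norm_inv, Real.norm_of_nonneg ha.le,
        show a⁻¹ * ‖w‖ / R = ‖w‖ / (a * R) by field_simp] at hx
      refine (mul_le_mul_of_nonneg_left hx (by positivity)).trans_eq ?_
      generalize (1 + ‖w‖ / (a * R)) ^ (-((n : ℝ) + 1)) = v
      rw [mul_pow, pow_add]
      field_simp
      exact mul_comm _ _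
    have h1 := enorm_integral_mul_le_hlMax (by positivity) (mul_pos ha hR0) hK hf x
    rw [waveOp, ← integral_const_mul]
    simpa only [mul_assoc] using h1
  calc volume {x | ENNReal.ofReal s < waveMax k R f x}
      ≤ volume {x | ENNReal.ofReal (s / (C * Q * 2 ^ (n + 2))) < hlMax (fun y => ‖f y‖ₑ) x} := by
        refine measure_mono fun x hx => ?_
        simp only [Set.mem_ofPred_eq] at hx ⊢
        have := hx.trans_le (hb x)
        by_contra! hcon
        refine absurd (this.trans_le (mul_le_mul' le_rfl hcon)) ?_
        rw [← ENNReal.ofReal_mul (by positivity), mul_div_cancel₀ _ (by positivity)]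
        exact lt_irrefl _
    _ ≤ _ := hw _ hf.enorm _ (by positivity)
    _ = _ := by
        congr 3
        field_simp

end

lemma measure_gt_le_of_weakType_one_two {E Ω : Type*} [MeasurableSpace E] [MeasurableSpace Ω]
    {μ : Measure Ω} {ν : Measure E} {T : (E → ℂ) → Ω → ℝ≥0∞}
    (hsub : ∀ f g : E → ℂ, Measurable f → Integrable f ν → Measurable g → Integrable g ν →
      ∀ ω, T (f + g) ω ≤ T f ω + T g ω)
    {p A₁ A₂ c : ℝ} (hp1 : 1 ≤ p) (hp2 : p ≤ 2) (hA₁ : 0 < A₁) (hA₂ : 0 < A₂) (hc : 0 < c)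
    (h1 : ∀ f : E → ℂ, Measurable f → Integrable f ν → ∀ t : ℝ, 0 < t →
      μ {ω | ENNReal.ofReal t < T f ω} ≤
        ENNReal.ofReal ((t / A₁) ^ (-(1 : ℝ))) * ∫⁻ x, ‖f x‖ₑ ^ (1 : ℝ) ∂ν)
    (h2 : ∀ f : E → ℂ, Measurable f → Integrable f ν → ∀ t : ℝ, 0 < t →
      μ {ω | ENNReal.ofReal t < T f ω} ≤
        ENNReal.ofReal ((t / A₂) ^ (-(2 : ℝ))) * ∫⁻ x, ‖f x‖ₑ ^ (2 : ℝ) ∂ν)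
    {f : E → ℂ} (hfm : Measurable f) (hf : Integrable f ν) {s : ℝ} (hs : 0 < s) :
    μ {ω | ENNReal.ofReal s < T f ω} ≤
      ENNReal.ofReal (s ^ (-p) * (2 * A₁ * c ^ (1 - p) + 4 * A₂ ^ 2 * c ^ (2 - p))) *
        ∫⁻ x, ‖f x‖ₑ ^ p ∂ν := by
  set S := {x | c * s < ‖f x‖}
  have hS : MeasurableSet S := measurableSet_lt measurable_const hfm.norm
  have hcs : 0 < c * s := by positivity
  have hsplit : f = S.indicator f + Sᶜ.indicator f := (Set.indicator_self_add_compl S f).symm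
  have hm1 := hfm.indicator hS
  have hm2 := hfm.indicator hS.compl
  have hi1 := hf.indicator hS
  have hi2 := hf.indicator hS.compl
  have b1 : ∫⁻ x, ‖S.indicator f x‖ₑ ^ (1 : ℝ) ∂ν ≤
      ENNReal.ofReal ((c * s) ^ (1 - p)) * ∫⁻ x, ‖f x‖ₑ ^ p ∂ν := by
    rw [← lintegral_const_mul' _ _ ENNReal.ofReal_ne_top]
    refine lintegral_mono fun x => ?_
    by_cases hx : x ∈ S
    · have hx' : c * s < ‖f x‖ := hx
      have h0 : 0 < ‖f x‖ := hcs.trans hx'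
      rw [Set.indicator_of_mem hx, ← ofReal_norm, ENNReal.ofReal_rpow_of_pos h0,
        ENNReal.ofReal_rpow_of_pos h0, ← ENNReal.ofReal_mul (by positivity)]
      refine ENNReal.ofReal_le_ofReal ?_
      calc ‖f x‖ ^ (1 : ℝ) = ‖f x‖ ^ (1 - p) * ‖f x‖ ^ p := by
            rw [← Real.rpow_add h0]; congr 1; ring
        _ ≤ _ := by
            gcongr ?_ * _
            exact Real.rpow_le_rpow_of_nonpos hcs hx'.le (by linarith)
    · simp [Set.indicator_of_notMem hx]
  have b2 : ∫⁻ x, ‖Sᶜ.indicator f x‖ₑ ^ (2 : ℝ) ∂ν ≤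
      ENNReal.ofReal ((c * s) ^ (2 - p)) * ∫⁻ x, ‖f x‖ₑ ^ p ∂ν := by
    rw [← lintegral_const_mul' _ _ ENNReal.ofReal_ne_top]
    refine lintegral_mono fun x => ?_
    by_cases hx : x ∈ S
    · simp [hx]
    · have hx' : ‖f x‖ ≤ c * s := not_lt.1 hx
      rw [Set.indicator_of_mem (Set.mem_compl hx)]
      rcases (norm_nonneg (f x)).eq_or_lt with h0 | h0
      · rw [norm_eq_zero.1 h0.symm]; simp
      rw [← ofReal_norm, ENNReal.ofReal_rpow_of_pos h0,
        ENNReal.ofReal_rpow_of_pos h0, ← ENNReal.ofReal_mul (by positivity)]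
      refine ENNReal.ofReal_le_ofReal ?_
      calc ‖f x‖ ^ (2 : ℝ) = ‖f x‖ ^ (2 - p) * ‖f x‖ ^ p := by
            rw [← Real.rpow_add h0]; congr 1; ring
        _ ≤ _ := by
            gcongr ?_ * _
            exact Real.rpow_le_rpow h0.le hx' (by linarith)
  have hsub' : {ω | ENNReal.ofReal s < T f ω} ⊆ {ω | ENNReal.ofReal (s / 2) < T (S.indicator f) ω} ∪
      {ω | ENNReal.ofReal (s / 2) < T (Sᶜ.indicator f) ω} := by
    intro ω hω
    by_contra! hcon
    simp only [Set.mem_union, Set.mem_ofPred_eq, not_or, not_lt] at hcon hω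
    have h := hsub _ _ hm1 hi1 hm2 hi2 ω
    rw [← hsplit] at h
    have := hω.trans_le (h.trans (add_le_add hcon.1 hcon.2))
    rw [← ENNReal.ofReal_add (by positivity) (by positivity), add_halves] at this
    exact lt_irrefl _ this
  refine (measure_mono hsub').trans ((measure_union_le _ _).trans ?_)
  refine (add_le_add ((h1 _ hm1 hi1 _ (half_pos hs)).trans (mul_le_mul' le_rfl b1))
    ((h2 _ hm2 hi2 _ (half_pos hs)).trans (mul_le_mul' le_rfl b2))).trans_eq ?_
  rw [← mul_assoc, ← mul_assoc, ← ENNReal.ofReal_mul (by positivity), ← ENNReal.ofReal_mul (by positivity),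
    ← add_mul, ← ENNReal.ofReal_add (by positivity) (by positivity)]
  congr 2
  rw [Real.mul_rpow hc.le hs.le, Real.mul_rpow hc.le hs.le, Real.rpow_neg_one,
    Real.rpow_neg (by positivity), Real.rpow_two, Real.rpow_sub hs, Real.rpow_sub hs, Real.rpow_one,
    Real.rpow_two, Real.rpow_neg hs.le]
  have : 0 < s ^ p := by positivity
  field_simp
  ring

section
variable {n : ℕ}

lemma waveMax_weakType_of_two_le (hn : 4 ≤ n) {a : ℝ} (ha : 2 ≤ a)
    (han : a < 2 * ((n : ℝ) - 1) / ((n : ℝ) - 3)) : ∃ δ : ℝ, 0 < δ ∧ ∃ k₀ : ℕ, ∀ k, k₀ ≤ k →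
      ∃ C : ℝ, 0 < C ∧ ∀ R : ℝ, 1 ≤ R → ∀ f : EuclideanSpace ℝ (Fin n) → ℂ, Measurable f →
        Integrable f → ∀ s : ℝ, 0 < s → volume {x | ENNReal.ofReal s < waveMax k R f x} ≤
          ENNReal.ofReal ((s / (C * R ^ (1 - δ))) ^ (-a)) * ∫⁻ w, ‖f w‖ₑ ^ a := by
  have hn' : (4 : ℝ) ≤ n := by exact_mod_cast hn
  have hgap : 0 < 1 - ((n : ℝ) - 1) * (1 / 2 - 1 / a) := by
    rw [lt_div_iff₀ (by linarith)] at han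
    have : 1 - ((n : ℝ) - 1) * (1 / 2 - 1 / a) = (2 * ((n : ℝ) - 1) - a * ((n : ℝ) - 3)) / (2 * a) := by
      field_simp; ring
    rw [this]
    have : 0 < 2 * ((n : ℝ) - 1) - a * ((n : ℝ) - 3) := by linarith
    positivity
  set gap := 1 - ((n : ℝ) - 1) * (1 / 2 - 1 / a) with hgd
  set ε := min 1 (gap / 8)
  have hε : 0 < ε := lt_min one_pos (by positivity)
  obtain ⟨k₁, hk₁⟩ := exists_nat_ge (((n : ℝ) + 1) / ε)
  refine ⟨gap / 4, by positivity, k₁ + 1, fun k hk => ?_⟩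
  obtain ⟨k, rfl⟩ : ∃ j, k = j + 1 := ⟨k - 1, by omega⟩
  have hk' : (n : ℝ) + 1 ≤ ε * k := by
    rw [div_le_iff₀ hε] at hk₁
    have : (k₁ : ℝ) ≤ k := by exact_mod_cast (by omega : k₁ ≤ k)
    nlinarith
  obtain ⟨C, hC, h⟩ := waveMax_weakType hn ha (by linarith) hε (min_le_left _ _) hk'
  refine ⟨C, hC, fun R hR f hfm hf s hs => (h R hR f hfm hf s hs).trans (mul_le_mul' ?_ le_rfl)⟩
  have hR0 : 0 < R := by linarith
  refine ENNReal.ofReal_le_ofReal (Real.rpow_le_rpow_of_nonpos (by positivity) ?_ (by linarith))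
  have h8 : ε ≤ gap / 8 := min_le_right _ _
  have : R ^ (1 / 2 + ((n : ℝ) - 1) / 2 * (1 / 2 - 1 / a) + 2 * ε) ≤ R ^ (1 - gap / 4) :=
    Real.rpow_le_rpow_of_exponent_le hR (by linarith)
  gcongr

lemma waveMax_weakType_of_lt_two (hn : 4 ≤ n) {a : ℝ} (ha : a < 2)
    (han : 2 * (n : ℝ) / ((n : ℝ) + 1) < a) : ∃ δ : ℝ, 0 < δ ∧ ∃ k₀ : ℕ, ∀ k, k₀ ≤ k →
      ∃ C : ℝ, 0 < C ∧ ∀ R : ℝ, 1 ≤ R → ∀ f : EuclideanSpace ℝ (Fin n) → ℂ, Measurable f →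
        Integrable f → ∀ s : ℝ, 0 < s → volume {x | ENNReal.ofReal s < waveMax k R f x} ≤
          ENNReal.ofReal ((s / (C * R ^ (1 - δ))) ^ (-a)) * ∫⁻ w, ‖f w‖ₑ ^ a := by
  have hn' : (4 : ℝ) ≤ n := by exact_mod_cast hn
  have ha1 : 1 < a := by
    refine lt_of_le_of_lt ?_ han
    rw [one_le_div (by positivity)]; linarith
  have hgap : 0 < a * ((n : ℝ) + 1) - 2 * n := by
    rw [div_lt_iff₀ (by positivity)] at han; linarith
  set gap := a * ((n : ℝ) + 1) - 2 * n with hgd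
  set ε := min 1 (gap / 16)
  have hε : 0 < ε := lt_min one_pos (by positivity)
  have h16 : ε ≤ gap / 16 := min_le_right _ _
  obtain ⟨k₁, hk₁⟩ := exists_nat_ge (((n : ℝ) + 1) / ε)
  refine ⟨gap / (4 * a), by positivity, max (n + 1) (k₁ + 1), fun k hk => ?_⟩
  have hkn : n + 1 ≤ k := (le_max_left _ _).trans hk
  have hkk : k₁ + 1 ≤ k := (le_max_right _ _).trans hk
  obtain ⟨C₁, hC₁, h1⟩ := waveMax_weakType_one (n := n) (by omega) hkn
  obtain ⟨k, rfl⟩ : ∃ j, k = j + 1 := ⟨k - 1, by omega⟩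
  have hk' : (n : ℝ) + 1 ≤ ε * k := by
    rw [div_le_iff₀ hε] at hk₁
    have : (k₁ : ℝ) ≤ k := by exact_mod_cast (by omega : k₁ ≤ k)
    nlinarith
  obtain ⟨C₂, hC₂, h2⟩ := waveMax_weakType hn le_rfl (by norm_num) hε (min_le_left _ _) hk'
  refine ⟨(2 * C₁ + 4 * C₂ ^ 2) ^ (1 / a), by positivity, fun R hR f hfm hf s hs => ?_⟩
  have hR0 : 0 < R := by linarith
  refine (measure_gt_le_of_weakType_one_two (T := waveMax (k + 1) R) (c := R ^ (((n : ℝ) - 1) / 2))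
    (fun f g _ hf _ hg => waveMax_add_le _ _ hf hg) ha1.le ha.le (by positivity) (by positivity)
    (by positivity) (fun f hfm _ => h1 R hR f hfm) (h2 R hR) hfm hf hs).trans
    (mul_le_mul' (ENNReal.ofReal_le_ofReal ?_) le_rfl)
  have hden : ((2 * C₁ + 4 * C₂ ^ 2) ^ (1 / a) * R ^ (1 - gap / (4 * a))) ^ (-a) =
      ((2 * C₁ + 4 * C₂ ^ 2) * R ^ ((1 - gap / (4 * a)) * a))⁻¹ := by
    rw [Real.rpow_neg (by positivity), Real.mul_rpow (by positivity) (by positivity),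
      ← Real.rpow_mul (by positivity), one_div_mul_cancel (by positivity), Real.rpow_one,
      ← Real.rpow_mul hR0.le]
  rw [Real.div_rpow hs.le (by positivity), hden, div_inv_eq_mul]
  refine mul_le_mul_of_nonneg_left ?_ (by positivity)
  have e1 : R ^ (((n : ℝ) + 1) / 2) * (R ^ (((n : ℝ) - 1) / 2)) ^ (1 - a) ≤
      R ^ ((1 - gap / (4 * a)) * a) := by
    rw [← Real.rpow_mul hR0.le, ← Real.rpow_add hR0]
    refine Real.rpow_le_rpow_of_exponent_le hR ?_
    have : (1 - gap / (4 * a)) * a = a - gap / 4 := by field_simp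
    rw [this]
    linarith
  have e2 : (R ^ (1 / 2 + ((n : ℝ) - 1) / 2 * (1 / 2 - 1 / 2) + 2 * ε)) ^ 2 *
      (R ^ (((n : ℝ) - 1) / 2)) ^ (2 - a) ≤ R ^ ((1 - gap / (4 * a)) * a) := by
    rw [← Real.rpow_natCast, ← Real.rpow_mul hR0.le, ← Real.rpow_mul hR0.le, ← Real.rpow_add hR0]
    refine Real.rpow_le_rpow_of_exponent_le hR ?_
    have : (1 - gap / (4 * a)) * a = a - gap / 4 := by field_simp
    rw [this]
    push_cast
    linarith
  calc _ = 2 * C₁ * (R ^ (((n : ℝ) + 1) / 2) * (R ^ (((n : ℝ) - 1) / 2)) ^ (1 - a)) +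
        4 * C₂ ^ 2 * ((R ^ (1 / 2 + ((n : ℝ) - 1) / 2 * (1 / 2 - 1 / 2) + 2 * ε)) ^ 2 *
          (R ^ (((n : ℝ) - 1) / 2)) ^ (2 - a)) := by ring
    _ ≤ 2 * C₁ * R ^ ((1 - gap / (4 * a)) * a) + 4 * C₂ ^ 2 * R ^ ((1 - gap / (4 * a)) * a) :=
        add_le_add (mul_le_mul_of_nonneg_left e1 (by positivity))
          (mul_le_mul_of_nonneg_left e2 (by positivity))
    _ = _ := by ring

lemma exists_waveMax_weakType (hn : 4 ≤ n) {a : ℝ} (han : 2 * (n : ℝ) / ((n : ℝ) + 1) < a)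
    (han' : a < 2 * ((n : ℝ) - 1) / ((n : ℝ) - 3)) : ∃ δ : ℝ, 0 < δ ∧ ∃ k₀ : ℕ, ∀ k, k₀ ≤ k →
      ∃ C : ℝ, 0 < C ∧ ∀ R : ℝ, 1 ≤ R → ∀ f : EuclideanSpace ℝ (Fin n) → ℂ, Measurable f →
        Integrable f → ∀ s : ℝ, 0 < s → volume {x | ENNReal.ofReal s < waveMax k R f x} ≤
          ENNReal.ofReal ((s / (C * R ^ (1 - δ))) ^ (-a)) * ∫⁻ w, ‖f w‖ₑ ^ a := by
  rcases lt_or_ge a 2 with h | h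
  · exact waveMax_weakType_of_lt_two hn h han
  · exact waveMax_weakType_of_two_le hn h han'

lemma exists_lintegral_waveMax_rpow_le (hn : 4 ≤ n) {p : ℝ}
    (hp1 : 2 * (n : ℝ) / ((n : ℝ) + 1) < p) (hp2 : p < 2 * ((n : ℝ) - 1) / ((n : ℝ) - 3)) :
    ∃ δ : ℝ, 0 < δ ∧ ∃ k₀ : ℕ, ∀ k, k₀ ≤ k → ∃ C : ℝ, 0 < C ∧ ∀ R : ℝ, 1 ≤ R →
      ∀ f : EuclideanSpace ℝ (Fin n) → ℂ, Measurable f → Integrable f →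
        ∫⁻ x, waveMax k R f x ^ p ≤
          ENNReal.ofReal ((C * R ^ (1 - δ)) ^ p) * ∫⁻ x, ‖f x‖ₑ ^ p := by
  obtain ⟨a, ha1, ha2⟩ := exists_between hp1
  obtain ⟨b, hb1, hb2⟩ := exists_between hp2
  obtain ⟨δ₁, hδ₁, k₁, h1⟩ := exists_waveMax_weakType hn ha1 (ha2.trans hp2)
  obtain ⟨δ₂, hδ₂, k₂, h2⟩ := exists_waveMax_weakType hn (hp1.trans hb1) hb2
  have ha0 : 0 < a := lt_of_le_of_lt (by positivity) ha1
  have hp0 : 0 < p := ha0.trans ha2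
  refine ⟨min δ₁ δ₂, lt_min hδ₁ hδ₂, max k₁ k₂, fun k hk => ?_⟩
  obtain ⟨C₁, hC₁, h1⟩ := h1 k ((le_max_left _ _).trans hk)
  obtain ⟨C₂, hC₂, h2⟩ := h2 k ((le_max_right _ _).trans hk)
  have hM : 0 < p / (p - a) + p / (b - p) :=
    add_pos (div_pos hp0 (by linarith)) (div_pos hp0 (by linarith))
  set M := p / (p - a) + p / (b - p)
  refine ⟨2 * max C₁ C₂ * M ^ (1 / p), by positivity, fun R hR f hfm hf => ?_⟩
  have hR0 : 0 < R := by linarith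
  have key : ∀ {C δ e : ℝ}, 0 < C → C ≤ max C₁ C₂ → min δ₁ δ₂ ≤ δ → 0 < e → ∀ t : ℝ, 0 < t →
      (t / (C * R ^ (1 - δ))) ^ (-e) ≤ (t / (max C₁ C₂ * R ^ (1 - min δ₁ δ₂))) ^ (-e) := by
    intro C δ e hC hC' hδ he t ht
    refine Real.rpow_le_rpow_of_nonpos (by positivity) ?_ (by linarith)
    have : R ^ (1 - δ) ≤ R ^ (1 - min δ₁ δ₂) := Real.rpow_le_rpow_of_exponent_le hR (by linarith)
    gcongr
  refine (lintegral_rpow_le_of_weakType (T := waveMax k R) (A := max C₁ C₂ * R ^ (1 - min δ₁ δ₂))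
    (fun f _ hf => measurable_waveMax k R hf)
    (fun f g _ hf _ hg => waveMax_add_le _ _ hf hg) ha0 ha2 hb1 (by positivity)
    (fun f hfm hf t ht => (h1 R hR f hfm hf t ht).trans (mul_le_mul' (ENNReal.ofReal_le_ofReal
      (key hC₁ (le_max_left _ _) (min_le_left _ _) ha0 t ht)) le_rfl))
    (fun f hfm hf t ht => (h2 R hR f hfm hf t ht).trans (mul_le_mul' (ENNReal.ofReal_le_ofReal
      (key hC₂ (le_max_right _ _) (min_le_right _ _) (by linarith) t ht)) le_rfl))
    hfm hf).trans_eq ?_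
  congr 2
  have e : M = (M ^ (1 / p)) ^ p := by
    rw [← Real.rpow_mul hM.le, one_div_mul_cancel hp0.ne', Real.rpow_one]
  change _ * M = _
  nth_rw 1 [e]
  rw [← Real.mul_rpow (by positivity) (by positivity)]
  congr 1
  ring

lemma lowerSemicontinuous_hlMax (φ : EuclideanSpace ℝ (Fin n) → ℝ≥0∞) :
    LowerSemicontinuous (hlMax φ) := by
  intro x c hc
  simp only [hlMax, lt_iSup_iff] at hc
  obtain ⟨r, hr, hc⟩ := hc
  set I := ∫⁻ y in closedBall x r, φ y
  have hcont : Tendsto (fun d : ℝ => I / ENNReal.ofReal ((r + d) ^ n)) (𝓝 0)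
      (𝓝 (I / ENNReal.ofReal ((r + 0) ^ n))) := by
    refine ENNReal.Tendsto.const_div ?_ (Or.inl ?_)
    · exact (ENNReal.continuous_ofReal.comp (by fun_prop)).tendsto 0
    · exact ENNReal.ofReal_ne_top
  rw [add_zero] at hcont
  have hev := hcont.eventually (lt_mem_nhds hc)
  have hd : Tendsto (fun x' => dist x' x) (𝓝 x) (𝓝 0) := by
    have : Continuous fun x' => dist x' x := by fun_prop
    simpa using this.tendsto x
  filter_upwards [hd.eventually hev] with x' hx'
  refine hx'.trans_le (le_trans ?_ (le_iSup₂ (f := fun (r : ℝ) (_ : 0 < r) =>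
    (∫⁻ y in closedBall x' r, φ y) / ENNReal.ofReal (r ^ n)) (r + dist x' x)
    (by have := dist_nonneg (x := x') (y := x); linarith)))
  gcongr
  refine lintegral_mono_set (closedBall_subset_closedBall' ?_)
  rw [dist_comm]

lemma hlMax_add_le {φ ψ : EuclideanSpace ℝ (Fin n) → ℝ≥0∞} (hφ : Measurable φ)
    (x : EuclideanSpace ℝ (Fin n)) : hlMax (φ + ψ) x ≤ hlMax φ x + hlMax ψ x := by
  refine iSup₂_le fun r hr => ?_
  simp only [Pi.add_apply]
  rw [lintegral_add_left hφ, ENNReal.add_div]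
  exact add_le_add
    (le_iSup₂ (f := fun (r : ℝ) (_ : 0 < r) =>
      (∫⁻ y in closedBall x r, φ y) / ENNReal.ofReal (r ^ n)) r hr)
    (le_iSup₂ (f := fun (r : ℝ) (_ : 0 < r) =>
      (∫⁻ y in closedBall x r, ψ y) / ENNReal.ofReal (r ^ n)) r hr)

lemma hlMax_mono {φ ψ : EuclideanSpace ℝ (Fin n) → ℝ≥0∞} (h : ∀ y, φ y ≤ ψ y)
    (x : EuclideanSpace ℝ (Fin n)) : hlMax φ x ≤ hlMax ψ x :=
  iSup₂_mono fun _ _ => ENNReal.div_le_div_right (lintegral_mono h) _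

lemma exists_lintegral_hlMax_rpow_le (hn : 0 < n) {p : ℝ} (hp : 1 < p) : ∃ C : ℝ, 0 < C ∧
    ∀ f : EuclideanSpace ℝ (Fin n) → ℂ, Measurable f → Integrable f →
      ∫⁻ x, hlMax (fun y => ‖f y‖ₑ) x ^ p ≤ ENNReal.ofReal C * ∫⁻ x, ‖f x‖ₑ ^ p := by
  obtain ⟨A, hA, h1⟩ := hlMax_weakType_rpow (n := n) hn le_rfl
  obtain ⟨B, hB, h2⟩ := hlMax_weakType_rpow (n := n) hn (a := p + 1) (by linarith)
  have key : ∀ {A' e : ℝ}, 0 < A' → A' ≤ max A B → 0 < e → ∀ t : ℝ, 0 < t →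
      (t / A') ^ (-e) ≤ (t / max A B) ^ (-e) := fun hA' h he t ht =>
    Real.rpow_le_rpow_of_nonpos (by positivity) (by gcongr) (by linarith)
  have hM : 0 < p / (p - 1) + p / (p + 1 - p) :=
    add_pos (div_pos (by linarith) (by linarith)) (div_pos (by linarith) (by linarith))
  refine ⟨(2 * max A B) ^ p * (p / (p - 1) + p / (p + 1 - p)), by positivity, fun f hfm hf => ?_⟩
  exact lintegral_rpow_le_of_weakType (T := fun f => hlMax (fun y => ‖f y‖ₑ)) (A := max A B)
    (fun f _ _ => (lowerSemicontinuous_hlMax _).measurable)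
    (fun f g hf _ _ _ x => (hlMax_mono (fun y => enorm_add_le (f y) (g y)) x).trans
      (hlMax_add_le hf.enorm x)) one_pos hp (by linarith) (by positivity)
    (fun f hfm _ t ht => (h1 _ hfm.enorm t ht).trans (mul_le_mul' (ENNReal.ofReal_le_ofReal
      (key hA (le_max_left _ _) one_pos t ht)) le_rfl))
    (fun f hfm _ t ht => (h2 _ hfm.enorm t ht).trans (mul_le_mul' (ENNReal.ofReal_le_ofReal
      (key hB (le_max_right _ _) (by linarith) t ht)) le_rfl))
    hfm hf

/-- The symbol `(sθ)^k e^{-sθ} e^{icθ}`. -/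
noncomputable def decaySym (k : ℕ) (s c θ : ℝ) : ℂ :=
  (((|s| * θ) ^ k * Real.exp (-(|s| * θ)) : ℝ) : ℂ) * Complex.exp (((c * θ : ℝ) : ℂ) * Complex.I)

lemma integral_pow_mul_exp_neg (k : ℕ) (θ : ℝ) :
    θ * ∫ s in (0 : ℝ)..1, (s * θ) ^ k * Real.exp (-(s * θ)) =
      k.factorial * (1 - Real.exp (-θ) * ∑ j ∈ Finset.range (k + 1), θ ^ j / j.factorial) := by
  induction k with
  | zero =>
    rw [← intervalIntegral.integral_const_mul]
    have hd : ∀ s ∈ Set.uIcc (0 : ℝ) 1, HasDerivAt (fun s => -Real.exp (-(s * θ)))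
        (θ * ((s * θ) ^ 0 * Real.exp (-(s * θ)))) s := by
      intro s _
      have h : HasDerivAt (fun s : ℝ => s * θ) θ s := by simpa using (hasDerivAt_id s).mul_const θ
      exact h.neg.exp.neg.congr_deriv (by simp; ring)
    rw [intervalIntegral.integral_eq_sub_of_hasDerivAt hd
      (Continuous.intervalIntegrable (by fun_prop) _ _)]
    simp
    ring
  | succ k ih =>
    have hd : ∀ s ∈ Set.uIcc (0 : ℝ) 1, HasDerivAt (fun s => -((s * θ) ^ (k + 1) * Real.exp (-(s * θ))))
        (θ * ((s * θ) ^ (k + 1) * Real.exp (-(s * θ))) -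
          (k + 1) * (θ * ((s * θ) ^ k * Real.exp (-(s * θ))))) s := by
      intro s _
      have h : HasDerivAt (fun s : ℝ => s * θ) θ s := by simpa using (hasDerivAt_id s).mul_const θ
      exact ((h.pow (k + 1)).mul h.neg.exp).neg.congr_deriv (by simp; ring)
    have h := intervalIntegral.integral_eq_sub_of_hasDerivAt hd
      (Continuous.intervalIntegrable (by fun_prop) _ _)
    rw [intervalIntegral.integral_sub (Continuous.intervalIntegrable (by fun_prop) _ _)
      (Continuous.intervalIntegrable (by fun_prop) _ _), intervalIntegral.integral_const_mul,
      intervalIntegral.integral_const_mul, intervalIntegral.integral_const_mul, ih] at h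
    rw [sub_eq_iff_eq_add] at h
    rw [h, Finset.sum_range_succ _ (k + 1), Nat.factorial_succ]
    have : (k.factorial : ℝ) ≠ 0 := by positivity
    push_cast
    simp only [one_mul, zero_mul]
    field_simp
    simp
    ring

lemma sin_div_eq_integral_cexp {θ : ℝ} (hθ : θ ≠ 0) :
    ((Real.sin θ / θ : ℝ) : ℂ) =
      (1 / 2) * ∫ h in (-1 : ℝ)..1, Complex.exp (((h * θ : ℝ) : ℂ) * Complex.I) := by
  have hθc : (θ : ℂ) * Complex.I ≠ 0 := mul_ne_zero (by exact_mod_cast hθ) Complex.I_ne_zero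
  have : ∀ h : ℝ, ((h * θ : ℝ) : ℂ) * Complex.I = (θ * Complex.I) * h := fun h => by push_cast; ring
  simp only [this]
  rw [integral_exp_mul_complex hθc]
  push_cast
  rw [Complex.sin]
  have h2 : (θ : ℂ) ≠ 0 := by exact_mod_cast hθ
  field_simp
  simp [mul_comm]

lemma sin_div_eq_sum_add_integral (k : ℕ) {θ : ℝ} (hθ : θ ≠ 0) :
    ((Real.sin θ / θ : ℝ) : ℂ) =
      (∑ j ∈ Finset.range (k + 1), (1 / (2 * j.factorial) : ℂ) * ∫ h in (-1 : ℝ)..1, decaySym j 1 h θ) +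
      (-Complex.I / (2 * k.factorial) : ℂ) * ((∫ s in (0 : ℝ)..1, decaySym k s 1 θ) -
        ∫ s in (0 : ℝ)..1, decaySym k s (-1) θ) := by
  have hθc : (θ : ℂ) ≠ 0 := by exact_mod_cast hθ
  have hk : (k.factorial : ℂ) ≠ 0 := by exact_mod_cast k.factorial_ne_zero
  have hlow : ∀ j, ∫ h in (-1 : ℝ)..1, decaySym j 1 h θ =
      ((θ ^ j * Real.exp (-θ) : ℝ) : ℂ) *
        ∫ h in (-1 : ℝ)..1, Complex.exp (((h * θ : ℝ) : ℂ) * Complex.I) := by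
    intro j
    rw [← intervalIntegral.integral_const_mul]
    simp [decaySym]
  have hhigh : ∀ c : ℝ, ∫ s in (0 : ℝ)..1, decaySym k s c θ =
      ((∫ s in (0 : ℝ)..1, (s * θ) ^ k * Real.exp (-(s * θ)) : ℝ) : ℂ) *
        Complex.exp (((c * θ : ℝ) : ℂ) * Complex.I) := by
    intro c
    rw [← intervalIntegral.integral_ofReal, ← intervalIntegral.integral_mul_const]
    refine intervalIntegral.integral_congr fun s hs => ?_
    rw [Set.uIcc_of_le zero_le_one] at hs
    simp only [decaySym, abs_of_nonneg hs.1]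
  have hI := integral_pow_mul_exp_neg k θ
  set J := ∫ s in (0 : ℝ)..1, (s * θ) ^ k * Real.exp (-(s * θ))
  have hJ : J = k.factorial * (1 - Real.exp (-θ) * ∑ j ∈ Finset.range (k + 1), θ ^ j / j.factorial) / θ := by
    rw [← hI]; field_simp
  have hs : Complex.exp (((1 * θ : ℝ) : ℂ) * Complex.I) - Complex.exp (((-1 * θ : ℝ) : ℂ) * Complex.I) =
      2 * Complex.I * ((Real.sin θ : ℝ) : ℂ) := by
    push_cast
    rw [Complex.sin]
    ring_nf
    simp only [Complex.I_sq]
    ring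
  have hE := sin_div_eq_integral_cexp hθ
  simp only [hlow, hhigh]
  set E := ∫ h in (-1 : ℝ)..1, Complex.exp (((h * θ : ℝ) : ℂ) * Complex.I)
  have hE' : E = 2 * ((Real.sin θ / θ : ℝ) : ℂ) := by rw [hE]; ring
  rw [← mul_sub, hs, hJ, hE']
  have hsum : ∑ j ∈ Finset.range (k + 1), (1 / (2 * j.factorial) : ℂ) *
      (((θ ^ j * Real.exp (-θ) : ℝ) : ℂ) * (2 * ((Real.sin θ / θ : ℝ) : ℂ))) =
      ((Real.sin θ / θ * (Real.exp (-θ) * ∑ j ∈ Finset.range (k + 1), θ ^ j / j.factorial) : ℝ) : ℂ) := by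
    rw [Finset.mul_sum, Finset.mul_sum, Complex.ofReal_sum]
    refine Finset.sum_congr rfl fun j _ => ?_
    push_cast
    field_simp
  rw [hsum]
  set X := Real.exp (-θ) * ∑ j ∈ Finset.range (k + 1), θ ^ j / j.factorial
  push_cast
  field_simp
  simp only [Complex.I_sq]
  ring

lemma norm_decaySym_le (k : ℕ) (s c : ℝ) {θ : ℝ} (hθ : 0 ≤ θ) :
    ‖decaySym k s c θ‖ ≤ k.factorial := by
  have hr : 0 ≤ |s| * θ := by positivity
  rw [decaySym, norm_mul, Complex.norm_exp_ofReal_mul_I, mul_one, Complex.norm_real,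
    Real.norm_of_nonneg (by positivity), Real.exp_neg, ← div_eq_mul_inv, div_le_iff₀ (by positivity)]
  have := Real.pow_div_factorial_le_exp _ hr k
  rwa [div_le_iff₀' (by positivity)] at this

@[fun_prop]
lemma Continuous.decaySym {X : Type*} [TopologicalSpace X] (k : ℕ) {s c θ : X → ℝ}
    (hs : Continuous s) (hc : Continuous c) (hθ : Continuous θ) :
    Continuous fun x => decaySym k (s x) (c x) (θ x) := by
  unfold _root_.decaySym
  fun_prop

/-- The operator with multiplier `decaySym k s c (2πt|ξ|)`, acting on the Fourier transform. -/
noncomputable def decayOp (k : ℕ) (s c t : ℝ) (F : EuclideanSpace ℝ (Fin n) → ℂ)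
    (x : EuclideanSpace ℝ (Fin n)) : ℂ :=
  ∫ ξ, Complex.exp (((2 * Real.pi * ⟪x, ξ⟫ : ℝ) : ℂ) * Complex.I) *
    (decaySym k s c (2 * Real.pi * t * ‖ξ‖) * F ξ)

lemma norm_decayOp_integrand_le (k : ℕ) (s c : ℝ) {t : ℝ} (ht : 0 ≤ t)
    (F : EuclideanSpace ℝ (Fin n) → ℂ) (x ξ : EuclideanSpace ℝ (Fin n)) :
    ‖Complex.exp (((2 * Real.pi * ⟪x, ξ⟫ : ℝ) : ℂ) * Complex.I) *
      (decaySym k s c (2 * Real.pi * t * ‖ξ‖) * F ξ)‖ ≤ k.factorial * ‖F ξ‖ := by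
  rw [norm_mul, Complex.norm_exp_ofReal_mul_I, one_mul, norm_mul]
  gcongr
  exact norm_decaySym_le k s c (by positivity)

lemma continuous_decayOp (k : ℕ) (c : ℝ) {t : ℝ} (ht : 0 ≤ t)
    {F : EuclideanSpace ℝ (Fin n) → ℂ} (hc : Continuous F) (hF : Integrable F) :
    Continuous fun q : ℝ × EuclideanSpace ℝ (Fin n) => decayOp k q.1 c t F q.2 := by
  unfold decayOp
  refine continuous_of_dominated (bound := fun ξ => k.factorial * ‖F ξ‖)
    (fun q => Continuous.aestronglyMeasurable (by fun_prop))
    (fun q => .of_forall fun ξ => norm_decayOp_integrand_le k q.1 c ht F q.2 ξ)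
    (hF.norm.const_mul _) (.of_forall fun ξ => by fun_prop)

lemma decayOp_eq_waveOp (k : ℕ) {s t : ℝ} (hs : 0 < s) (ht : 0 < t) (c : ℝ)
    {f : EuclideanSpace ℝ (Fin n) → ℂ} (hf : Integrable f) (x : EuclideanSpace ℝ (Fin n)) :
    decayOp k s c t (𝓕 f) x = (-1) ^ k * ((((s * t) ^ k : ℝ) : ℂ) *
      waveOp k (((s * t : ℝ) : ℂ) * (1 - ((c / s : ℝ) : ℂ) * Complex.I)) f x) := by
  rw [waveOp_eq k (by rw [mul_one_sub_mul_I_re]; positivity) hf, decayOp, ← integral_const_mul,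
    ← integral_const_mul]
  refine integral_congr_ae (.of_forall fun ξ => ?_)
  have : decaySym k s c (2 * Real.pi * t * ‖ξ‖) = (-1) ^ k * ((((s * t) ^ k : ℝ) : ℂ) *
      waveSym k (((s * t : ℝ) : ℂ) * (1 - ((c / s : ℝ) : ℂ) * Complex.I)) ξ) := by
    have hsc : (s : ℂ) ≠ 0 := by exact_mod_cast hs.ne'
    rw [decaySym, waveSym, abs_of_pos hs]
    push_cast
    have hpow : ((s : ℂ) * (2 * Real.pi * t * ‖ξ‖)) ^ k =
        (-1) ^ k * (((s : ℂ) * t) ^ k * (-(2 * Real.pi * ‖ξ‖ : ℂ)) ^ k) := by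
      rw [← mul_pow, ← mul_pow]
      congr 1
      ring
    have hexp : -((s : ℂ) * (2 * Real.pi * t * ‖ξ‖)) + c * (2 * Real.pi * t * ‖ξ‖) * Complex.I =
        -(2 * Real.pi * ‖ξ‖) * (s * t * (1 - c / s * Complex.I)) := by
      field_simp
      ring
    rw [mul_assoc, ← Complex.exp_add, hexp, hpow]
    ring
  simp only
  rw [this, real_inner_comm]
  ring

lemma integral_intervalIntegral_decay (k : ℕ) {t : ℝ} (ht : 0 ≤ t) {s c : ℝ → ℝ}
    (hs : Continuous s) (hcc : Continuous c) {a b : ℝ} (hab : a ≤ b)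
    {F : EuclideanSpace ℝ (Fin n) → ℂ} (hc : Continuous F) (hF : Integrable F)
    (x : EuclideanSpace ℝ (Fin n)) :
    Integrable (fun ξ => Complex.exp (((2 * Real.pi * ⟪x, ξ⟫ : ℝ) : ℂ) * Complex.I) *
      ((∫ h in a..b, decaySym k (s h) (c h) (2 * Real.pi * t * ‖ξ‖)) * F ξ)) ∧
    ∫ ξ, Complex.exp (((2 * Real.pi * ⟪x, ξ⟫ : ℝ) : ℂ) * Complex.I) *
      ((∫ h in a..b, decaySym k (s h) (c h) (2 * Real.pi * t * ‖ξ‖)) * F ξ) =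
      ∫ h in a..b, decayOp k (s h) (c h) t F x := by
  have hInt : Integrable (Function.uncurry fun (h : ℝ) (ξ : EuclideanSpace ℝ (Fin n)) =>
      Complex.exp (((2 * Real.pi * ⟪x, ξ⟫ : ℝ) : ℂ) * Complex.I) *
      (decaySym k (s h) (c h) (2 * Real.pi * t * ‖ξ‖) * F ξ))
      ((volume.restrict (Set.Ioc a b)).prod volume) := by
    refine Integrable.mono' (g := fun q : ℝ × EuclideanSpace ℝ (Fin n) => (k.factorial : ℝ) * ‖F q.2‖)
      ?_ (Continuous.aestronglyMeasurable ?_) (.of_forall fun q =>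
        norm_decayOp_integrand_le k _ _ ht F x q.2)
    · exact (integrable_const (k.factorial : ℝ)).mul_prod hF.norm
    · unfold Function.uncurry
      fun_prop
  have hpt : ∀ ξ : EuclideanSpace ℝ (Fin n), Complex.exp (((2 * Real.pi * ⟪x, ξ⟫ : ℝ) : ℂ) * Complex.I) *
      ((∫ h in a..b, decaySym k (s h) (c h) (2 * Real.pi * t * ‖ξ‖)) * F ξ) =
      ∫ h in Set.Ioc a b, Complex.exp (((2 * Real.pi * ⟪x, ξ⟫ : ℝ) : ℂ) * Complex.I) *
        (decaySym k (s h) (c h) (2 * Real.pi * t * ‖ξ‖) * F ξ) := by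
    intro ξ
    rw [integral_const_mul, integral_mul_const, intervalIntegral.integral_of_le hab]
  simp only [hpt]
  refine ⟨hInt.integral_prod_right, ?_⟩
  rw [intervalIntegral.integral_of_le hab]
  exact (integral_integral_swap hInt).symm

lemma enorm_decayOp_one_le_waveMax (k : ℕ) {s t : ℝ} (hs : 0 < s) (ht : 0 < t)
    {f : EuclideanSpace ℝ (Fin n) → ℂ} (hf : Integrable f) (x : EuclideanSpace ℝ (Fin n)) :
    ‖decayOp k s 1 t (𝓕 f) x‖ₑ ≤ waveMax k s⁻¹ f x := by
  rw [decayOp_eq_waveOp k hs ht 1 hf, enorm_mul, enorm_pow, enorm_neg, enorm_one, one_pow, one_mul,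
    one_div]
  exact le_iSup₂ (f := fun (a : ℝ) (_ : 0 < a) =>
      ‖((a ^ k : ℝ) : ℂ) * waveOp k ((a : ℂ) * (1 - ((s⁻¹ : ℝ) : ℂ) * Complex.I)) f x‖ₑ) (s * t)
      (mul_pos hs ht)

lemma waveOp_conj (k : ℕ) (z : ℂ) (f : EuclideanSpace ℝ (Fin n) → ℂ) (x : EuclideanSpace ℝ (Fin n)) :
    waveOp k (starRingEnd ℂ z) f x =
      starRingEnd ℂ (waveOp k z (fun y => starRingEnd ℂ (f y)) x) := by
  simp only [waveOp, ← integral_conj, waveKer_conj, map_mul, Complex.conj_conj]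

lemma enorm_decayOp_neg_one_le_waveMax (k : ℕ) {s t : ℝ} (hs : 0 < s) (ht : 0 < t)
    {f : EuclideanSpace ℝ (Fin n) → ℂ} (hf : Integrable f) (x : EuclideanSpace ℝ (Fin n)) :
    ‖decayOp k s (-1) t (𝓕 f) x‖ₑ ≤ waveMax k s⁻¹ (fun y => starRingEnd ℂ (f y)) x := by
  have hz : ((s * t : ℝ) : ℂ) * (1 - ((-1 / s : ℝ) : ℂ) * Complex.I) =
      starRingEnd ℂ (((s * t : ℝ) : ℂ) * (1 - ((s⁻¹ : ℝ) : ℂ) * Complex.I)) := by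
    simp only [map_mul, map_sub, map_one, Complex.conj_ofReal, Complex.conj_I]
    push_cast
    ring
  rw [decayOp_eq_waveOp k hs ht (-1) hf, hz, waveOp_conj, enorm_mul, enorm_pow, enorm_neg, enorm_one,
    one_pow, one_mul, enorm_mul, RCLike.enorm_conj, ← enorm_mul]
  exact le_iSup₂ (f := fun (a : ℝ) (_ : 0 < a) =>
      ‖((a ^ k : ℝ) : ℂ) * waveOp k ((a : ℂ) * (1 - ((s⁻¹ : ℝ) : ℂ) * Complex.I))
        (fun y => starRingEnd ℂ (f y)) x‖ₑ) (s * t) (mul_pos hs ht)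

lemma exists_enorm_decayOp_le_hlMax (n k : ℕ) : ∃ C : ℝ, 0 < C ∧ ∀ c t : ℝ, |c| ≤ 1 → 0 < t →
    ∀ f : EuclideanSpace ℝ (Fin n) → ℂ, Measurable f → Integrable f → ∀ x,
      ‖decayOp k 1 c t (𝓕 f) x‖ₑ ≤ ENNReal.ofReal C * hlMax (fun y => ‖f y‖ₑ) x := by
  obtain ⟨C, hC, h⟩ := norm_waveKer_le_of_abs_im_le n k
  refine ⟨C * 2 ^ (n + 2), by positivity, fun c t hc ht f hfm hf x => ?_⟩
  have hK : ∀ w : EuclideanSpace ℝ (Fin n),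
      ‖((t ^ k : ℝ) : ℂ) * waveKer k ((t : ℂ) * (1 - (c : ℂ) * Complex.I)) w‖ ≤
        C * ((t ^ n)⁻¹ * (1 + ‖w‖ / t) ^ (-((n : ℝ) + 1))) := by
    intro w
    have hw' := waveKer_smul k (1 - (c : ℂ) * Complex.I) ht (t⁻¹ • w)
    rw [smul_inv_smul₀ ht.ne'] at hw'
    rw [hw', ← mul_assoc, ← Complex.ofReal_mul, norm_mul, Complex.norm_real,
      Real.norm_of_nonneg (by positivity)]
    have hx := h (1 - (c : ℂ) * Complex.I) (by simp; norm_num) (by simp) (by simpa using hc) (t⁻¹ • w)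
    rw [norm_smul, norm_inv, Real.norm_of_nonneg ht.le, inv_mul_eq_div] at hx
    refine (mul_le_mul_of_nonneg_left hx (by positivity)).trans_eq ?_
    generalize (1 + ‖w‖ / t) ^ (-((n : ℝ) + 1)) = v
    rw [pow_add]
    field_simp
  have h1 := enorm_integral_mul_le_hlMax hC.le ht hK hfm x
  rw [decayOp_eq_waveOp k one_pos ht c hf, enorm_mul, enorm_pow, enorm_neg, enorm_one, one_pow,
    one_mul, one_mul, div_one, waveOp, ← integral_const_mul]
  simpa only [mul_assoc] using h1

end

/-- Minkowski's integral inequality with prescribed bounds `w s` on the fibre norms. -/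
lemma lintegral_rpow_lintegral_le {α β : Type*} [MeasurableSpace α] [MeasurableSpace β]
    {μ : Measure α} {ν : Measure β} [SFinite μ] [SFinite ν] {p : ℝ} (hp : 1 < p)
    {Φ : α × β → ℝ≥0∞} (hΦ : Measurable Φ) {w : α → ℝ≥0∞} (hw : Measurable w)
    (hw' : ∀ᵐ s ∂μ, w s ≠ 0 ∧ w s ≠ ⊤) {A : ℝ≥0∞}
    (h : ∀ᵐ s ∂μ, ∫⁻ x, Φ (s, x) ^ p ∂ν ≤ w s ^ p * A) :
    ∫⁻ x, (∫⁻ s, Φ (s, x) ∂μ) ^ p ∂ν ≤ (∫⁻ s, w s ∂μ) ^ p * A := by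
  have hp0 : 0 < p := by linarith
  set q := p / (p - 1) with hq
  have hpq : p.HolderConjugate q := .conjExponent hp
  have hqp : 1 / q * p = p - 1 := by
    rw [hq]
    have : p - 1 ≠ 0 := by linarith
    field_simp
  set W := ∫⁻ s, w s ∂μ with hW
  have hholder : ∀ x, (∫⁻ s, Φ (s, x) ∂μ) ^ p ≤
      (∫⁻ s, Φ (s, x) ^ p * w s ^ (-(p - 1)) ∂μ) * W ^ (p - 1) := by
    intro x
    have h1 := ENNReal.lintegral_mul_le_Lp_mul_Lq μ hpq
      (f := fun s => Φ (s, x) * w s ^ (-(1 / q))) (g := fun s => w s ^ (1 / q))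
      (by fun_prop) (by fun_prop)
    have h2 : ∫⁻ s, Φ (s, x) ∂μ = ∫⁻ s, ((fun s => Φ (s, x) * w s ^ (-(1 / q))) *
        fun s => w s ^ (1 / q)) s ∂μ := by
      refine lintegral_congr_ae ?_
      filter_upwards [hw'] with s hs
      rw [Pi.mul_apply, mul_assoc, ← ENNReal.rpow_add _ _ hs.1 hs.2]
      simp
    have h3 : ∀ s, (Φ (s, x) * w s ^ (-(1 / q))) ^ p = Φ (s, x) ^ p * w s ^ (-(p - 1)) := by
      intro s
      rw [ENNReal.mul_rpow_of_nonneg _ _ hp0.le, ← ENNReal.rpow_mul, neg_mul, hqp]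
    have h4 : ∀ s, (w s ^ (1 / q)) ^ q = w s := by
      intro s
      rw [← ENNReal.rpow_mul, one_div_mul_cancel hpq.symm.ne_zero, ENNReal.rpow_one]
    rw [← h2] at h1
    simp only [h3, h4] at h1
    refine (ENNReal.rpow_le_rpow h1 hp0.le).trans_eq ?_
    rw [ENNReal.mul_rpow_of_nonneg _ _ hp0.le, ← ENNReal.rpow_mul, ← ENNReal.rpow_mul, hqp,
      one_div_mul_cancel hp0.ne', ENNReal.rpow_one]
  have hmeas : Measurable fun z : β × α => Φ (z.2, z.1) ^ p * w z.2 ^ (-(p - 1)) := by fun_prop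
  calc ∫⁻ x, (∫⁻ s, Φ (s, x) ∂μ) ^ p ∂ν
      ≤ ∫⁻ x, (∫⁻ s, Φ (s, x) ^ p * w s ^ (-(p - 1)) ∂μ) * W ^ (p - 1) ∂ν :=
        lintegral_mono hholder
    _ = (∫⁻ s, ∫⁻ x, Φ (s, x) ^ p * w s ^ (-(p - 1)) ∂ν ∂μ) * W ^ (p - 1) := by
        rw [lintegral_mul_const _ hmeas.lintegral_prod_right', lintegral_lintegral_swap]
        exact hmeas.aemeasurable
    _ ≤ (∫⁻ s, w s * A ∂μ) * W ^ (p - 1) := by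
        refine mul_le_mul' (lintegral_mono_ae ?_) le_rfl
        filter_upwards [hw', h] with s hs hsb
        rw [lintegral_mul_const _ (by fun_prop)]
        refine (mul_le_mul' hsb le_rfl).trans_eq ?_
        rw [mul_right_comm, ← ENNReal.rpow_add _ _ hs.1 hs.2]
        simp
    _ = W ^ p * A := by
        rw [lintegral_mul_const _ hw, ← hW, mul_right_comm]
        congr 1
        nth_rw 1 [← ENNReal.rpow_one W]
        rw [← ENNReal.rpow_add_of_nonneg _ _ zero_le_one (by linarith)]
        simp

section
variable {n : ℕ}

/-- The maximal function of `decayOp`. -/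
noncomputable def decayMax (k : ℕ) (c : ℝ) (F : EuclideanSpace ℝ (Fin n) → ℂ)
    (q : ℝ × EuclideanSpace ℝ (Fin n)) : ℝ≥0∞ :=
  ⨆ (t : ℝ) (_ : 0 < t), ‖decayOp k q.1 c t F q.2‖ₑ

lemma measurable_decayMax (k : ℕ) (c : ℝ) {F : EuclideanSpace ℝ (Fin n) → ℂ}
    (hc : Continuous F) (hF : Integrable F) : Measurable (decayMax k c F) := by
  refine LowerSemicontinuous.measurable (lowerSemicontinuous_biSup fun t ht => ?_)
  exact (continuous_decayOp k c ht.le hc hF).enorm.lowerSemicontinuous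

lemma le_decayMax (k : ℕ) (s c : ℝ) {t : ℝ} (ht : 0 < t) (F : EuclideanSpace ℝ (Fin n) → ℂ)
    (x : EuclideanSpace ℝ (Fin n)) : ‖decayOp k s c t F x‖ₑ ≤ decayMax k c F (s, x) :=
  le_iSup₂ (f := fun (t : ℝ) (_ : 0 < t) => ‖decayOp k s c t F x‖ₑ) t ht

lemma integral_sin_div_mul_eq (hn : 0 < n) (k : ℕ) {t : ℝ} (ht : 0 < t)
    {F : EuclideanSpace ℝ (Fin n) → ℂ} (hc : Continuous F) (hF : Integrable F)
    (x : EuclideanSpace ℝ (Fin n)) :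
    (t⁻¹ : ℝ) • ∫ ξ, Complex.exp (((2 * Real.pi * ⟪x, ξ⟫ : ℝ) : ℂ) * Complex.I) *
      ((Real.sin (2 * Real.pi * t * ‖ξ‖) / (2 * Real.pi * ‖ξ‖) : ℝ) : ℂ) * F ξ =
    (∑ j ∈ Finset.range (k + 1), (1 / (2 * j.factorial) : ℂ) *
        ∫ h in (-1 : ℝ)..1, decayOp j 1 h t F x) +
      (-Complex.I / (2 * k.factorial) : ℂ) * ((∫ s in (0 : ℝ)..1, decayOp k s 1 t F x) -
        ∫ s in (0 : ℝ)..1, decayOp k s (-1) t F x) := by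
  have : Nonempty (Fin n) := ⟨⟨0, hn⟩⟩
  have h1 := fun j => integral_intervalIntegral_decay j ht.le (continuous_const (y := (1 : ℝ)))
    continuous_id (show (-1 : ℝ) ≤ 1 by norm_num) hc hF x
  have h2 := fun c : ℝ => integral_intervalIntegral_decay k ht.le continuous_id
    (continuous_const (y := c)) (zero_le_one' ℝ) hc hF x
  simp only [id] at h1 h2
  rw [← (h2 1).2, ← (h2 (-1)).2, ← integral_sub (h2 1).1 (h2 (-1)).1, ← integral_const_mul]
  simp only [← (h1 _).2, ← integral_const_mul]
  rw [← integral_finsetSum _ fun j _ => (h1 j).1.const_mul _, ← integral_smul]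
  refine Eq.trans (integral_congr_ae ?_) (integral_add
    (integrable_finsetSum _ fun j _ => (h1 j).1.const_mul _)
    (((h2 1).1.sub (h2 (-1)).1).const_mul _))
  filter_upwards [Measure.ae_ne volume 0] with ξ hξ
  have hξ' : 0 < ‖ξ‖ := norm_pos_iff.2 hξ
  have hθ : 2 * Real.pi * t * ‖ξ‖ ≠ 0 := by positivity
  have hsin : ((Real.sin (2 * Real.pi * t * ‖ξ‖) / (2 * Real.pi * ‖ξ‖) : ℝ) : ℂ) =
      t * ((Real.sin (2 * Real.pi * t * ‖ξ‖) / (2 * Real.pi * t * ‖ξ‖) : ℝ) : ℂ) := by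
    rw [← Complex.ofReal_mul]
    congr 1
    field_simp
  have htc : (t : ℂ) ≠ 0 := by exact_mod_cast ht.ne'
  rw [hsin, sin_div_eq_sum_add_integral k hθ, Complex.real_smul, Complex.ofReal_inv]
  simp only [add_mul, mul_add, Finset.sum_mul, Finset.mul_sum]
  congr 1
  · refine Finset.sum_congr rfl fun j _ => ?_
    field_simp
  · field_simp

lemma fourierT_eq (f : EuclideanSpace ℝ (Fin n) → ℂ) : fourierT f = 𝓕 f := by
  ext ξ
  rw [Real.fourier_eq', fourierT]
  refine integral_congr_ae (.of_forall fun x => ?_)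
  simp only [smul_eq_mul]
  congr 3
  ring_nf

lemma enorm_intervalIntegral_le {a b : ℝ} (hab : a ≤ b) (f : ℝ → ℂ) :
    ‖∫ s in a..b, f s‖ₑ ≤ ∫⁻ s in Set.Ioc a b, ‖f s‖ₑ := by
  rw [intervalIntegral.integral_of_le hab]
  exact enorm_integral_le_lintegral_enorm _

lemma enorm_div_two_mul_factorial_le {z : ℂ} (hz : ‖z‖ ≤ 1) (k : ℕ) :
    ‖z / (2 * k.factorial)‖ₑ ≤ 1 := by
  have h1 : (1 : ℝ) ≤ k.factorial := by exact_mod_cast Nat.one_le_iff_ne_zero.2 k.factorial_ne_zero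
  rw [← ofReal_norm, ENNReal.ofReal_le_one, norm_div, norm_mul, Complex.norm_natCast,
    Complex.norm_two]
  exact div_le_one_of_le₀ (by linarith) (by linarith)

lemma exists_enorm_inv_smul_waveSol_le (hn : 0 < n) (k : ℕ) : ∃ C : ℝ, 0 < C ∧
    ∀ f : EuclideanSpace ℝ (Fin n) → ℂ, Measurable f → Integrable f → Integrable (𝓕 f) →
      ∀ t : ℝ, 0 < t → ∀ x, ‖(t⁻¹ : ℝ) • waveSol n f x t‖ₑ ≤
        ENNReal.ofReal C * hlMax (fun y => ‖f y‖ₑ) x +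
          ((∫⁻ s in Set.Ioc (0 : ℝ) 1, decayMax k 1 (𝓕 f) (s, x)) +
            ∫⁻ s in Set.Ioc (0 : ℝ) 1, decayMax k (-1) (𝓕 f) (s, x)) := by
  choose B hB hBle using exists_enorm_decayOp_le_hlMax n
  refine ⟨∑ j ∈ Finset.range (k + 1), B j * 2, Finset.sum_pos (fun j _ => by linarith [hB j])
    (by simp), fun f hfm hf hF t ht x => ?_⟩
  rw [waveSol, fourierT_eq, integral_sin_div_mul_eq hn k ht (continuous_fourier hf) hF]
  refine (enorm_add_le _ _).trans (add_le_add ?_ ?_)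
  · refine (enorm_sum_le _ _).trans ?_
    rw [ENNReal.ofReal_sum_of_nonneg fun j _ => by linarith [hB j], Finset.sum_mul]
    refine Finset.sum_le_sum fun j _ => ?_
    rw [enorm_mul]
    refine (mul_le_mul' (enorm_div_two_mul_factorial_le (by simp) j)
      (enorm_intervalIntegral_le (by norm_num) _)).trans ?_
    rw [one_mul]
    calc ∫⁻ h in Set.Ioc (-1 : ℝ) 1, ‖decayOp j 1 h t (𝓕 f) x‖ₑ
        ≤ ∫⁻ _ in Set.Ioc (-1 : ℝ) 1, ENNReal.ofReal (B j) * hlMax (fun y => ‖f y‖ₑ) x :=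
          setLIntegral_mono measurable_const fun h hh =>
            hBle j h t (abs_le.2 ⟨hh.1.le, hh.2⟩) ht f hfm hf x
      _ = ENNReal.ofReal (B j * 2) * hlMax (fun y => ‖f y‖ₑ) x := by
          rw [setLIntegral_const, Real.volume_Ioc, ENNReal.ofReal_mul (hB j).le, mul_right_comm]
          norm_num
  · rw [enorm_mul]
    refine (mul_le_mul' (enorm_div_two_mul_factorial_le (by simp) k) (enorm_sub_le)).trans ?_
    rw [one_mul]
    refine add_le_add ?_ ?_ <;>
    exact (enorm_intervalIntegral_le zero_le_one _).trans
      (lintegral_mono fun s => le_decayMax k s _ ht _ x)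

lemma lintegral_rpow_lintegral_decayMax_le {p δ C : ℝ} (hp : 1 < p) (hδ : 0 < δ) (hC : 0 < C)
    {k : ℕ} {c : ℝ} {F : EuclideanSpace ℝ (Fin n) → ℂ} (hc : Continuous F) (hF : Integrable F)
    {f : EuclideanSpace ℝ (Fin n) → ℂ}
    (hle : ∀ s : ℝ, 0 < s → ∀ x, decayMax k c F (s, x) ≤ waveMax k s⁻¹ f x)
    (hmax : ∀ R : ℝ, 1 ≤ R →
      ∫⁻ x, waveMax k R f x ^ p ≤ ENNReal.ofReal ((C * R ^ (1 - δ)) ^ p) * ∫⁻ x, ‖f x‖ₑ ^ p) :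
    ∫⁻ x, (∫⁻ s in Set.Ioc (0 : ℝ) 1, decayMax k c F (s, x)) ^ p ≤
      ENNReal.ofReal (C / δ) ^ p * ∫⁻ x, ‖f x‖ₑ ^ p := by
  have hp0 : 0 ≤ p := by linarith
  have hw : ∫⁻ s in Set.Ioc (0 : ℝ) 1, ENNReal.ofReal (C * s ^ (δ - 1)) =
      ENNReal.ofReal (C / δ) := by
    rw [← ofReal_integral_eq_lintegral_ofReal]
    · rw [← intervalIntegral.integral_of_le zero_le_one, intervalIntegral.integral_const_mul,
        integral_rpow (Or.inl (by linarith))]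
      simp [hδ.ne', div_eq_mul_inv]
    · exact (intervalIntegrable_iff_integrableOn_Ioc_of_le zero_le_one).1
        ((intervalIntegral.intervalIntegrable_rpow' (by linarith)).const_mul C)
    · filter_upwards [ae_restrict_mem measurableSet_Ioc] with s hs
      have := hs.1
      positivity
  rw [← hw]
  refine lintegral_rpow_lintegral_le hp (measurable_decayMax k c hc hF) (by fun_prop) ?_ ?_
  · filter_upwards [ae_restrict_mem measurableSet_Ioc] with s hs
    have := hs.1
    exact ⟨(ENNReal.ofReal_pos.2 (by positivity)).ne', ENNReal.ofReal_ne_top⟩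
  · filter_upwards [ae_restrict_mem measurableSet_Ioc] with s hs
    refine (lintegral_mono fun x => ENNReal.rpow_le_rpow (hle s hs.1 x) hp0).trans
      ((hmax s⁻¹ ((one_le_inv₀ hs.1).2 hs.2)).trans_eq ?_)
    have := hs.1
    rw [ENNReal.ofReal_rpow_of_nonneg (by positivity) hp0, Real.inv_rpow hs.1.le,
      ← Real.rpow_neg hs.1.le, neg_sub]

end

/-- The maximal estimate `‖sup_{t>0} t⁻¹|u(·,t)|‖_{L^p} ≤ C‖g‖_{L^p}` for the solution of the
wave equation with vanishing initial position, for `n ≥ 4` and `2n/(n+1) < p < 2(n-1)/(n-3)`. -/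
theorem wave_maximal_estimate (n : ℕ) (hn : 4 ≤ n) (p : ℝ)
    (hp1 : 2 * (n : ℝ) / ((n : ℝ) + 1) < p) (hp2 : p < 2 * ((n : ℝ) - 1) / ((n : ℝ) - 3)) :
    ∃ C : ℝ, 0 < C ∧ ∀ g : SchwartzMap (EuclideanSpace ℝ (Fin n)) ℂ,
      (∫⁻ x, (⨆ (t : ℝ) (_ : 0 < t),
          (‖(t⁻¹ : ℝ) • waveSol n (fun y => g y) x t‖₊ : ℝ≥0∞)) ^ p) ^ (1 / p) ≤
        ENNReal.ofReal C * eLpNorm (fun y => g y) (ENNReal.ofReal p) volume := by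
  obtain ⟨δ, hδ, k, hk⟩ := exists_lintegral_waveMax_rpow_le hn hp1 hp2
  obtain ⟨C, hC, hmax⟩ := hk k le_rfl
  have hn4 : (4 : ℝ) ≤ n := by exact_mod_cast hn
  have hp : 1 < p := by
    refine lt_of_le_of_lt ?_ hp1
    rw [le_div_iff₀ (by linarith)]
    linarith
  have hp0 : 0 < p := by linarith
  obtain ⟨A, hA, hhl⟩ := exists_lintegral_hlMax_rpow_le (n := n) (by omega) hp
  obtain ⟨B, hB, hpt⟩ := exists_enorm_inv_smul_waveSol_le (n := n) (by omega) k
  set D : ℝ := 2 ^ (p - 1) * (B ^ p * A + 2 ^ (p - 1) * (2 * (C / δ) ^ p)) with hD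
  have hD0 : 0 < D := by positivity
  refine ⟨D ^ (1 / p), by positivity, fun g => ?_⟩
  set f : EuclideanSpace ℝ (Fin n) → ℂ := fun y => g y with hf_def
  have hfm : Measurable f := g.continuous.measurable
  have hf : Integrable f := g.integrable
  have hF : Integrable (𝓕 f) := by
    have := (𝓕 g).integrable (μ := volume)
    rwa [SchwartzMap.fourier_coe] at this
  have hFc : Continuous (𝓕 f) := continuous_fourier hf
  set J := ∫⁻ x, ‖f x‖ₑ ^ p with hJ
  have hplus := lintegral_rpow_lintegral_decayMax_le (k := k) (c := 1) hp hδ hC hFc hF (f := f)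
    (fun s hs x => iSup₂_le fun t ht => enorm_decayOp_one_le_waveMax k hs ht hf x)
    (fun R hR => hmax R hR f hfm hf)
  have hminus := lintegral_rpow_lintegral_decayMax_le (k := k) (c := -1) hp hδ hC hFc hF
    (f := fun y => starRingEnd ℂ (f y))
    (fun s hs x => iSup₂_le fun t ht => enorm_decayOp_neg_one_le_waveMax k hs ht hf x)
    (fun R hR => hmax R hR _ (Complex.continuous_conj.measurable.comp hfm)
      (Complex.conjCLE.integrable_comp_iff.2 hf))
  simp only [RCLike.enorm_conj] at hminus
  rw [← hJ] at hplus hminus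
  have hmeas : ∀ c, Measurable fun x =>
      (∫⁻ s in Set.Ioc (0 : ℝ) 1, decayMax k c (𝓕 f) (s, x)) ^ p := fun c =>
    (measurable_decayMax k c hFc hF).lintegral_prod_left'.pow_const p
  have hadd : ∀ a b : ℝ≥0∞, (a + b) ^ p ≤ ENNReal.ofReal (2 ^ (p - 1)) * (a ^ p + b ^ p) := by
    intro a b
    refine (ENNReal.rpow_add_le_mul_rpow_add_rpow a b hp.le).trans_eq ?_
    rw [← ENNReal.ofReal_rpow_of_pos two_pos, ENNReal.ofReal_ofNat]
  have hmain : ∫⁻ x, (⨆ (t : ℝ) (_ : 0 < t),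
      (‖(t⁻¹ : ℝ) • waveSol n f x t‖₊ : ℝ≥0∞)) ^ p ≤ ENNReal.ofReal D * J := by
    calc _ ≤ ∫⁻ x, ENNReal.ofReal (2 ^ (p - 1)) *
          (ENNReal.ofReal (B ^ p) * hlMax (fun y => ‖f y‖ₑ) x ^ p + ENNReal.ofReal (2 ^ (p - 1)) *
            ((∫⁻ s in Set.Ioc (0 : ℝ) 1, decayMax k 1 (𝓕 f) (s, x)) ^ p +
            (∫⁻ s in Set.Ioc (0 : ℝ) 1, decayMax k (-1) (𝓕 f) (s, x)) ^ p)) := by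
          refine lintegral_mono fun x => (ENNReal.rpow_le_rpow
            (iSup₂_le fun t ht => hpt f hfm hf hF t ht x) hp0.le).trans ((hadd _ _).trans ?_)
          refine mul_le_mul' le_rfl (add_le_add ?_ (hadd _ _))
          rw [ENNReal.mul_rpow_of_nonneg _ _ hp0.le, ENNReal.ofReal_rpow_of_pos hB]
      _ = ENNReal.ofReal (2 ^ (p - 1)) *
          (ENNReal.ofReal (B ^ p) * (∫⁻ x, hlMax (fun y => ‖f y‖ₑ) x ^ p) +
            ENNReal.ofReal (2 ^ (p - 1)) *
            ((∫⁻ x, (∫⁻ s in Set.Ioc (0 : ℝ) 1, decayMax k 1 (𝓕 f) (s, x)) ^ p) +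
            ∫⁻ x, (∫⁻ s in Set.Ioc (0 : ℝ) 1, decayMax k (-1) (𝓕 f) (s, x)) ^ p)) := by
          have h1 := hmeas 1
          have h2 := hmeas (-1)
          rw [lintegral_const_mul' _ _ ENNReal.ofReal_ne_top, lintegral_add_right _
            (by fun_prop), lintegral_const_mul' _ _ ENNReal.ofReal_ne_top,
            lintegral_const_mul' _ _ ENNReal.ofReal_ne_top, lintegral_add_right _ h2]
      _ ≤ ENNReal.ofReal (2 ^ (p - 1)) * (ENNReal.ofReal (B ^ p) * (ENNReal.ofReal A * J) +
            ENNReal.ofReal (2 ^ (p - 1)) * (ENNReal.ofReal (C / δ) ^ p * J +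
              ENNReal.ofReal (C / δ) ^ p * J)) := by
          gcongr
          exact hhl f hfm hf
      _ = ENNReal.ofReal D * J := by
          rw [hD, ENNReal.ofReal_mul (by positivity), ENNReal.ofReal_add (by positivity)
            (by positivity), ENNReal.ofReal_mul (by positivity), ENNReal.ofReal_mul
            (by positivity), ENNReal.ofReal_mul (by positivity), ENNReal.ofReal_ofNat,
            ENNReal.ofReal_rpow_of_pos (by positivity)]
          ring
  have hpe : ENNReal.ofReal p ≠ 0 := (ENNReal.ofReal_pos.2 hp0).ne'
  rw [eLpNorm_eq_lintegral_rpow_enorm_toReal hpe ENNReal.ofReal_ne_top, ENNReal.toReal_ofReal hp0.le,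
    ← ENNReal.ofReal_rpow_of_pos hD0, ← ENNReal.mul_rpow_of_nonneg _ _ (by positivity)]
  exact ENNReal.rpow_le_rpow hmain (by positivity)
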